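/- Let X ⊂ ℙ^r be the Segre embedding of ℙ^{n_1} × ⋯ × ℙ^{n_s} over an algebraically closed field of characteristic 0, with n = n_1 + ⋯ + n_s and r = −1 + ∏(n_i+1). Assume that for each i ∈ {1,…,s} there exists j ∈ {1,…,s} \ {i} with n_j = n_i, and that dim σ_{k+n−1}(X) = (k+n−1)(n+1)−1 < r. Then X is not weakly j-defective, and hence is j-identifiable, for every j ≤ k. -/

import Mathlib

noncomputable section

namespace ContactLoci

variable {K : Type*} [Field K] {ι : Type*} [Fintype ι]

/-- Projective space over `K` with homogeneous coordinates indexed by `ι`. -/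
abbrev PP (K : Type*) [Field K] (ι : Type*) : Type _ :=
  Projectivization K (ι → K)

/-- The affine cone over a set of projective points. -/
def coneOf (S : Set (PP K ι)) : Set (ι → K) :=
  ⋃ x ∈ S, (x.submodule : Set (ι → K))

/-- The linear span, in the underlying vector space, of the cone over `S`. -/
def vspan (S : Set (PP K ι)) : Submodule K (ι → K) :=
  Submodule.span K (coneOf S)

/-- The projective linear span of a set of projective points. -/
def projSpan (S : Set (PP K ι)) : Set (PP K ι) :=
  {x | x.submodule ≤ vspan S}

/-- The projective dimension of the linear span of `S` (`-1` for `S = ∅`). -/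
def projDim (S : Set (PP K ι)) : ℤ :=
  (Module.finrank K (vspan S) : ℤ) - 1

/-- A set of projective points is non-degenerate if its linear span is everything. -/
def Nondegenerate (S : Set (PP K ι)) : Prop :=
  vspan S = ⊤

/-- The common zero locus in projective space of a set of polynomials. -/
def zeroLocus (S : Set (MvPolynomial ι K)) : Set (PP K ι) :=
  {x | ∀ f ∈ S, ∀ v ∈ x.submodule, MvPolynomial.eval v f = 0}

/-- Zariski-closed subsets of projective space: common zero loci of sets of
homogeneous polynomials. -/
def IsZClosed (X : Set (PP K ι)) : Prop :=
  ∃ S : Set (MvPolynomial ι K), (∀ f ∈ S, ∃ d : ℕ, f.IsHomogeneous d) ∧ X = zeroLocus S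

/-- Zariski closure. -/
def zclosure (S : Set (PP K ι)) : Set (PP K ι) :=
  ⋂₀ {Y | IsZClosed Y ∧ S ⊆ Y}

/-- Irreducibility with respect to the Zariski topology. -/
def IsZIrreducible (S : Set (PP K ι)) : Prop :=
  S.Nonempty ∧ ∀ Y Z : Set (PP K ι), IsZClosed Y → IsZClosed Z → S ⊆ Y ∪ Z → S ⊆ Y ∨ S ⊆ Z

/-- An integral projective variety: a Zariski-closed irreducible subset. -/
def IsIntegralVariety (X : Set (PP K ι)) : Prop :=
  IsZClosed X ∧ IsZIrreducible X

/-- `C` is an irreducible component of `S`: a maximal irreducible subset of `S`. -/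
def IsZIrredComponent (S C : Set (PP K ι)) : Prop :=
  IsZIrreducible C ∧ C ⊆ S ∧ ∀ D : Set (PP K ι), IsZIrreducible D → D ⊆ S → C ⊆ D → C = D

/-- The dimension of a set: the Krull dimension of the poset of irreducible
Zariski-closed subsets of its Zariski closure (`⊥` for the empty set). -/
def zdim (S : Set (PP K ι)) : WithBot ℕ∞ :=
  Order.krullDim ({Y : Set (PP K ι) // IsZClosed Y ∧ IsZIrreducible Y ∧ Y ⊆ zclosure S})

/-- A property holds at a general point of `X`: it holds away from a proper
Zariski-closed subset. -/
def HoldsGenerically (X : Set (PP K ι)) (P : PP K ι → Prop) : Prop :=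
  ∃ Y : Set (PP K ι), IsZClosed Y ∧ ¬X ⊆ Y ∧ ∀ x ∈ X \ Y, P x

/-- Zero locus of multihomogeneous polynomials in a self-product of projective space. -/
def multiZeroLocus {m : ℕ} (S : Set (MvPolynomial (Fin m × ι) K)) :
    Set (Fin m → PP K ι) :=
  {u | ∀ f ∈ S, ∀ v : Fin m → ι → K, (∀ i, v i ∈ (u i).submodule) →
    MvPolynomial.eval (fun p => v p.1 p.2) f = 0}

/-- Zariski-closed subsets of the `m`-fold self-product of projective space. -/
def IsMultiZClosed {m : ℕ} (T : Set (Fin m → PP K ι)) : Prop :=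
  ∃ S : Set (MvPolynomial (Fin m × ι) K),
    (∀ f ∈ S, ∀ i : Fin m, ∃ d : ℕ,
      MvPolynomial.IsWeightedHomogeneous (fun p : Fin m × ι => if p.1 = i then 1 else 0) f d) ∧
    T = multiZeroLocus S

/-- A property holds for a general `m`-tuple of points of `X`. -/
def HoldsForGeneralTuples (X : Set (PP K ι)) (m : ℕ) (P : (Fin m → PP K ι) → Prop) : Prop :=
  ∃ T : Set (Fin m → PP K ι), IsMultiZClosed T ∧
    (∃ u : Fin m → PP K ι, (∀ i, u i ∈ X) ∧ u ∉ T) ∧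
    ∀ u : Fin m → PP K ι, (∀ i, u i ∈ X) → u ∉ T → P u

/-- The homogeneous vanishing ideal of `X` (as a set of homogeneous polynomials). -/
def homogVanishingIdeal (X : Set (PP K ι)) : Set (MvPolynomial ι K) :=
  {f | (∃ d : ℕ, f.IsHomogeneous d) ∧ ∀ x ∈ X, ∀ v ∈ x.submodule, MvPolynomial.eval v f = 0}

/-- The embedded (projective) tangent space of `X` at `x`. -/
def embTangentSpace (X : Set (PP K ι)) (x : PP K ι) : Set (PP K ι) :=
  {y | ∀ f ∈ homogVanishingIdeal X,
    ∑ i : ι, y.rep i * MvPolynomial.eval x.rep (MvPolynomial.pderiv i f) = 0}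

/-- Smooth points of `X`. -/
def IsSmoothPoint (X : Set (PP K ι)) (x : PP K ι) : Prop :=
  x ∈ X ∧ zdim (embTangentSpace X x) = zdim X

/-- `M_A`: the linear span of the tangent spaces of `X` at the points of `A`. -/
def tangentSpan (X A : Set (PP K ι)) : Set (PP K ι) :=
  projSpan (⋃ a ∈ A, embTangentSpace X a)

/-- The locus of smooth points of `X` at which `M_A` is tangent to `X`. -/
def tangencyLocus (X A : Set (PP K ι)) : Set (PP K ι) :=
  {x | IsSmoothPoint X x ∧ embTangentSpace X x ⊆ tangentSpan X A}

/-- The tangential contact locus of `X` at `A`: the closure of the union of the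
irreducible components of the tangency locus meeting `A`. -/
def contactLocus (X A : Set (PP K ι)) : Set (PP K ι) :=
  zclosure (⋃ C ∈ {C : Set (PP K ι) |
    IsZIrredComponent (tangencyLocus X A) C ∧ (C ∩ A).Nonempty}, C)

/-- `X` is weakly `k`-defective: the tangential contact locus at `k` general points
has positive dimension. -/
def WeaklyDefective (X : Set (PP K ι)) (k : ℕ) : Prop :=
  HoldsForGeneralTuples X k fun u => 0 < zdim (contactLocus X (Set.range u))

/-- The `k`-th secant variety of `X`. -/
def secant (k : ℕ) (X : Set (PP K ι)) : Set (PP K ι) :=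
  zclosure {q | ∃ S : Finset (PP K ι), ↑S ⊆ X ∧ S.card = k ∧ q ∈ projSpan (S : Set (PP K ι))}

/-- The `X`-rank of a point. -/
def xrank (X : Set (PP K ι)) (q : PP K ι) : ℕ :=
  sInf {k | ∃ S : Finset (PP K ι), ↑S ⊆ X ∧ S.card = k ∧ q ∈ projSpan (S : Set (PP K ι))}

/-- `𝒮(q,X)`: the set of minimal `X`-decompositions of `q`. -/
def decompositions (X : Set (PP K ι)) (q : PP K ι) : Set (Finset (PP K ι)) :=
  {S | ↑S ⊆ X ∧ S.card = xrank X q ∧ q ∈ projSpan (S : Set (PP K ι))}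

/-- `X` is `k`-identifiable: a general point of `σ_k(X)` has a unique minimal
decomposition. -/
def Identifiable (X : Set (PP K ι)) (k : ℕ) : Prop :=
  HoldsGenerically (secant k X) fun q => ∃! S : Finset (PP K ι), S ∈ decompositions X q

/-- `α` is the `k`-th secant degree of `X`. -/
def HasSecantDegree (X : Set (PP K ι)) (k α : ℕ) : Prop :=
  HoldsGenerically (secant k X) fun q => (decompositions X q).ncard = α

/-- Projective linear subspaces. -/
def IsProjLinear (L : Set (PP K ι)) : Prop :=
  L = projSpan L

/-- Lines in projective space. -/
def IsLine (L : Set (PP K ι)) : Prop :=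
  IsProjLinear L ∧ Module.finrank K (vspan L) = 2

/-- `X` is uniruled by lines: through a general point of `X` there is a line
contained in `X`. -/
def UniruledByLines (X : Set (PP K ι)) : Prop :=
  HoldsGenerically X fun x => ∃ L : Set (PP K ι), IsLine L ∧ x ∈ L ∧ L ⊆ X

/-- The join of two sets in projective space. -/
def join (A B : Set (PP K ι)) : Set (PP K ι) :=
  zclosure (⋃ a ∈ A, ⋃ b ∈ B, projSpan {a, b})

/-- The linear space `M` is tangent to `X` along `W`. -/
def TangentAlong (M X W : Set (PP K ι)) : Prop :=
  ∀ x ∈ W, IsSmoothPoint X x → embTangentSpace X x ⊆ M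

/-- `S` has exactly `m` irreducible components, all of them projective linear
subspaces, and these components are linearly independent. -/
def ComponentsAreIndepLinear (S : Set (PP K ι)) (m : ℕ) : Prop :=
  ∃ C : Fin m → Set (PP K ι), Function.Injective C ∧
    (∀ D : Set (PP K ι), IsZIrredComponent S D ↔ ∃ i, D = C i) ∧
    (∀ i, IsProjLinear (C i)) ∧
    Module.finrank K (vspan S) = ∑ i, Module.finrank K (vspan (C i))


/-- The Segre variety: the image of `ℙ^{n 1} × ⋯ × ℙ^{n s}` under the Segre
embedding, given by the complete linear system `|O(1,…,1)|`. -/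
def segreVariety (K : Type*) [Field K] (s : ℕ) (n : Fin s → ℕ) :
    Set (PP K (∀ i : Fin s, Fin (n i + 1))) :=
  {x | ∃ u : ∀ i : Fin s, Fin (n i + 1) → K,
    x.submodule = Submodule.span K
      ({fun t => ∏ i, u i (t i)} : Set ((∀ i : Fin s, Fin (n i + 1)) → K))}

/-- The projection of `L ⊆ Segre` to the `i`-th factor is a single point, i.e. `L`
lies in a single fiber of the `i`-th projection. -/
def SegreFactorIsPoint (K : Type*) [Field K] (s : ℕ) (n : Fin s → ℕ) (i : Fin s)
    (L : Set (PP K (∀ j : Fin s, Fin (n j + 1)))) : Prop :=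
  ∃ w : Fin (n i + 1) → K, w ≠ 0 ∧ ∀ x ∈ L,
    ∃ u : ∀ j : Fin s, Fin (n j + 1) → K,
      x.submodule = Submodule.span K
        ({fun t => ∏ j, u j (t j)} : Set ((∀ j : Fin s, Fin (n j + 1)) → K)) ∧
      u i ∈ Submodule.span K ({w} : Set (Fin (n i + 1) → K))

/-- Index type for the Segre–Veronese embedding of multidegree `d`:
multi-indices of degree `d i` in the homogeneous variables of the `i`-th factor. -/
abbrev svIndex (s : ℕ) (n d : Fin s → ℕ) : Type :=
  ∀ i : Fin s, {w : Fin (n i + 1) → Fin (d i + 1) // ∑ j, (w j : ℕ) = d i}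

/-- The Segre–Veronese variety of multidegree `d`: the image of
`ℙ^{n 1} × ⋯ × ℙ^{n s}` under the embedding by `|L_1^{d 1} ⊗ ⋯ ⊗ L_s^{d s}|`. -/
def segreVeroneseVariety (K : Type*) [Field K] (s : ℕ) (n d : Fin s → ℕ) :
    Set (PP K (svIndex s n d)) :=
  {x | ∃ u : ∀ i : Fin s, Fin (n i + 1) → K,
    x.submodule = Submodule.span K
      ({fun t => ∏ i, ∏ j, u i j ^ ((t i).1 j : ℕ)} : Set (svIndex s n d → K))}

/-- The vector of the moments of degree `≤ d` of the one-dimensional Gaussian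
distribution with mean `μ` and variance `t`. -/
def gaussMomentVec (K : Type*) [Field K] (d : ℕ) (μ t : K) : Fin (d + 1) → K := fun i =>
  ∑ j ∈ Finset.range ((i : ℕ) / 2 + 1),
    ((Nat.choose (i : ℕ) (2 * j) * Nat.doubleFactorial (2 * j - 1) : ℕ) : K) *
      t ^ j * μ ^ ((i : ℕ) - 2 * j)

/-- The Gaussian moment variety `𝒢_{1,d} ⊆ ℙ^d`. -/
def gaussianMomentVariety (K : Type*) [Field K] (d : ℕ) : Set (PP K (Fin (d + 1))) :=
  zclosure {x | ∃ μ t : K,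
    x.submodule = Submodule.span K ({gaussMomentVec K d μ t} : Set (Fin (d + 1) → K))}

/-- Zariski-closed families of `m`-tuples of coefficient vectors of linear forms. -/
def IsAffineClosedFamily {m : ℕ} (T : Set (Fin m → ι → K)) : Prop :=
  ∃ S : Set (MvPolynomial (Fin m × ι) K),
    T = {h | ∀ f ∈ S, MvPolynomial.eval (fun p => h p.1 p.2) f = 0}

/-- The linear subspace cut out by the `m` linear forms with coefficient vectors `h`. -/
def linearSlice {m : ℕ} (h : Fin m → ι → K) : Set (PP K ι) :=
  {x | ∀ j : Fin m, ∑ i : ι, h j i * x.rep i = 0}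

/-- `x` lies on the hyperplane with coefficient vector `f`. -/
def inHyperplane (f : ι → K) (x : PP K ι) : Prop :=
  ∑ i : ι, f i * x.rep i = 0

/-- `X ⊆ ℙ^r` (of dimension `n`, `r + 1 = card ι`) is very strange: for a general
codimension-`n` linear subspace `M`, some `r - n + 2` points of `X ∩ M` lie in a
hyperplane of `M`, i.e. in a linear subspace of projective dimension `r - n - 1`. -/
def VeryStrange (n : ℕ) (X : Set (PP K ι)) : Prop :=
  ∃ T : Set (Fin n → ι → K), IsAffineClosedFamily T ∧ (∃ h, h ∉ T) ∧
    ∀ h : Fin n → ι → K, h ∉ T →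
      ∃ A : Finset (PP K ι), ↑A ⊆ X ∩ linearSlice h ∧
        A.card = Fintype.card ι + 1 - n ∧
        Module.finrank K (vspan (A : Set (PP K ι))) ≤ Fintype.card ι - 1 - n


universe uK

section part1
set_option linter.unusedSectionVars false
set_option linter.unusedVariables false
open Finset Function


abbrev Idx {s : ℕ} (n : Fin s → ℕ) : Type := ∀ i : Fin s, Fin (n i + 1)
abbrev Par {s : ℕ} (n : Fin s → ℕ) (R : Type*) : Type _ := ∀ i : Fin s, Fin (n i + 1) → R

section alg
variable {s : ℕ} {n : Fin s → ℕ} {R : Type*} [CommRing R]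

def tenM (n : Fin s → ℕ) (R : Type*) [CommRing R] :
    MultilinearMap R (fun i : Fin s => Fin (n i + 1) → R) (Idx n → R) :=
  MultilinearMap.pi (fun t => (MultilinearMap.mkPiAlgebra R (Fin s) R).compLinearMap
    (fun i => LinearMap.proj (t i)))

def ten (u : Par n R) : Idx n → R := tenM n R u

lemma ten_apply (u : Par n R) (t : Idx n) : ten u t = ∏ i, u i (t i) := by
  simp [ten, tenM]

def dten (u : Par n R) : Par n R →ₗ[R] (Idx n → R) :=
  ∑ i, ((tenM n R).toLinearMap u i) ∘ₗ LinearMap.proj i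

lemma dten_apply (u v : Par n R) : dten u v = ∑ i, ten (update u i (v i)) := by
  simp [dten, ten]

def II (u w : Par n R) : Par n R →ₗ[R] (Idx n → R) :=
  ∑ i, ∑ j ∈ univ.erase i, ((tenM n R).toLinearMap (update u i (w i)) j) ∘ₗ LinearMap.proj j

lemma II_apply (u w v : Par n R) :
    II u w v = ∑ i, ∑ j ∈ univ.erase i, ten (update (update u i (w i)) j (v j)) := by
  simp [II, ten, LinearMap.sum_apply]

lemma II_symm (u w v : Par n R) : II u w v = II u v w := by
  rw [II_apply, II_apply]
  have h : ∀ f : Fin s → Fin s → (Idx n → R), ∑ i, ∑ j ∈ univ.erase i, f i j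
      = ∑ i, ∑ j, if i = j then 0 else f i j := by
    intro f
    refine Finset.sum_congr rfl fun i _ => ?_
    rw [← Finset.sum_erase (a := i) (s := univ) (f := fun j => if i = j then 0 else f i j) (by simp)]
    refine Finset.sum_congr rfl fun j hj => ?_
    rw [if_neg (Ne.symm (Finset.ne_of_mem_erase hj))]
  rw [h, h, Finset.sum_comm]
  refine Finset.sum_congr rfl fun i _ => Finset.sum_congr rfl fun j _ => ?_
  by_cases hij : i = j
  · simp [hij]
  · rw [if_neg hij, if_neg (Ne.symm hij), update_comm (Ne.symm hij)]

lemma ten_smul_update (u : Par n R) (i : Fin s) (c : R) (x : Fin (n i + 1) → R) :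
    ten (update u i (c • x)) = c • ten (update u i x) := (tenM n R).map_update_smul u i c x

lemma ten_zero (u : Par n R) (i : Fin s) (h : u i = 0) : ten u = 0 :=
  (tenM n R).map_coord_zero i h

lemma dten_mu (u : Par n R) (μ : Fin s → R) :
    dten u (fun i => μ i • u i) = (∑ i, μ i) • ten u := by
  rw [dten_apply, Finset.sum_smul]
  refine Finset.sum_congr rfl fun i _ => ?_
  rw [ten_smul_update, update_eq_self]

lemma II_mu (u w : Par n R) (μ : Fin s → R) :
    II u w (fun i => μ i • u i) = dten u (fun i => (∑ j ∈ univ.erase i, μ j) • w i) := by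
  rw [II_apply, dten_apply]
  refine Finset.sum_congr rfl fun i _ => ?_
  rw [ten_smul_update, Finset.sum_smul]
  refine Finset.sum_congr rfl fun j hj => ?_
  rw [ten_smul_update, update_eq_self_iff.2]
  rw [update_of_ne (Finset.ne_of_mem_erase hj)]

section map
variable {S : Type*} [CommRing S] (φ : R →+* S)
def pmap {R S : Type*} (φ : R → S) (u : Par n R) : Par n S := fun i p => φ (u i p)

lemma pmap_update (φ : R → S) (u : Par n R) (i : Fin s) (x : Fin (n i + 1) → R) :
    pmap φ (update u i x) = update (pmap φ u) i (fun p => φ (x p)) := by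
  funext l p
  by_cases h : l = i
  · subst h; simp [pmap]
  · simp [pmap, update_of_ne h]

lemma ten_map (u : Par n R) (t : Idx n) : φ (ten u t) = ten (pmap φ u) t := by
  simp [ten_apply, pmap]

lemma dten_map (u v : Par n R) (t : Idx n) : φ (dten u v t) = dten (pmap φ u) (pmap φ v) t := by
  simp only [dten_apply, Finset.sum_apply, map_sum, ten_map, pmap_update]; rfl

lemma II_map (u w v : Par n R) (t : Idx n) :
    φ (II u w v t) = II (pmap φ u) (pmap φ w) (pmap φ v) t := by
  simp only [II_apply, Finset.sum_apply, map_sum, ten_map, pmap_update]; rfl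
end map

section der
variable {K : Type*} [CommRing K] [Algebra K R] (D : Derivation K R R)

lemma der_prod {ι : Type*} [DecidableEq ι] (S : Finset ι) (f : ι → R) :
    D (∏ i ∈ S, f i) = ∑ i ∈ S, (D (f i)) * ∏ l ∈ S.erase i, f l := by
  induction S using Finset.induction_on with
  | empty => simp
  | insert a S ha ih =>
    rw [Finset.prod_insert ha, D.leibniz, ih, Finset.sum_insert ha, Finset.erase_insert ha]
    simp only [smul_eq_mul]
    rw [mul_comm (∏ i ∈ S, f i), add_comm, Finset.mul_sum]
    congr 1
    refine Finset.sum_congr rfl fun i hi => ?_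
    have : (insert a S).erase i = insert a (S.erase i) := by
      rw [Finset.erase_insert_of_ne]; rintro rfl; exact ha hi
    rw [this, Finset.prod_insert (fun h => ha (Finset.mem_of_mem_erase h))]
    ring

lemma ten_update_apply (u : Par n R) (i : Fin s) (x : Fin (n i + 1) → R) (t : Idx n) :
    ten (update u i x) t = x (t i) * ∏ l ∈ univ.erase i, u l (t l) := by
  rw [ten_apply, ← Finset.mul_prod_erase univ _ (mem_univ i), update_self]
  congr 1
  refine Finset.prod_congr rfl fun l hl => ?_
  rw [update_of_ne (Finset.ne_of_mem_erase hl)]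

lemma der_ten (u : Par n R) (t : Idx n) : D (ten u t) = dten u (pmap D u) t := by
  rw [ten_apply, der_prod, dten_apply, Finset.sum_apply]
  refine Finset.sum_congr rfl fun i _ => ?_
  rw [ten_update_apply]; rfl

lemma der_dten (u v : Par n R) (t : Idx n) :
    D (dten u v t) = dten u (pmap D v) t + II u v (pmap D u) t := by
  rw [dten_apply, Finset.sum_apply, map_sum, dten_apply, II_apply, Finset.sum_apply,
    Finset.sum_apply, ← Finset.sum_add_distrib]
  refine Finset.sum_congr rfl fun i _ => ?_
  rw [der_ten, dten_apply, ← Finset.add_sum_erase univ _ (mem_univ i), Pi.add_apply]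
  congr 1
  · rw [update_idem]
    have : pmap (⇑D) (update u i (v i)) i = pmap (⇑D) v i := by funext p; simp [pmap]
    rw [this]
  · refine congrFun (Finset.sum_congr rfl fun j hj => ?_) t
    congr 2
    funext p
    simp [pmap, update_of_ne (Finset.ne_of_mem_erase hj)]
end der

lemma ten_at2 (y : Par n R) (t : Idx n) {i j : Fin s} (hij : i ≠ j) (a : Fin (n i + 1))
    (b : Fin (n j + 1)) : ten y (update (update t i a) j b) =
      y i a * y j b * ∏ l ∈ (univ.erase i).erase j, y l (t l) := by
  rw [ten_apply, ← Finset.mul_prod_erase univ _ (mem_univ i),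
    ← Finset.mul_prod_erase (univ.erase i) _ (Finset.mem_erase.2 ⟨hij.symm, mem_univ j⟩),
    ← mul_assoc]
  congr 1
  · simp [update_of_ne hij]
  · refine Finset.prod_congr rfl fun l hl => ?_
    have h1 := Finset.ne_of_mem_erase hl
    have h2 := Finset.ne_of_mem_erase (Finset.mem_of_mem_erase hl)
    rw [update_of_ne h1, update_of_ne h2]

lemma ten_at1 (y : Par n R) (t : Idx n) (i : Fin s) (a : Fin (n i + 1)) :
    ten y (update t i a) = y i a * ∏ l ∈ univ.erase i, y l (t l) := by
  rw [ten_apply, ← Finset.mul_prod_erase univ _ (mem_univ i)]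
  congr 1
  · simp
  · refine Finset.prod_congr rfl fun l hl => ?_
    have h1 := Finset.ne_of_mem_erase hl
    rw [update_of_ne h1]

/-- contraction -/
def lam2 (u : Par n R) (t : Idx n) (i j : Fin s) (p q : Fin (n i + 1)) (p' q' : Fin (n j + 1)) :
    (Idx n → R) →ₗ[R] R :=
  (u i q * u j q') • LinearMap.proj (update (update t i p) j p')
  - (u i p * u j q') • LinearMap.proj (update (update t i q) j p')
  - (u i q * u j p') • LinearMap.proj (update (update t i p) j q')
  + (u i p * u j p') • LinearMap.proj (update (update t i q) j q')

lemma lam2_ten (u : Par n R) (t : Idx n) {i j : Fin s} (hij : i ≠ j) (p q : Fin (n i + 1))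
    (p' q' : Fin (n j + 1)) (y : Par n R) : lam2 u t i j p q p' q' (ten y) =
    (y i p * u i q - y i q * u i p) * (y j p' * u j q' - y j q' * u j p') *
      ∏ l ∈ (univ.erase i).erase j, y l (t l) := by
  simp only [lam2, LinearMap.add_apply, LinearMap.sub_apply, LinearMap.smul_apply,
    LinearMap.proj_apply, ten_at2 _ _ hij, smul_eq_mul]
  ring

end alg

section fld
variable {s : ℕ} {n : Fin s → ℕ} {F : Type*} [Field F]

def UU (u : Par n F) : Submodule F (Par n F) where
  carrier := {v | ∀ i p q, v i p * u i q = v i q * u i p}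
  add_mem' := by
    intro a b ha hb i p q
    simp only [Pi.add_apply, add_mul]
    rw [ha, hb]
  zero_mem' := by intro i p q; simp
  smul_mem' := by
    intro c a ha i p q
    simp only [Pi.smul_apply, smul_eq_mul, mul_assoc]
    rw [ha]

lemma mem_UU {u v : Par n F} : v ∈ UU u ↔ ∀ i p q, v i p * u i q = v i q * u i p := Iff.rfl

lemma UU_exists {u v : Par n F} (hu : ∀ i, u i ≠ 0) (h : v ∈ UU u) :
    ∃ μ : Fin s → F, v = fun i => μ i • u i := by
  have : ∀ i, ∃ c : F, v i = c • u i := by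
    intro i
    obtain ⟨q, hq⟩ := Function.ne_iff.1 (hu i)
    refine ⟨v i q / u i q, ?_⟩
    funext p
    have := h i p q
    simp only [Pi.zero_apply] at hq
    simp only [Pi.smul_apply, smul_eq_mul]
    field_simp
    rw [this]
  choose μ hμ using this
  exact ⟨μ, funext hμ⟩

lemma mu_mem_UU (u : Par n F) (μ : Fin s → F) : (fun i => μ i • u i) ∈ UU u := by
  intro i p q
  simp only [Pi.smul_apply, smul_eq_mul]; ring

lemma UU_of_II_mem (hs : 2 ≤ s) (hn : ∀ i, 0 < n i) {u v : Par n F} (hu : ∀ i p, u i p ≠ 0)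
    (h : ∀ w, II u w v ∈ LinearMap.range (dten u)) : v ∈ UU u := by
  classical
  intro i p q
  obtain ⟨j, hij⟩ : ∃ j : Fin s, i ≠ j := by
    have : Nontrivial (Fin s) := Fin.nontrivial_iff_two_le.2 hs
    obtain ⟨j, hj⟩ := exists_ne i
    exact ⟨j, hj.symm⟩
  set p' : Fin (n j + 1) := 0
  set q' : Fin (n j + 1) := Fin.last _
  have hpq' : p' ≠ q' := by
    intro e
    have := congrArg Fin.val e
    simp [p', q'] at this
    have := hn j
    omega
  let t : Idx n := fun _ => 0
  let w : Par n F := Pi.single j (Pi.single p' 1)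
  obtain ⟨x, hx⟩ := h w
  have h1 := congrArg (lam2 u t i j p q p' q') hx
  have h0 : lam2 u t i j p q p' q' (dten u x) = 0 := by
    rw [dten_apply, map_sum]
    refine Finset.sum_eq_zero fun l _ => ?_
    rw [lam2_ten _ _ hij]
    by_cases hl : l = i
    · have : j ≠ l := by rw [hl]; exact hij.symm
      rw [update_of_ne this]; ring
    · rw [update_of_ne (Ne.symm hl)]; ring
  rw [h0, II_apply, map_sum, Finset.sum_eq_single j, map_sum, Finset.sum_eq_single i,
    lam2_ten _ _ hij] at h1
  · have h2 : ∏ l ∈ (univ.erase i).erase j, (update (update u j (w j)) i (v i)) l (t l) ≠ 0 := by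
      rw [Finset.prod_ne_zero_iff]
      intro l hl
      have h1 := Finset.ne_of_mem_erase hl
      have h2 := Finset.ne_of_mem_erase (Finset.mem_of_mem_erase hl)
      rw [update_of_ne h2, update_of_ne h1]
      exact hu _ _
    have h3 := (mul_eq_zero.1 h1.symm).resolve_right h2
    rw [update_self, update_of_ne hij.symm, update_self] at h3
    have h4 : w j p' * u j q' - w j q' * u j p' ≠ 0 := by
      simp [w, hpq'.symm, hu]
    exact sub_eq_zero.1 ((mul_eq_zero.1 h3).resolve_right h4)
  · intro l hl hli
    rw [lam2_ten _ _ hij, update_of_ne (Ne.symm hli), update_of_ne hij]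
    ring
  · intro hi
    exact absurd (Finset.mem_erase.2 ⟨hij, mem_univ i⟩) hi
  · intro l _ hl
    rw [map_sum]
    refine Finset.sum_eq_zero fun m hm => ?_
    have : w l = 0 := by simp [w, hl]
    rw [this, ten_zero _ l, map_zero]
    rw [update_of_ne (Finset.ne_of_mem_erase hm).symm, update_self]
  · simp

end fld

end part1

section part2
set_option linter.unusedSectionVars false
set_option linter.unusedVariables false
open Finset Function


section fld
variable {s : ℕ} {n : Fin s → ℕ} {F : Type*} [Field F] {J : Type*} [Fintype J]

def MM (A : J → Par n F) (B : Set J) : Submodule F (Idx n → F) where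
  carrier := {x | ∃ v : J → Par n F, (∀ a, a ∉ B → v a = 0) ∧ x = ∑ a, dten (A a) (v a)}
  add_mem' := by
    rintro x y ⟨v, hv, rfl⟩ ⟨w, hw, rfl⟩
    refine ⟨v + w, fun a ha => by simp [hv a ha, hw a ha], ?_⟩
    simp [Finset.sum_add_distrib]
  zero_mem' := ⟨0, by simp, by simp⟩
  smul_mem' := by
    rintro c x ⟨v, hv, rfl⟩
    refine ⟨c • v, fun a ha => by simp [hv a ha], ?_⟩
    simp [Finset.smul_sum]

lemma dten_mem_MM (A : J → Par n F) {B : Set J} {a : J} (ha : a ∈ B) (v : Par n F) :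
    dten (A a) v ∈ MM A B := by
  classical
  refine ⟨Pi.single a v, fun b hb => ?_, ?_⟩
  · rw [Pi.single_eq_of_ne]; rintro rfl; exact hb ha
  · rw [Finset.sum_eq_single a]
    · simp
    · intro b _ hb; simp [hb]
    · simp

lemma MM_mono (A : J → Par n F) {B C : Set J} (h : B ⊆ C) : MM A B ≤ MM A C := by
  rintro x ⟨v, hv, rfl⟩
  exact ⟨v, fun a ha => hv a (fun hb => ha (h hb)), rfl⟩

def ZZ (A : J → Par n F) (B : Set J) (b : J) : Submodule F (Par n F) where
  carrier := {v | ∀ w, II (A b) w v ∈ MM A B}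
  add_mem' := by
    intro x y hx hy w
    rw [map_add]; exact add_mem (hx w) (hy w)
  zero_mem' := by intro w; rw [map_zero]; exact zero_mem _
  smul_mem' := by
    intro c x hx w
    rw [map_smul]; exact Submodule.smul_mem _ _ (hx w)

lemma mem_ZZ {A : J → Par n F} {B : Set J} {b : J} {v : Par n F} :
    v ∈ ZZ A B b ↔ ∀ w, II (A b) w v ∈ MM A B := Iff.rfl

lemma ZZ_mono (A : J → Par n F) {B C : Set J} (h : B ⊆ C) (b : J) : ZZ A B b ≤ ZZ A C b :=
  fun _ hv w => MM_mono A h (hv w)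

lemma UU_le_ZZ {A : J → Par n F} {B : Set J} {b : J} (hb : b ∈ B) (hA : ∀ i, A b i ≠ 0) :
    UU (A b) ≤ ZZ A B b := by
  intro v hv w
  obtain ⟨μ, rfl⟩ := UU_exists hA hv
  rw [II_mu]
  exact dten_mem_MM A hb _

def G1 (A : J → Par n F) : Prop :=
  ∀ v : J → Par n F, ∑ a, dten (A a) (v a) = 0 → ∀ a, dten (A a) (v a) = 0

lemma G1.uniq {A : J → Par n F} (h : G1 A) {v w : J → Par n F}
    (e : ∑ a, dten (A a) (v a) = ∑ a, dten (A a) (w a)) (a : J) :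
    dten (A a) (v a) = dten (A a) (w a) := by
  have := h (v - w) (by simp [e]) a
  simpa [sub_eq_zero] using this

section perm
variable (φ : F ≃+* F) (σ : Equiv.Perm J) (A : J → Par n F)
  (hφ : ∀ a i p, φ (A a i p) = A (σ a) i p)
include hφ

lemma pmap_A (a : J) : pmap φ (A a) = A (σ a) := by
  funext i p; exact hφ a i p

lemma MM_map {B C : Set J} (hB : ∀ a, σ a ∈ C ↔ a ∈ B) {x : Idx n → F} (hx : x ∈ MM A B) :
    (fun t => φ (x t)) ∈ MM A C := by
  obtain ⟨v, hv, rfl⟩ := hx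
  refine ⟨fun a => pmap φ (v (σ.symm a)), fun a ha => ?_, ?_⟩
  · have : σ.symm a ∉ B := fun h => ha (by have := (hB (σ.symm a)).2 h; simpa using this)
    funext i p
    simp [pmap, hv _ this]
  · funext t
    rw [Finset.sum_apply, map_sum, Finset.sum_apply]
    refine Eq.trans ?_ (Equiv.sum_comp σ _)
    refine Finset.sum_congr rfl fun a _ => ?_
    have := dten_map (φ : F →+* F) (A a) (v a) t
    simp only [RingHom.coe_coe] at this
    rw [this, pmap_A φ σ A hφ]
    simp

lemma ZZ_map {B C : Set J} (hB : ∀ a, σ a ∈ C ↔ a ∈ B) {b : J} {v : Par n F}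
    (hv : v ∈ ZZ A B b) : pmap φ v ∈ ZZ A C (σ b) := by
  intro w
  have := MM_map φ σ A hφ hB (hv (pmap φ.symm w))
  have e : (fun t => φ (II (A b) (pmap φ.symm w) v t)) = II (A (σ b)) w (pmap φ v) := by
    funext t
    have := II_map (φ : F →+* F) (A b) (pmap φ.symm w) v t
    simp only [RingHom.coe_coe] at this
    rw [this, pmap_A φ σ A hφ]
    have : pmap φ (pmap φ.symm w) = w := by funext i p; simp [pmap]
    rw [this]
  rwa [e] at this
end perm

lemma pmap_symm (φ : F ≃+* F) (v : Par n F) : pmap φ.symm (pmap φ v) = v := by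
  funext i p; simp [pmap]

/-- the total map -/
def sumD (A : J → Par n F) : (J → Par n F) →ₗ[F] (Idx n → F) :=
  ∑ a, (dten (A a)) ∘ₗ LinearMap.proj a

lemma sumD_apply (A : J → Par n F) (v : J → Par n F) : sumD A v = ∑ a, dten (A a) (v a) := by
  simp [sumD]

lemma MM_univ (A : J → Par n F) : MM A Set.univ = LinearMap.range (sumD A) := by
  ext x
  constructor
  · rintro ⟨v, -, rfl⟩; exact ⟨v, sumD_apply A v⟩
  · rintro ⟨v, rfl⟩; exact ⟨v, by simp, sumD_apply A v⟩

lemma finrank_par : Module.finrank F (Par n F) = ∑ i, n i + s := by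
  rw [Module.finrank_pi_fintype]
  simp [Finset.sum_add_distrib]

lemma finrank_MM_le (hs : 1 ≤ s) (A : J → Par n F) (hA : ∀ a i, A a i ≠ 0) :
    Module.finrank F (MM A Set.univ) ≤ Fintype.card J * (∑ i, n i + 1) := by
  classical
  obtain ⟨i0⟩ : Nonempty (Fin s) := ⟨⟨0, hs⟩⟩
  rw [MM_univ]
  have h1 := LinearMap.finrank_range_add_finrank_ker (sumD A)
  have h2 : Module.finrank F (J → Par n F) = Fintype.card J * (∑ i, n i + s) := by
    rw [Module.finrank_pi_fintype]
    simp [finrank_par]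
  let μ : ({i : Fin s // i ≠ i0} → F) → Fin s → F := fun c i =>
    if h : i = i0 then - ∑ l, c l else c ⟨i, h⟩
  have hμ : ∀ c, ∑ i, μ c i = 0 := by
    intro c
    rw [← Finset.add_sum_erase univ _ (mem_univ i0)]
    have : ∑ i ∈ univ.erase i0, μ c i = ∑ l, c l := by
      rw [← Finset.sum_subtype_of_mem (p := fun i => i ≠ i0) (fun i => μ c i)
        (fun i hi => Finset.ne_of_mem_erase hi)]
      refine Finset.sum_bij' (fun x _ => x) (fun x _ => x) (by simp) (by simp) (by simp) (by simp) ?_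
      intro a _
      simp [μ, a.2]
    rw [this]; simp [μ]
  let g : (J → {i : Fin s // i ≠ i0} → F) →ₗ[F] (J → Par n F) :=
    { toFun := fun c a i => μ (c a) i • A a i
      map_add' := by
        intro c d; funext a i p
        by_cases h : i = i0
        · simp [μ, h, Finset.sum_add_distrib]; ring
        · simp [μ, h]; ring
      map_smul' := by
        intro r c; funext a i p
        by_cases h : i = i0
        · simp [μ, h, ← Finset.mul_sum]; ring
        · simp [μ, h]; ring }
  have hg : Injective g := by
    intro c d h
    funext a i
    have := congrFun (congrFun h a) i.1
    simp only [g, LinearMap.coe_mk, AddHom.coe_mk, μ, i.2, dite_false] at this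
    exact smul_left_injective F (hA a i.1) this
  have hgr : LinearMap.range g ≤ LinearMap.ker (sumD A) := by
    rintro _ ⟨c, rfl⟩
    rw [LinearMap.mem_ker, sumD_apply]
    refine Finset.sum_eq_zero fun a _ => ?_
    have := dten_mu (A a) (μ (c a))
    rw [hμ, zero_smul] at this
    exact this
  have h3 := Submodule.finrank_mono hgr
  rw [LinearMap.finrank_range_of_inj hg, Module.finrank_pi_fintype] at h3
  simp only [Module.finrank_fintype_fun_eq_card, Fintype.card_subtype_compl,
    Fintype.card_fin, Finset.sum_const, smul_eq_mul, Finset.card_univ,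
    Fintype.card_unique] at h3
  rw [h2] at h1
  obtain ⟨s', rfl⟩ : ∃ s', s = s' + 1 := ⟨s - 1, by omega⟩
  simp only [Nat.add_sub_cancel] at h3
  nlinarith

lemma finrank_UU_ge (u : Par n F) (hu : ∀ i, u i ≠ 0) : s ≤ Module.finrank F (UU u) := by
  let g : (Fin s → F) →ₗ[F] UU u :=
    { toFun := fun c => ⟨fun i => c i • u i, mu_mem_UU u c⟩
      map_add' := by intro c d; ext i p; simp; ring
      map_smul' := by intro r c; ext i p; simp; ring }
  have hg : Injective g := by
    intro c d h
    funext i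
    have := congrFun (congrArg Subtype.val h) i
    exact smul_left_injective F (hu i) this
  have := LinearMap.finrank_le_finrank_of_injective hg
  simpa using this

/-- key derivation argument -/
lemma exists_const_functional {K : Type*} [Field K] [Algebra K F] {T : Type*} [Fintype T]
    (W : Submodule F (T → F)) (hW : W ≠ ⊤) (S : Set (Derivation K F F))
    (hst : ∀ D ∈ S, ∀ x ∈ W, (fun t => D (x t)) ∈ W) :
    ∃ l : T → F, l ≠ 0 ∧ (∀ x ∈ W, ∑ t, l t * x t = 0) ∧ ∀ D ∈ S, ∀ t, D (l t) = 0 := by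
  classical
  have hne : ∃ l : T → F, l ≠ 0 ∧ (∀ x ∈ W, ∑ t, l t * x t = 0) := by
    obtain ⟨f, hf, hWf⟩ := Submodule.exists_le_ker_of_lt_top W (lt_top_iff_ne_top.2 hW)
    have key : ∀ x, f x = ∑ t, f (Pi.single t 1) * x t := by
      intro x
      conv_lhs => rw [LinearMap.pi_apply_eq_sum_univ f x]
      refine Finset.sum_congr rfl fun t _ => ?_
      rw [smul_eq_mul, mul_comm]
      congr 2
      funext y
      simp [Pi.single_apply, eq_comm]
    refine ⟨fun t => f (Pi.single t 1), ?_, fun x hx => ?_⟩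
    · intro h0
      apply hf
      refine LinearMap.ext fun x => ?_
      rw [key]
      have h0' : ∀ t, f (Pi.single t 1) = 0 := fun t => congrFun h0 t
      simp [h0']
    · rw [← key]; exact hWf hx
  let P : ℕ → Prop := fun m => ∃ l : T → F, l ≠ 0 ∧ (∀ x ∈ W, ∑ t, l t * x t = 0) ∧
    (univ.filter fun t => l t ≠ 0).card = m
  have hP : ∃ m, P m := by
    obtain ⟨l, h1, h2⟩ := hne
    exact ⟨_, l, h1, h2, rfl⟩
  obtain ⟨l, hl0, hlW, hlc⟩ := Nat.find_spec hP
  have hmin := fun m => @Nat.find_min P _ hP m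
  obtain ⟨t0, ht0⟩ := Function.ne_iff.1 hl0
  simp only [Pi.zero_apply] at ht0
  refine ⟨fun t => l t / l t0, ?_, ?_, ?_⟩
  · intro h
    have := congrFun h t0
    simp [ht0] at this
  · intro x hx
    have := hlW x hx
    simp only [div_eq_mul_inv, mul_right_comm, ← Finset.sum_mul, this, zero_mul]
  · intro D hD t
    by_contra hne0
    let m : T → F := fun t => D (l t / l t0)
    have hmW : ∀ x ∈ W, ∑ t, m t * x t = 0 := by
      intro x hx
      have e1 : ∀ y ∈ W, ∑ t, (l t / l t0) * y t = 0 := by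
        intro x hx
        have := hlW x hx
        simp only [div_eq_mul_inv, mul_right_comm, ← Finset.sum_mul, this, zero_mul]
      have e2 := congrArg D (e1 x hx)
      rw [map_sum, map_zero] at e2
      simp only [D.leibniz, smul_eq_mul, Finset.sum_add_distrib] at e2
      have e3 := e1 _ (hst D hD x hx)
      rw [e3, zero_add] at e2
      rw [← e2]
      exact Finset.sum_congr rfl fun t _ => mul_comm _ _
    refine hmin _ ?_ ⟨m, fun h => hne0 (congrFun h t), hmW, rfl⟩
    rw [← hlc]
    refine Finset.card_lt_card ?_
    rw [Finset.ssubset_iff_of_subset]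
    · refine ⟨t0, by simp [ht0], ?_⟩
      simp [m, div_self ht0]
    · intro t ht
      simp only [Finset.mem_filter, Finset.mem_univ, true_and] at ht ⊢
      intro h
      apply ht
      simp [m, h]

end fld

section main
variable {K : Type*} [Field K] {s : ℕ} {n : Fin s → ℕ} {F : Type*} [Field F] [Algebra K F]
  {M : ℕ}

lemma main_not_all_top (hs : 1 ≤ s) (A : Fin M → Par n F)
    (hA : ∀ a i p, A a i p ≠ 0)
    (hder : ∀ d : Fin M → Par n F, ∃ D : Derivation K F F, ∀ a i p, D (A a i p) = d a i p)
    (hM : 0 < M) (hcard : M * (∑ i, n i + 1) < Fintype.card (Idx n)) 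
    (htop : ∀ b, ZZ A Set.univ b = ⊤) : False := by
  classical
  have hA' : ∀ a i, A a i ≠ 0 := fun a i h => hA a i 0 (by rw [h]; rfl)
  have hW : MM A Set.univ ≠ ⊤ := by
    intro h
    have := finrank_MM_le hs A hA'
    rw [h, finrank_top, Module.finrank_fintype_fun_eq_card, Fintype.card_fin] at this
    omega
  obtain ⟨l, hl0, hlW, hlD⟩ := exists_const_functional (K := K) (MM A Set.univ) hW Set.univ (by
    rintro D - x ⟨v, -, rfl⟩
    have : (fun t => D ((∑ a, dten (A a) (v a)) t)) =
        ∑ a, (dten (A a) (pmap D (v a)) + II (A a) (v a) (pmap D (A a))) := by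
      funext t
      rw [Finset.sum_apply, map_sum, Finset.sum_apply]
      exact Finset.sum_congr rfl fun a _ => der_dten D _ _ t
    rw [this]
    refine Submodule.sum_mem _ fun a _ => add_mem (dten_mem_MM A (Set.mem_univ a) _) ?_
    have h : pmap D (A a) ∈ ZZ A Set.univ a := by rw [htop]; trivial
    exact h (v a))
  apply hl0
  funext t
  let b : Fin M := ⟨0, hM⟩
  have key : ∀ S : Finset (Fin s), 
      ∑ t', l t' * ten (n := n) (fun i => if i ∈ S then Pi.single (t i) 1 else A b i) t' = 0 := by
    intro S
    induction S using Finset.induction_on with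
    | empty =>
      simp only [Finset.notMem_empty, if_false]
      apply hlW
      have : ten (A b) = dten (A b) (Pi.single ⟨0, hs⟩ (A b ⟨0, hs⟩)) := by
        rw [dten_apply, Finset.sum_eq_single ⟨0, hs⟩]
        · simp
        · intro i _ hi
          rw [ten_zero _ i]; simp [hi]
        · simp
      rw [this]
      exact dten_mem_MM A (Set.mem_univ b) _
    | insert i S hi ih =>
      obtain ⟨D, hD⟩ := hder (Pi.single b (Pi.single i (Pi.single (t i) 1)))
      have := congrArg D ih
      rw [map_zero, map_sum] at this
      simp only [D.leibniz, hlD D (Set.mem_univ _), smul_zero, add_zero, der_ten] at this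
      rw [← this]
      refine Finset.sum_congr rfl fun t' _ => ?_
      rw [smul_eq_mul]
      congr 1
      rw [dten_apply, Finset.sum_eq_single i]
      · congr 1
        funext l p
        by_cases hl : l = i
        · subst hl
          simp [pmap, hi, hD]
        · simp [hl]
      · intro l _ hl
        apply ten_zero _ l
        funext p
        by_cases hlS : l ∈ S
        · simp only [pmap, update_self, hlS, if_true, Pi.single_apply]
          split_ifs <;> simp
        · simp [pmap, hlS, hD, hl]
      · simp
  have := key univ
  rw [Finset.sum_eq_single t] at this
  · simpa [ten_apply] using this
  · intro t' _ ht'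
    obtain ⟨i, hi⟩ := Function.ne_iff.1 ht'
    rw [ten_apply, Finset.prod_eq_zero (mem_univ i), mul_zero]
    simp [hi]
  · simp

def BB (M m : ℕ) : Set (Fin M) := {a | a.val < m}

theorem main_generic (hs : 2 ≤ s) (hn : ∀ i, 0 < n i) (A : Fin M → Par n F)
    (hA : ∀ a i p, A a i p ≠ 0)
    (hder : ∀ d : Fin M → Par n F, ∃ D : Derivation K F F, ∀ a i p, D (A a i p) = d a i p)
    (hG1 : G1 A)
    (hperm : ∀ σ : Equiv.Perm (Fin M), ∃ φ : F ≃+* F, ∀ a i p, φ (A a i p) = A (σ a) i p)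
    (hcard : M * (∑ i, n i + 1) < Fintype.card (Idx n)) (k : ℕ) (hk : 1 ≤ k)
    (hM : M = k + ∑ i, n i - 1) (b : Fin M) (hb : b.val < k) :
    ZZ A (BB M k) b ≤ UU (A b) := by
  classical
  have hA' : ∀ a i, A a i ≠ 0 := fun a i h => hA a i 0 (by rw [h]; rfl)
  have hN : 1 ≤ ∑ i, n i := by
    have := Finset.single_le_sum (f := n) (fun i _ => Nat.zero_le _) (mem_univ (⟨0, by omega⟩ : Fin s))
    have := hn ⟨0, by omega⟩
    omega
  have hM0 : 0 < M := by omega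
  let z : Fin M := ⟨0, hM0⟩
  have main : ZZ A (BB M k) z ≤ UU (A z) := by
    by_contra hcon
    have step : ∀ m, 1 ≤ m → m < M → ZZ A (BB M (m+1)) z ≤ ZZ A (BB M m) z →
        ZZ A (BB M (m+1)) z ≤ UU (A z) := by
      intro m hm hmM hle v hv
      refine UU_of_II_mem hs hn (hA z) fun w => ?_
      obtain ⟨x, hx0, hx⟩ := hv w
      have hpc : ∀ c : Fin M, c ≠ z → dten (A c) (x c) = 0 := by
        intro c hcz
        by_cases hc : c.val < m + 1
        · obtain ⟨φ, hφ⟩ := hperm (Equiv.swap c ⟨m, hmM⟩)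
          set σ := Equiv.swap c ⟨m, hmM⟩ with hσ
          have hσz : σ z = z := Equiv.swap_apply_of_ne_of_ne (Ne.symm hcz)
            (by intro h; have := congrArg Fin.val h; simp [z] at this; omega)
          have hσB : ∀ a, σ a ∈ BB M (m+1) ↔ a ∈ BB M (m+1) := by
            intro a
            rw [hσ, Equiv.swap_apply_def]
            split_ifs with h1 h2
            · subst h1; simp [BB]; omega
            · subst h2; simp [BB]; omega
            · rfl
          have h1 := hle (hσz ▸ ZZ_map φ σ A hφ hσB hv)
          have hφs : ∀ a i p, φ.symm (A a i p) = A (σ.symm a) i p := by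
            intro a i p
            rw [RingEquiv.symm_apply_eq, hφ]; simp
          have h2 := ZZ_map φ.symm σ.symm A hφs (B := BB M m) (C := {a | σ a ∈ BB M m})
            (by intro a; simp) h1
          rw [pmap_symm] at h2
          have hσz' : σ.symm z = z := by rw [Equiv.symm_apply_eq, hσz]
          rw [hσz'] at h2
          obtain ⟨y, hy0, hy⟩ := h2 w
          rw [hG1.uniq (hx.symm.trans hy) c, hy0 c, map_zero]
          simp [hσ, BB]
        · rw [hx0 c hc, map_zero]
      rw [hx, Finset.sum_eq_single z (fun c _ hc => hpc c hc) (by simp)]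
      exact ⟨_, rfl⟩
    have grow : ∀ t, k + t ≤ M → s + 1 + t ≤ Module.finrank F (ZZ A (BB M (k + t)) z) ∧
        ¬ ZZ A (BB M (k+t)) z ≤ UU (A z) := by
      intro t
      induction t with
      | zero =>
        intro _
        refine ⟨?_, hcon⟩
        have h1 : UU (A z) < ZZ A (BB M k) z :=
          lt_of_le_not_ge (UU_le_ZZ (show z.val < k by simp [z]; omega) (hA' z)) hcon
        have h2 := Submodule.finrank_lt_finrank_of_lt h1
        have h3 := finrank_UU_ge (A z) (hA' z)
        rw [add_zero, add_zero]
        omega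
      | succ t ih =>
        intro ht
        obtain ⟨h1, h2⟩ := ih (by omega)
        have hmono : ZZ A (BB M (k+t)) z ≤ ZZ A (BB M (k+(t+1))) z :=
          ZZ_mono A (fun a (ha : a.val < _) => show a.val < _ by omega) z
        have h3 : ¬ ZZ A (BB M (k+(t+1))) z ≤ UU (A z) := fun h => h2 (hmono.trans h)
        refine ⟨?_, h3⟩
        have h4 : ZZ A (BB M (k+t)) z < ZZ A (BB M (k+(t+1))) z :=
          lt_of_le_not_ge hmono (fun h => h3 (step (k+t) (by omega) (by omega) h))
        have := Submodule.finrank_lt_finrank_of_lt h4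
        omega
    obtain ⟨h1, -⟩ := grow (∑ i, n i - 1) (by omega)
    have hBu : BB M (k + (∑ i, n i - 1)) = Set.univ := by
      ext a; simp only [BB, Set.mem_ofPred_eq, Set.mem_univ, iff_true]
      have := a.2; omega
    rw [hBu] at h1
    have htop : ZZ A Set.univ z = ⊤ := by
      apply Submodule.eq_top_of_finrank_eq
      have := Submodule.finrank_le (ZZ A Set.univ z)
      rw [finrank_par] at *
      omega
    refine main_not_all_top (K := K) (by omega) A hA hder hM0 hcard fun b => ?_
    rw [eq_top_iff]
    intro v _
    obtain ⟨φ, hφ⟩ := hperm (Equiv.swap z b)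
    have h2 : pmap φ.symm v ∈ ZZ A Set.univ z := by rw [htop]; trivial
    have h3 := ZZ_map φ _ A hφ (C := Set.univ) (by simp) h2
    have : pmap φ (pmap φ.symm v) = v := pmap_symm φ.symm v
    rw [this] at h3
    simpa using h3
  intro v hv
  obtain ⟨φ, hφ⟩ := hperm (Equiv.swap z b)
  have hB : ∀ a, Equiv.swap z b a ∈ BB M k ↔ a ∈ BB M k := by
    intro a
    rw [Equiv.swap_apply_def]
    split_ifs with h1 h2
    · subst h1; simp [BB, hb, z]; omega
    · subst h2; simp [BB, hb, z]; omega
    · rfl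
  have h1 := ZZ_map φ _ A hφ hB hv
  rw [Equiv.swap_apply_right] at h1
  have h2 := main h1
  intro i p q
  have := h2 i p q
  simp only [pmap] at this
  apply φ.injective
  rw [map_mul, map_mul, hφ, hφ, Equiv.swap_apply_right]
  exact this

end main

end part2

section part3
set_option linter.unusedSectionVars false
set_option linter.unusedVariables false
open Finset Function


section derext
variable {K Ω : Type*} [Field K] [Field Ω] [Algebra K Ω] [CharZero K]

lemma charZero_ext (K Ω : Type*) [Field K] [Field Ω] [Algebra K Ω] [CharZero K] : CharZero Ω :=
  charZero_of_injective_algebraMap (algebraMap K Ω).injective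

lemma der_ext_basis {ι : Type*} (z : ι → Ω) (hz : IsTranscendenceBasis K z) (d : ι → Ω) :
    ∃ D : Derivation K Ω Ω, ∀ i, D (z i) = d i := by
  have := charZero_ext K Ω
  let S := MvPolynomial ι K
  let _i1 : Algebra S Ω := (MvPolynomial.aeval z : MvPolynomial ι K →ₐ[K] Ω).toRingHom.toAlgebra
  have hmap : ∀ p : S, algebraMap S Ω p = MvPolynomial.aeval z p := fun p => rfl
  have _i2 : IsScalarTower K S Ω := IsScalarTower.of_algebraMap_eq (fun x => by
    rw [hmap, MvPolynomial.algebraMap_eq, MvPolynomial.aeval_C])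
  have _i3 : FaithfulSMul S Ω := (faithfulSMul_iff_algebraMap_injective S Ω).2 hz.1
  let _i4 : Algebra (FractionRing S) Ω := FractionRing.liftAlgebra S Ω
  have _i5 : IsScalarTower S (FractionRing S) Ω := inferInstance
  have halgS : Algebra.IsAlgebraic S Ω := by
    have h1 := hz.isAlgebraic
    constructor
    intro x
    obtain ⟨p, hp, hpx⟩ := h1.isAlgebraic x
    let e := hz.1.aevalEquiv
    refine ⟨p.map (e.symm : _ →+* S), ?_, ?_⟩
    · rw [Ne, Polynomial.map_eq_zero_iff]
      · exact hp
      · exact e.symm.injective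
    · rw [Polynomial.aeval_def, Polynomial.eval₂_map]
      rw [Polynomial.aeval_def] at hpx
      convert hpx using 2
      ext y
      have : y = e (e.symm y) := by simp
      conv_rhs => rw [this]
      change algebraMap S Ω (e.symm y) = _
      rw [hmap, ← hz.1.algebraMap_aevalEquiv]
  have halgF : Algebra.IsAlgebraic (FractionRing S) Ω :=
    (IsFractionRing.comap_isAlgebraic_iff (A := S) (K := FractionRing S) (C := Ω)).1 halgS
  have : CharZero (FractionRing S) :=
    charZero_of_injective_algebraMap (R := K) (algebraMap K (FractionRing S)).injective
  have e1 : Algebra.FormallyEtale S (FractionRing S) :=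
    .of_isLocalization (nonZeroDivisors S)
  have e2 : Algebra.FormallyEtale (FractionRing S) Ω := .of_isSeparable _ _
  have e3 : Algebra.FormallyEtale S Ω := .comp S (FractionRing S) Ω
  let δ : Derivation K S Ω := MvPolynomial.mkDerivation K d
  let E := KaehlerDifferential.tensorKaehlerEquivOfFormallyEtale K S Ω
  let L : TensorProduct S Ω (Ω[S⁄K]) →ₗ[Ω] Ω :=
    TensorProduct.AlgebraTensorModule.lift
      ((LinearMap.ringLmapEquivSelf Ω Ω (Ω[S⁄K] →ₗ[S] Ω)).symm δ.liftKaehlerDifferential)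
  let D : Derivation K Ω Ω := (L ∘ₗ E.symm.toLinearMap).compDer (KaehlerDifferential.D K Ω)
  refine ⟨D, fun i => ?_⟩
  have hz' : z i = algebraMap S Ω (MvPolynomial.X i) := by rw [hmap, MvPolynomial.aeval_X]
  change L (E.symm (KaehlerDifferential.D K Ω (z i))) = d i
  rw [hz', KaehlerDifferential.tensorKaehlerEquivOfFormallyEtale_symm_D_algebraMap]
  simp only [L, δ, TensorProduct.AlgebraTensorModule.lift_tmul]
  simp
  exact MvPolynomial.mkDerivation_X _ _ _

lemma der_ext {ι : Type*} (z : ι → Ω) (hz : AlgebraicIndependent K z) (d : ι → Ω) :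
    ∃ D : Derivation K Ω Ω, ∀ i, D (z i) = d i := by
  classical
  obtain ⟨t, hst, ht⟩ := exists_isTranscendenceBasis_superset (R := K) (s := Set.range z)
    (AlgebraicIndependent.coe_range hz)
  obtain ⟨D, hD⟩ := der_ext_basis _ ht (fun y : t => if h : ∃ i, z i = y then d h.choose else 0)
  refine ⟨D, fun i => ?_⟩
  have h : ∃ i', z i' = z i := ⟨i, rfl⟩
  have := hD ⟨z i, hst ⟨i, rfl⟩⟩
  simp only at this
  rw [this, dif_pos h]
  congr 1
  exact hz.injective h.choose_spec

/-- A derivation killing a subalgebra kills all elements algebraic over it. -/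
lemma der_kill_algebraic (D : Derivation K Ω Ω) (R0 : Subalgebra K Ω) (h0 : ∀ x ∈ R0, D x = 0)
    {y : Ω} (hy : IsAlgebraic R0 y) : D y = 0 := by
  classical
  have := charZero_ext K Ω
  -- the kernel as an intermediate field
  let E : IntermediateField K Ω :=
    { carrier := {x | D x = 0}
      mul_mem' := by intro a b ha hb; simp only [Set.mem_ofPred_eq] at *; simp [D.leibniz, ha, hb]
      add_mem' := by intro a b ha hb; simp only [Set.mem_ofPred_eq] at *; simp [ha, hb]
      algebraMap_mem' := by intro r; simp
      inv_mem' := by intro a ha; simp only [Set.mem_ofPred_eq] at *; simp [D.leibniz_inv, ha] }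
  have hyE : IsAlgebraic E y := by
    obtain ⟨p, hp, hpy⟩ := hy
    let f : R0 →+* E := 
      { toFun := fun x => ⟨x.1, h0 x.1 x.2⟩
        map_one' := rfl
        map_mul' := fun _ _ => rfl
        map_zero' := rfl
        map_add' := fun _ _ => rfl }
    refine ⟨p.map f, ?_, ?_⟩
    · rw [Ne, Polynomial.map_eq_zero_iff]
      · exact hp
      · intro a b hab; exact Subtype.ext (congrArg (fun x : E => x.1) hab)
    · rw [Polynomial.aeval_def, Polynomial.eval₂_map]
      exact hpy
  let D' : Derivation E Ω Ω :=
    { toFun := D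
      map_add' := map_add D
      map_smul' := by
        intro m x
        have hm : D m.1 = 0 := m.2
        have : m • x = m.1 * x := rfl
        rw [this, D.leibniz, hm, smul_zero, add_zero]; rfl
      map_one_eq_zero' := D.map_one_eq_zero
      leibniz' := D.leibniz }
  have hsep : IsSeparable E y := (minpoly.irreducible hyE.isIntegral).separable
  have h1 : D' (Polynomial.aeval y (minpoly E y)) = 0 := by rw [minpoly.aeval, map_zero]
  rw [D'.map_aeval] at h1
  have h2 : Polynomial.aeval y (Polynomial.derivative (minpoly E y)) ≠ 0 :=
    hsep.aeval_derivative_ne_zero (minpoly.aeval E y)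
  exact (smul_eq_zero.1 h1).resolve_left h2

end derext

end part3

section part4
set_option linter.unusedSectionVars false
set_option linter.unusedVariables false
open Finset Function


section geo
variable {K : Type*} [Field K] [Infinite K] {ι : Type*} [Fintype ι]

lemma hom_eval_smul {f : MvPolynomial ι K} {d : ℕ} (hf : f.IsHomogeneous d) (c : K) (v : ι → K) :
    MvPolynomial.eval (c • v) f = c ^ d * MvPolynomial.eval v f := by
  rw [MvPolynomial.eval_eq, MvPolynomial.eval_eq, Finset.mul_sum]
  refine Finset.sum_congr rfl fun m hm => ?_
  have h := hf.degree_eq_sum_deg_support hm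
  have : ∏ i ∈ m.support, (c • v) i ^ m i = c ^ d * ∏ i ∈ m.support, v i ^ m i := by
    simp only [Pi.smul_apply, smul_eq_mul, mul_pow, Finset.prod_mul_distrib]
    rw [Finset.prod_pow_eq_pow_sum, h]
  rw [this]; ring

lemma hom_comp_vanish {f : MvPolynomial ι K} {v : ι → K}
    (h : ∀ c : K, MvPolynomial.eval (c • v) f = 0) (d : ℕ) :
    MvPolynomial.eval v (MvPolynomial.homogeneousComponent d f) = 0 := by
  let p : Polynomial K := ∑ i ∈ range (f.totalDegree + 1),
    Polynomial.C (MvPolynomial.eval v (MvPolynomial.homogeneousComponent i f)) * Polynomial.X ^ i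
  have hp : p = 0 := by
    apply Polynomial.funext
    intro c
    have h1 := h c
    rw [← MvPolynomial.sum_homogeneousComponent f, map_sum] at h1
    simp only [p, Polynomial.eval_finsetSum, Polynomial.eval_mul, Polynomial.eval_C,
      Polynomial.eval_pow, Polynomial.eval_X, Polynomial.eval_zero]
    rw [← h1]
    refine Finset.sum_congr rfl fun i _ => ?_
    rw [hom_eval_smul (MvPolynomial.homogeneousComponent_isHomogeneous i f)]; ring
  by_cases hd : d < f.totalDegree + 1
  · have h2 : p.coeff d = 0 := by rw [hp]; simp
    simpa [p, Polynomial.finsetSum_coeff, Polynomial.coeff_C_mul, Polynomial.coeff_X_pow, hd] using h2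
  · rw [MvPolynomial.homogeneousComponent_eq_zero _ _ (by omega)]; simp

/-- vanishing ideal of the cone -/
def IC (C : Set (PP K ι)) : Ideal (MvPolynomial ι K) where
  carrier := {f | ∀ x ∈ C, ∀ v ∈ x.submodule, MvPolynomial.eval v f = 0}
  add_mem' := by
    intro f g hf hg x hx v hv
    rw [map_add, hf x hx v hv, hg x hx v hv, add_zero]
  zero_mem' := by intro x _ v _; simp
  smul_mem' := by
    intro c f hf x hx v hv
    rw [smul_eq_mul, map_mul, hf x hx v hv, mul_zero]

lemma mem_IC {C : Set (PP K ι)} {f : MvPolynomial ι K} :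
    f ∈ IC C ↔ ∀ x ∈ C, ∀ v ∈ x.submodule, MvPolynomial.eval v f = 0 := Iff.rfl

lemma IC_anti {C D : Set (PP K ι)} (h : C ⊆ D) : IC D ≤ IC C := fun _ hf x hx => hf x (h hx)

lemma IC_comp {C : Set (PP K ι)} {f : MvPolynomial ι K} (hf : f ∈ IC C) (d : ℕ) :
    MvPolynomial.homogeneousComponent d f ∈ IC C := fun x hx v hv =>
  hom_comp_vanish (fun c => hf x hx _ (x.submodule.smul_mem c hv)) d

lemma sub_zeroLocus_IC {C : Set (PP K ι)} (hC : IsZClosed C) {x : PP K ι}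
    (h : ∀ f ∈ IC C, ∀ v ∈ x.submodule, MvPolynomial.eval v f = 0) : x ∈ C := by
  obtain ⟨S, hS, rfl⟩ := hC
  intro f hf v hv
  exact h f (fun y hy w hw => hy f hf w hw) v hv

lemma closed_of_IC {C D : Set (PP K ι)} (hC : IsZClosed C) (h : IC C ≤ IC D) : D ⊆ C :=
  fun x hx => sub_zeroLocus_IC hC fun f hf v hv => h hf x hx v hv

lemma zeroLocus_closed_of_hom {f : MvPolynomial ι K} {d : ℕ} (hf : f.IsHomogeneous d) :
    IsZClosed (zeroLocus {f}) := ⟨{f}, by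
      intro g hg; rw [Set.mem_singleton_iff] at hg; subst hg; exact ⟨d, hf⟩, rfl⟩

lemma mem_submodule_smul {x : PP K ι} {v w : ι → K} (hv : v ∈ x.submodule) (hv0 : v ≠ 0)
    (hw : w ∈ x.submodule) : ∃ c : K, w = c • v := by
  rw [Projectivization.submodule_eq] at hv hw
  obtain ⟨a, rfl⟩ := Submodule.mem_span_singleton.1 hv
  obtain ⟨b, rfl⟩ := Submodule.mem_span_singleton.1 hw
  have ha : a ≠ 0 := by rintro rfl; simp at hv0
  exact ⟨b * a⁻¹, by rw [smul_smul, mul_assoc, inv_mul_cancel₀ ha, mul_one]⟩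

lemma rep_mem (x : PP K ι) : x.rep ∈ x.submodule := by
  rw [Projectivization.submodule_eq]; exact Submodule.mem_span_singleton_self _

lemma mem_zeroLocus_hom {f : MvPolynomial ι K} {d : ℕ} (hf : f.IsHomogeneous d) {x : PP K ι}
    {v : ι → K} (hv : v ∈ x.submodule) (hv0 : v ≠ 0) (h : MvPolynomial.eval v f = 0) :
    x ∈ zeroLocus {f} := by
  intro g hg w hw
  rw [Set.mem_singleton_iff] at hg; subst hg
  obtain ⟨c, rfl⟩ := mem_submodule_smul hv hv0 hw
  rw [hom_eval_smul hf, h, mul_zero]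

attribute [local instance] MvPolynomial.gradedAlgebra

lemma IC_prime {C : Set (PP K ι)} (hC : IsZIrreducible C) : (IC C).IsPrime := by
  have hh : (IC C).IsHomogeneous (MvPolynomial.homogeneousSubmodule ι K) := by
    intro d f hf
    have h1 := IC_comp hf d
    rw [← MvPolynomial.decomposition.decompose'_apply] at h1
    exact h1
  refine hh.isPrime_of_homogeneous_mem_or_mem ?_ ?_
  · obtain ⟨x, hx⟩ := hC.1
    intro h
    have h1 : (1 : MvPolynomial ι K) ∈ IC C := by rw [h]; trivial
    have := h1 x hx x.rep (rep_mem x)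
    simp at this
  · rintro f g ⟨d, hf⟩ ⟨e, hg⟩ hfg
    have hf' : f.IsHomogeneous d := hf
    have hg' : g.IsHomogeneous e := hg
    have := hC.2 (zeroLocus {f}) (zeroLocus {g}) (zeroLocus_closed_of_hom hf')
      (zeroLocus_closed_of_hom hg') (by
        intro x hx
        have h1 := hfg x hx x.rep (rep_mem x)
        rw [map_mul, mul_eq_zero] at h1
        rcases h1 with h1 | h1
        · exact Or.inl (mem_zeroLocus_hom hf' (rep_mem x) x.rep_nonzero h1)
        · exact Or.inr (mem_zeroLocus_hom hg' (rep_mem x) x.rep_nonzero h1))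
    rcases this with h | h
    · exact Or.inl fun x hx v hv => h hx f rfl v hv
    · exact Or.inr fun x hx v hv => h hx g rfl v hv

lemma subset_zclosure (S : Set (PP K ι)) : S ⊆ zclosure S := by
  intro x hx Y hY; exact hY.2 hx

lemma IC_zclosure (S : Set (PP K ι)) : IC (zclosure S) = IC S := by
  apply le_antisymm (IC_anti (subset_zclosure S))
  intro f hf x hx v hv
  have h : ∀ d, MvPolynomial.eval v (MvPolynomial.homogeneousComponent d f) = 0 := by
    intro d
    have := hx (zeroLocus {MvPolynomial.homogeneousComponent d f}) ⟨zeroLocus_closed_of_hom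
      (MvPolynomial.homogeneousComponent_isHomogeneous d f), by
        intro y hy g hg w hw
        rw [Set.mem_singleton_iff] at hg; subst hg
        exact IC_comp hf d y hy w hw⟩
    exact this _ rfl v hv
  rw [← MvPolynomial.sum_homogeneousComponent f, map_sum]
  exact Finset.sum_eq_zero fun i _ => h i

lemma zclosure_closed (S : Set (PP K ι)) : IsZClosed (zclosure S) := by
  refine ⟨{f | f ∈ IC S ∧ ∃ d, f.IsHomogeneous d}, fun f hf => hf.2, ?_⟩
  ext x
  constructor
  · intro hx f hf v hv
    have := hf.1
    rw [← IC_zclosure] at this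
    exact this x hx v hv
  · rintro hx Y ⟨⟨T, hT, rfl⟩, hS⟩ f hf v hv
    exact hx f ⟨fun y hy w hw => hS hy f hf w hw, hT f hf⟩ v hv

/-- the ideal of the origin -/
def I0 (K : Type*) [Field K] (ι : Type*) : Ideal (MvPolynomial ι K) :=
  RingHom.ker (MvPolynomial.eval (0 : ι → K))

lemma IC_lt_I0 {C : Set (PP K ι)} (hC : C.Nonempty) : IC C < I0 K ι := by
  obtain ⟨x, hx⟩ := hC
  rw [lt_iff_le_and_ne]
  constructor
  · intro f hf
    exact hf x hx 0 (Submodule.zero_mem _)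
  · intro h
    apply x.rep_nonzero
    funext i
    have : (MvPolynomial.X i : MvPolynomial ι K) ∈ IC C := by
      rw [h]; simp [I0, RingHom.mem_ker]
    simpa using this x hx x.rep (rep_mem x)

lemma zdim_le (S : Set (PP K ι)) (P : Ideal (MvPolynomial ι K))
    (hP : P ≤ IC S) : zdim S + 1 ≤ ringKrullDim (MvPolynomial ι K ⧸ P) := by
  let α := {Y : Set (PP K ι) // IsZClosed Y ∧ IsZIrreducible Y ∧ Y ⊆ zclosure S}
  by_cases hα : Nonempty α
  swap
  · rw [not_nonempty_iff] at hα
    have : zdim S = ⊥ := Order.krullDim_eq_bot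
    rw [this]; simp
  have h1 : zdim S + 1 = Order.krullDim (WithTop αᵒᵈ) := by
    rw [Order.krullDim_WithTop, Order.krullDim_orderDual]; rfl
  rw [h1, ringKrullDim_quotient]
  have hI0 : (I0 K ι).IsPrime := RingHom.ker_isPrime _
  have hle : ∀ Y : α, P ≤ IC Y.1 := fun Y => by
    refine hP.trans ?_
    rw [← IC_zclosure]
    exact IC_anti Y.2.2.2
  let F : WithTop αᵒᵈ → PrimeSpectrum.zeroLocus (P : Set (MvPolynomial ι K)) := fun y =>
    match y with
    | none => ⟨⟨I0 K ι, hI0⟩, by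
        obtain ⟨Y⟩ := hα
        exact (hle Y).trans (IC_lt_I0 Y.2.2.1.1).le⟩
    | some Y => ⟨⟨IC (OrderDual.ofDual Y).1, IC_prime (OrderDual.ofDual Y).2.2.1⟩,
        hle (OrderDual.ofDual Y)⟩
  refine Order.krullDim_le_of_strictMono F ?_
  intro y z hyz
  match y, z, hyz with
  | some Y, none, _ =>
    change IC (OrderDual.ofDual Y).1 < I0 K ι
    exact IC_lt_I0 (OrderDual.ofDual Y).2.2.1.1
  | some Y, some Z, h =>
    have h' : Y < Z := WithTop.coe_lt_coe.1 h
    change IC (OrderDual.ofDual Y).1 < IC (OrderDual.ofDual Z).1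
    have h2 : (OrderDual.ofDual Z).1 < (OrderDual.ofDual Y).1 := h'
    rw [lt_iff_le_not_ge]
    exact ⟨IC_anti h2.le, fun h3 => h2.not_ge (closed_of_IC (OrderDual.ofDual Z).2.1 h3)⟩
  | none, z, h => exact absurd h (by exact not_top_lt)

end geo

/-- Krull dimension gives algebraically independent elements -/
lemma krull_algInd {K B : Type*} [Field K] [CommRing B] [Nontrivial B] [Algebra K B]
    [Algebra.FiniteType K B] (d : ℕ) (h : (d : WithBot ℕ∞) ≤ ringKrullDim B) :
    ∃ x : Fin d → B, AlgebraicIndependent K x := by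
  obtain ⟨m, g, hg, hint⟩ := exists_integral_inj_algHom_of_fg K B
  let _ : Algebra (MvPolynomial (Fin m) K) B := g.toRingHom.toAlgebra
  have : Algebra.IsIntegral (MvPolynomial (Fin m) K) B := ⟨hint⟩
  have h1 : ringKrullDim B ≤ ringKrullDim (MvPolynomial (Fin m) K) := by
    refine Order.krullDim_le_of_strictMono (PrimeSpectrum.comap (algebraMap (MvPolynomial (Fin m) K) B)) ?_
    intro p q hpq
    exact Ideal.IsIntegral.comap_lt_comap (show p.asIdeal < q.asIdeal from hpq)
  rw [MvPolynomial.ringKrullDim_of_isNoetherianRing, ringKrullDim_eq_zero_of_field, zero_add,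
    Nat.card_eq_fintype_card, Fintype.card_fin] at h1
  have h2 : d ≤ m := by exact_mod_cast h.trans h1
  have h3 : AlgebraicIndependent K (fun i : Fin m => g (MvPolynomial.X i)) := by
    have := (MvPolynomial.algebraicIndependent_X (Fin m) K).map' hg
    exact this
  exact ⟨fun i => g (MvPolynomial.X (Fin.castLE h2 i)), h3.comp _ (Fin.castLE_injective h2)⟩


end part4

section part5
set_option linter.unusedSectionVars false
set_option linter.unusedVariables false
open Finset Function


section rk
variable {K Ω : Type*} [Field K] [Field Ω] [Algebra K Ω]

def TrGe (K : Type*) {Ω : Type*} [Field K] [Field Ω] [Algebra K Ω] {κ : Type*} (q : κ → Ω) (d : ℕ) :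
    Prop := ∃ e : Fin d → κ, AlgebraicIndependent K (q ∘ e)

def trk (K : Type*) {Ω : Type*} [Field K] [Field Ω] [Algebra K Ω] (S : Set Ω) : ℕ∞ :=
  (AlgebraicIndependent.matroid K Ω).eRk S

lemma adjoin_sub_closure (S : Set Ω) :
    (Algebra.adjoin K S : Set Ω) ⊆ (AlgebraicIndependent.matroid K Ω).closure S := by
  rw [AlgebraicIndependent.matroid_closure_eq]
  intro x hx
  rw [SetLike.mem_coe, Subalgebra.mem_algebraicClosure]
  exact isAlgebraic_algebraMap (⟨x, hx⟩ : Algebra.adjoin K S)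

lemma trk_adjoin_le {S T : Set Ω} (h : T ⊆ (Algebra.adjoin K S : Set Ω)) : trk K T ≤ trk K S := by
  unfold trk
  rw [← Matroid.eRk_closure_eq _ S]
  exact Matroid.eRk_mono _ (h.trans (adjoin_sub_closure S))

lemma le_trk_of_algInd {ι : Type*} [Fintype ι] {z : ι → Ω} (hz : AlgebraicIndependent K z) :
    (Fintype.card ι : ℕ∞) ≤ trk K (Set.range z) := by
  have h1 : (AlgebraicIndependent.matroid K Ω).Indep (Set.range z) := hz.to_subtype_range
  unfold trk
  rw [h1.eRk_eq_encard, ← Set.image_univ, hz.injective.injOn.encard_image, Set.encard_univ,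
    ENat.card_eq_coe_fintype_card]

lemma trk_range_le {ι : Type*} [Fintype ι] (z : ι → Ω) :
    trk K (Set.range z) ≤ Fintype.card ι := by
  refine (Matroid.eRk_le_encard _ _).trans ?_
  rw [← Set.image_univ]
  refine (Set.encard_image_le _ _).trans ?_
  rw [Set.encard_univ, ENat.card_eq_coe_fintype_card]

lemma TrGe_iff {κ : Type*} {q : κ → Ω} {d : ℕ} : TrGe K q d ↔ (d : ℕ∞) ≤ trk K (Set.range q) := by
  constructor
  · rintro ⟨e, he⟩
    have := le_trk_of_algInd he
    rw [Fintype.card_fin] at this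
    exact this.trans (Matroid.eRk_mono _ (Set.range_comp_subset_range _ _))
  · intro h
    unfold trk at h
    rw [Matroid.le_eRk_iff] at h
    obtain ⟨I, hI, hind, hcard⟩ := h
    have hfin : I.Finite := Set.finite_of_encard_eq_coe hcard
    have : Fintype I := hfin.fintype
    have hc : Fintype.card I = d := by
      rw [Set.encard_eq_coe_toFinset_card, Set.toFinset_card] at hcard
      exact_mod_cast hcard
    choose g hg using fun x : I => hI x.2
    let e := (Fintype.equivFinOfCardEq hc).symm
    refine ⟨fun i => g (e i), ?_⟩
    have h1 : AlgebraicIndependent K (fun x : I => (x : Ω)) := hind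
    have h2 := h1.comp e e.injective
    convert h2 using 1
    funext i
    exact hg (e i)

lemma rank_chart {κ κ' : Type*} [Fintype κ'] {q : κ → Ω} {z : κ' → Ω}
    (hq : ∀ i, q i ∈ Algebra.adjoin K (Set.range z)) (h : TrGe K q (Fintype.card κ')) :
    AlgebraicIndependent K z ∧ ∀ i, IsAlgebraic (Algebra.adjoin K (Set.range q)) (z i) := by
  rw [TrGe_iff] at h
  have hsub : Set.range q ⊆ (Algebra.adjoin K (Set.range z) : Set Ω) := by
    rintro _ ⟨i, rfl⟩; exact hq i
  have h1 : trk K (Set.range q) ≤ trk K (Set.range z) := trk_adjoin_le hsub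
  have h2 : trk K (Set.range z) ≤ Fintype.card κ' := trk_range_le z
  have h3 : trk K (Set.range z) = Fintype.card κ' := le_antisymm h2 (h.trans h1)
  have h4 : (Set.range z).encard = Fintype.card κ' := by
    apply le_antisymm
    · rw [← Set.image_univ]
      refine (Set.encard_image_le _ _).trans ?_
      rw [Set.encard_univ, ENat.card_eq_coe_fintype_card]
    · rw [← h3]; exact Matroid.eRk_le_encard _ _
  have hinj : Injective z := by
    classical
    have h5 : (Finset.univ.image z).card = Fintype.card κ' := by
      have : (Set.range z) = ((Finset.univ.image z : Finset Ω) : Set Ω) := by simp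
      rw [this, Set.encard_coe_eq_coe_finsetCard] at h4
      exact_mod_cast h4
    have := Finset.card_image_iff.1 (h5.trans Finset.card_univ.symm)
    exact fun a b hab => this (by simp) (by simp) hab
  constructor
  · have : (AlgebraicIndependent.matroid K Ω).Indep (Set.range z) :=
      (Matroid.indep_iff_eRk_eq_encard_of_finite (Set.finite_range z)).2 (h3.trans h4.symm)
    exact (algebraicIndependent_subtype_range hinj).1 this
  · intro i
    have hfin : (AlgebraicIndependent.matroid K Ω).IsRkFinite (Set.range q) := by
      rw [← Matroid.eRk_lt_top_iff]
      exact lt_of_le_of_lt (h1.trans h2) (by simp)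
    have h6 := hfin.closure_eq_closure_of_subset_of_eRk_ge_eRk
      (hsub.trans (adjoin_sub_closure _)) (by
        rw [Matroid.eRk_closure_eq]
        exact h2.trans h)
    rw [Matroid.closure_closure] at h6
    have h7 : z i ∈ (AlgebraicIndependent.matroid K Ω).closure (Set.range z) :=
      adjoin_sub_closure _ (Algebra.subset_adjoin ⟨i, rfl⟩)
    rw [← h6, AlgebraicIndependent.matroid_closure_eq] at h7
    rwa [SetLike.mem_coe, Subalgebra.mem_algebraicClosure] at h7

end rk

section param
variable {s : ℕ} {n : Fin s → ℕ}

abbrev Vr {s : ℕ} (n : Fin s → ℕ) (m : ℕ) : Type := Fin m × (Σ i : Fin s, Fin (n i + 1))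

def phi {R : Type*} [CommRing R] {m : ℕ} (x : Fin m → Par n R) : Idx n → R := ∑ a, ten (x a)

lemma phi_apply {R : Type*} [CommRing R] {m : ℕ} (x : Fin m → Par n R) (t : Idx n) :
    phi x t = ∑ a, ten (x a) t := by simp [phi]

lemma phi_map {R S : Type*} [CommRing R] [CommRing S] (φ : R →+* S) {m : ℕ} (x : Fin m → Par n R)
    (t : Idx n) : φ (phi x t) = phi (fun a i p => φ (x a i p)) t := by
  rw [phi_apply, phi_apply, map_sum]
  refine Finset.sum_congr rfl fun a _ => ?_
  rw [ten_apply, ten_apply, map_prod]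

def Xg (K : Type*) [Field K] (n : Fin s → ℕ) (m : ℕ) : Fin m → Par n (MvPolynomial (Vr n m) K) :=
  fun a i p => MvPolynomial.X (a, ⟨i, p⟩)

def ev (K : Type*) {Ω : Type*} [Field K] [CommRing Ω] [Algebra K Ω] {m : ℕ} (x : Fin m → Par n Ω) :
    MvPolynomial (Vr n m) K →ₐ[K] Ω := MvPolynomial.aeval (fun q => x q.1 q.2.1 q.2.2)

lemma ev_Xg {K Ω : Type*} [Field K] [CommRing Ω] [Algebra K Ω] {m : ℕ} (x : Fin m → Par n Ω)
    (a i p) : ev K x (Xg K n m a i p) = x a i p := by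
  simp [ev, Xg]

def PI (K : Type*) [Field K] (n : Fin s → ℕ) (m : ℕ) : Ideal (MvPolynomial (Idx n) K) :=
  RingHom.ker (MvPolynomial.aeval (phi (Xg K n m)) : MvPolynomial (Idx n) K →ₐ[K] _)

lemma aeval_phi {K Ω : Type*} [Field K] [CommRing Ω] [Algebra K Ω] {m : ℕ} (x : Fin m → Par n Ω)
    (f : MvPolynomial (Idx n) K) :
    MvPolynomial.aeval (phi x) f = ev K x (MvPolynomial.aeval (phi (Xg K n m)) f) := by
  rw [← AlgHom.comp_apply, MvPolynomial.comp_aeval]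
  congr 2
  funext t
  rw [← AlgHom.coe_toRingHom, phi_map]
  simp only [AlgHom.coe_toRingHom, ev_Xg]

lemma PI_vanish {K Ω : Type*} [Field K] [CommRing Ω] [Algebra K Ω] {m : ℕ} (x : Fin m → Par n Ω)
    {f : MvPolynomial (Idx n) K} (hf : f ∈ PI K n m) : MvPolynomial.aeval (phi x) f = 0 := by
  rw [aeval_phi, show MvPolynomial.aeval (phi (Xg K n m)) f = 0 from hf, map_zero]

lemma mv_exists_ne {K σ : Type*} [Field K] [Infinite K] {f : MvPolynomial σ K} (hf : f ≠ 0) :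
    ∃ v : σ → K, MvPolynomial.eval v f ≠ 0 := by
  by_contra! h
  exact hf (MvPolynomial.funext fun v => by rw [h v]; simp)

lemma ev_exists_ne {K : Type*} [Field K] [Infinite K] {m : ℕ} {f : MvPolynomial (Vr n m) K}
    (hf : f ≠ 0) : ∃ x : Fin m → Par n K, ev K x f ≠ 0 := by
  obtain ⟨v, hv⟩ := mv_exists_ne hf
  refine ⟨fun a i p => v (a, ⟨i, p⟩), ?_⟩
  rwa [ev, MvPolynomial.aeval_eq_eval]

instance PI_prime (K : Type*) [Field K] (m : ℕ) : (PI K n m).IsPrime := RingHom.ker_isPrime _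

/-- generic points -/
def Gen (K : Type*) {Ω : Type*} [Field K] [CommRing Ω] [Algebra K Ω] (m : ℕ) (q : Idx n → Ω) : Prop :=
  ∀ f : MvPolynomial (Idx n) K, MvPolynomial.aeval q f = 0 → f ∈ PI K n m

abbrev FF (K : Type*) [Field K] (n : Fin s → ℕ) (m : ℕ) := FractionRing (MvPolynomial (Vr n m) K)

def Ag (K : Type*) [Field K] (n : Fin s → ℕ) (m : ℕ) : Fin m → Par n (FF K n m) :=
  fun a i p => algebraMap _ _ (Xg K n m a i p)

lemma ev_Ag (K : Type*) [Field K] (n : Fin s → ℕ) (m : ℕ) (f : MvPolynomial (Vr n m) K) :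
    ev K (Ag K n m) f = algebraMap _ (FF K n m) f := by
  have : ev K (Ag K n m) = (Algebra.ofId (MvPolynomial (Vr n m) K) (FF K n m)).restrictScalars K := by
    apply MvPolynomial.algHom_ext
    rintro ⟨a, i, p⟩
    have := ev_Xg (K := K) (Ag K n m) a i p
    simp only [Xg, Ag] at this
    rw [this]; rfl
  rw [this]; rfl

lemma gen_Ag (K : Type*) [Field K] (n : Fin s → ℕ) (m : ℕ) : Gen K m (phi (Ag K n m)) := by
  intro f hf
  rw [aeval_phi, ev_Ag, map_eq_zero_iff _ (IsFractionRing.injective _ _)] at hf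
  exact hf

lemma algInd_Ag (K : Type*) [Field K] (n : Fin s → ℕ) (m : ℕ) :
    AlgebraicIndependent K (fun q : Vr n m => Ag K n m q.1 q.2.1 q.2.2) := by
  rw [algebraicIndependent_iff]
  intro f hf
  have : MvPolynomial.aeval (fun q : Vr n m => Ag K n m q.1 q.2.1 q.2.2) f = ev K (Ag K n m) f := rfl
  rw [this, ev_Ag, map_eq_zero_iff _ (IsFractionRing.injective _ _)] at hf
  exact hf

lemma TrGe_transfer {K Ω Ω' : Type*} [Field K] [Field Ω] [Algebra K Ω] [Field Ω'] [Algebra K Ω']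
    {m d : ℕ} {q : Idx n → Ω} (hq : Gen K m q) {x : Fin m → Par n Ω'} (h : TrGe K (phi x) d) :
    TrGe K q d := by
  obtain ⟨e, he⟩ := h
  refine ⟨e, ?_⟩
  rw [algebraicIndependent_iff] at he ⊢
  intro f hf
  apply he
  have h1 : MvPolynomial.aeval q (MvPolynomial.rename e f) = 0 := by
    rw [MvPolynomial.aeval_rename]; exact hf
  have h2 := PI_vanish x (hq _ h1)
  rwa [MvPolynomial.aeval_rename] at h2

end param

end part5

section part6
set_option linter.unusedSectionVars false
set_option linter.unusedVariables false
open Finset Function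


section seg
variable {s : ℕ} {n : Fin s → ℕ} {K : Type*} [Field K]

lemma mem_segre {x : PP K (Idx n)} : x ∈ segreVariety K s n ↔
    ∃ u : Par n K, x.submodule = Submodule.span K {ten u} := by
  have : ∀ u : Par n K, ten u = fun t => ∏ i, u i (t i) := fun u => funext fun t => ten_apply u t
  simp only [this]; rfl

lemma vspan_fin (i0 : Fin s) {m : ℕ} (S : Finset (PP K (Idx n)))
    (hS : (S : Set (PP K (Idx n))) ⊆ segreVariety K s n) (hm : S.card ≤ m) {v : Idx n → K}
    (hv : v ∈ vspan (S : Set (PP K (Idx n)))) :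
    ∃ x : Fin m → Par n K, v = phi x ∧ (∀ p ∈ S, ∃ a, ten (x a) ∈ p.submodule) ∧
      (∀ a, ten (x a) ≠ 0 → ∃ p ∈ S, ten (x a) ∈ p.submodule) ∧
      (S.card < m → ∃ a, ten (x a) = 0) := by
  choose u hu using fun p : S => mem_segre.1 (hS p.2)
  have h1 : vspan (S : Set (PP K (Idx n))) ≤ Submodule.span K (Set.range fun p : S => ten (u p)) := by
    unfold vspan coneOf
    rw [Submodule.span_le]
    intro w hw
    simp only [Set.mem_iUnion] at hw
    obtain ⟨p, hp, hw⟩ := hw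
    rw [SetLike.mem_coe, hu ⟨p, hp⟩] at hw
    refine Submodule.span_mono ?_ hw
    rintro _ rfl
    exact ⟨⟨p, hp⟩, rfl⟩
  obtain ⟨c, hc⟩ := (Submodule.mem_span_range_iff_exists_fun K).1 (h1 hv)
  let y : S → Par n K := fun p => update (u p) i0 (c p • u p i0)
  have hy : ∀ p, ten (y p) = c p • ten (u p) := fun p => by
    simp only [y]; rw [ten_smul_update, update_eq_self]
  let ι : S → Fin m := fun p => Fin.castLE hm (S.equivFin p)
  have hι : Injective ι := (Fin.castLE_injective hm).comp S.equivFin.injective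
  have hex : ∀ p, extend ι y 0 (ι p) = y p := fun p => hι.extend_apply _ _ _
  have hz : ∀ a, (¬ ∃ p, ι p = a) → ten (extend ι y 0 a) = 0 := fun a ha => by
    rw [extend_apply' _ _ _ ha]; exact ten_zero _ i0 rfl
  have hmem : ∀ p : S, ten (y p) ∈ (p : PP K (Idx n)).submodule := fun p => by
    rw [hy, hu]; exact Submodule.smul_mem _ _ (Submodule.mem_span_singleton_self _)
  refine ⟨extend ι y 0, ?_, ?_, ?_, ?_⟩
  · rw [← hc, phi]
    refine Fintype.sum_of_injective ι hι _ _ (fun a ha => hz a ?_) (fun p => ?_)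
    · rintro ⟨p, hp⟩; exact ha ⟨p, hp⟩
    · rw [hex, hy]
  · intro p hp
    exact ⟨ι ⟨p, hp⟩, by rw [hex]; exact hmem ⟨p, hp⟩⟩
  · intro a ha
    by_cases h : ∃ p, ι p = a
    · obtain ⟨p, rfl⟩ := h
      exact ⟨p, p.2, by rw [hex]; exact hmem p⟩
    · exact absurd (hz a h) ha
  · intro hlt
    have : ∃ a, ¬ ∃ p, ι p = a := by
      by_contra! h
      have h2 := Fintype.card_le_of_surjective ι h
      rw [Fintype.card_fin, Fintype.card_coe] at h2
      omega
    obtain ⟨a, ha⟩ := this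
    exact ⟨a, hz a ha⟩

lemma PI_le_IC [Infinite K] (i0 : Fin s) (m : ℕ) : PI K n m ≤ IC (secant m (segreVariety K s n)) := by
  unfold secant
  rw [IC_zclosure]
  rintro f hf q ⟨S, hS, hc, hq⟩ v hv
  obtain ⟨x, rfl, -⟩ := vspan_fin i0 S hS hc.le (hq hv)
  have := PI_vanish x hf
  rwa [MvPolynomial.aeval_eq_eval] at this

lemma TrGe_of_zdim [Infinite K] (i0 : Fin s) (m d : ℕ)
    (h : (d : WithBot ℕ∞) ≤ zdim (secant m (segreVariety K s n)) + 1) :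
    TrGe K (phi (Ag K n m)) d := by
  obtain ⟨x, hx⟩ := krull_algInd (K := K) (B := MvPolynomial (Idx n) K ⧸ PI K n m) d
    (h.trans (zdim_le _ _ (PI_le_IC i0 m)))
  rw [TrGe_iff]
  let θ : MvPolynomial (Idx n) K →ₐ[K] FF K n m := MvPolynomial.aeval (phi (Ag K n m))
  have hker : ∀ f ∈ PI K n m, θ f = 0 := fun f hf => PI_vanish _ hf
  let θ' := Ideal.Quotient.liftₐ (PI K n m) θ hker
  have hinj : Injective θ' := by
    rw [injective_iff_map_eq_zero]
    intro b hb
    obtain ⟨f, rfl⟩ := Ideal.Quotient.mk_surjective b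
    exact Ideal.Quotient.eq_zero_iff_mem.2 (gen_Ag K n m f hb)
  have h2 := le_trk_of_algInd (hx.map' hinj)
  rw [Fintype.card_fin] at h2
  refine h2.trans (trk_adjoin_le ?_)
  rintro _ ⟨i, rfl⟩
  obtain ⟨f, hf⟩ := Ideal.Quotient.mk_surjective (x i)
  have : (⇑θ' ∘ x) i = θ f := by simp only [comp_apply, ← hf]; rfl
  rw [this, SetLike.mem_coe, Algebra.adjoin_range_eq_range_aeval]
  exact ⟨f, rfl⟩

end seg

section chart
variable {s : ℕ} {n : Fin s → ℕ} {K Ω : Type*} [Field K] [Field Ω] [Algebra K Ω]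

lemma chart_exists (i0 : Fin s) {m : ℕ} (x : Fin m → Par n Ω) (c : Fin m → Par n K)
    (hc : ∀ a i p, c a i p ≠ 0) : ∃ (τ : Fin m → Idx n) (x' : Fin m → Par n Ω),
    (∀ a, ten (x' a) = ten (x a)) ∧
    ∀ a i, i ≠ i0 → x' a i (τ a i) = algebraMap K Ω (c a i (τ a i)) := by
  have key : ∀ a, ∃ (τ : Idx n) (x' : Par n Ω), ten x' = ten (x a) ∧
      ∀ i, i ≠ i0 → x' i (τ i) = algebraMap K Ω (c a i (τ i)) := by
    intro a
    by_cases h : ∀ i, x a i ≠ 0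
    · choose τ hτ using fun i => Function.ne_iff.1 (h i)
      let l : Fin s → Ω := fun i => algebraMap K Ω (c a i (τ i)) / x a i (τ i)
      have hl : ∀ i, l i ≠ 0 := fun i => div_ne_zero
        ((map_ne_zero (algebraMap K Ω)).2 (hc _ _ _)) (hτ i)
      let l' : Fin s → Ω := update l i0 (∏ i ∈ univ.erase i0, l i)⁻¹
      refine ⟨τ, fun i => l' i • x a i, ?_, ?_⟩
      · funext t
        rw [ten_apply, ten_apply]
        simp only [Pi.smul_apply, smul_eq_mul, Finset.prod_mul_distrib]
        have : ∏ i, l' i = 1 := by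
          rw [← Finset.mul_prod_erase univ l' (mem_univ i0)]
          have h3 : ∏ i ∈ univ.erase i0, l' i = ∏ i ∈ univ.erase i0, l i :=
            Finset.prod_congr rfl fun i hi => by simp [l', ne_of_mem_erase hi]
          rw [h3]
          simp only [l', update_self]
          exact inv_mul_cancel₀ (Finset.prod_ne_zero_iff.2 fun i _ => hl i)
        rw [this, one_mul]
      · intro i hi
        simp only [l', update_of_ne hi, Pi.smul_apply, smul_eq_mul, l]
        exact div_mul_cancel₀ _ (hτ i)
    · push Not at h
      obtain ⟨i, hi⟩ := h
      refine ⟨fun _ => 0, update (fun i p => algebraMap K Ω (c a i p)) i0 0, ?_, ?_⟩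
      · rw [ten_zero _ i hi, ten_zero _ i0 (by simp)]
      · intro i hi; rw [update_of_ne hi]
  choose τ x' h1 h2 using key
  exact ⟨τ, x', h1, h2⟩

abbrev CI (i0 : Fin s) {m : ℕ} (τ : Fin m → Idx n) : Type :=
  {q : Vr n m // q.2.1 = i0 ∨ q.2.2 ≠ τ q.1 q.2.1}

lemma card_CI (i0 : Fin s) {m : ℕ} (τ : Fin m → Idx n) :
    Fintype.card (CI i0 τ) = m * (∑ i, n i + 1) := by
  rw [Fintype.card_subtype, Finset.card_filter, Fintype.sum_prod_type]
  have : ∀ a, (∑ y : (Σ i : Fin s, Fin (n i + 1)), if y.1 = i0 ∨ y.2 ≠ τ a y.1 then 1 else 0)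
      = ∑ i, n i + 1 := by
    intro a
    rw [Fintype.sum_sigma]
    have h2 : ∀ i, (∑ y : Fin (n i + 1), if i = i0 ∨ y ≠ τ a i then 1 else 0)
        = n i + if i = i0 then 1 else 0 := by
      intro i
      by_cases hi : i = i0
      · simp [hi]
      · simp only [hi, false_or, if_false, add_zero]
        rw [← Finset.card_filter, Finset.filter_ne', Finset.card_erase_of_mem (mem_univ _)]
        simp
    simp only [h2, Finset.sum_add_distrib, Finset.sum_ite_eq', mem_univ, if_true]
  simp only [this]
  simp

abbrev zc (i0 : Fin s) {m : ℕ} (τ : Fin m → Idx n) (x : Fin m → Par n Ω) : CI i0 τ → Ω :=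
  fun q => x q.1.1 q.1.2.1 q.1.2.2

def IsChart (K : Type*) {Ω : Type*} [Field K] [Field Ω] [Algebra K Ω]
    (i0 : Fin s) {m : ℕ} (τ : Fin m → Idx n) (c : Fin m → Par n K) (x : Fin m → Par n Ω) :
    Prop := ∀ a i, i ≠ i0 → x a i (τ a i) = algebraMap K Ω (c a i (τ a i))

variable {i0 : Fin s} {m : ℕ} {τ : Fin m → Idx n} {c : Fin m → Par n K} {x : Fin m → Par n Ω}

lemma IsChart.mem (h : IsChart K i0 τ c x) (a i p) :
    x a i p ∈ Algebra.adjoin K (Set.range (zc i0 τ x)) := by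
  by_cases hq : i = i0 ∨ p ≠ τ a i
  · exact Algebra.subset_adjoin ⟨⟨(a, ⟨i, p⟩), hq⟩, rfl⟩
  · push Not at hq
    rw [hq.2, h a i hq.1]
    exact Subalgebra.algebraMap_mem _ _

lemma IsChart.phi_mem (h : IsChart K i0 τ c x) (t) :
    phi x t ∈ Algebra.adjoin K (Set.range (zc i0 τ x)) := by
  rw [phi_apply]
  refine Subalgebra.sum_mem _ fun a _ => ?_
  rw [ten_apply]
  exact Subalgebra.prod_mem _ fun i _ => h.mem a i _

lemma IsChart.rank (h : IsChart K i0 τ c x) (ht : TrGe K (phi x) (m * (∑ i, n i + 1))) :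
    AlgebraicIndependent K (zc i0 τ x) ∧
      ∀ a i p, IsAlgebraic (Algebra.adjoin K (Set.range (phi x))) (x a i p) := by
  rw [← card_CI i0 τ] at ht
  obtain ⟨h1, h2⟩ := rank_chart h.phi_mem ht
  refine ⟨h1, fun a i p => ?_⟩
  by_cases hq : i = i0 ∨ p ≠ τ a i
  · exact h2 ⟨(a, ⟨i, p⟩), hq⟩
  · push Not at hq
    rw [hq.2, h a i hq.1]
    exact isAlgebraic_algebraMap (algebraMap K (Algebra.adjoin K (Set.range (phi x))) _)

lemma IsChart.ne (h : IsChart K i0 τ c x) (hz : AlgebraicIndependent K (zc i0 τ x))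
    (g : MvPolynomial (Vr n m) K) (hg : ev K c g ≠ 0) : ev K x g ≠ 0 := by
  classical
  let θ : MvPolynomial (Vr n m) K →ₐ[K] MvPolynomial (CI i0 τ) K := MvPolynomial.aeval
    (fun q => if h : q.2.1 = i0 ∨ q.2.2 ≠ τ q.1 q.2.1 then MvPolynomial.X ⟨q, h⟩
      else MvPolynomial.C (c q.1 q.2.1 q.2.2))
  have h1 : (MvPolynomial.aeval (zc i0 τ x)).comp θ = ev K x := by
    apply MvPolynomial.algHom_ext
    rintro ⟨a, i, p⟩
    simp only [AlgHom.comp_apply, θ, ev, MvPolynomial.aeval_X]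
    split_ifs with hq
    · simp
    · push Not at hq
      rw [MvPolynomial.aeval_C, hq.2, h a i hq.1]
  have h2 : (MvPolynomial.aeval (zc i0 τ c)).comp θ = ev K c := by
    apply MvPolynomial.algHom_ext
    rintro ⟨a, i, p⟩
    simp only [AlgHom.comp_apply, θ, ev, MvPolynomial.aeval_X]
    split_ifs with hq
    · simp
    · rw [MvPolynomial.aeval_C]; rfl
  intro h0
  apply hg
  rw [← h1, AlgHom.comp_apply] at h0
  rw [← h2, AlgHom.comp_apply, (algebraicIndependent_iff.1 hz) _ h0, map_zero]

lemma IsChart.der [CharZero K] (h : IsChart K i0 τ c x) (hz : AlgebraicIndependent K (zc i0 τ x))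
    (d : Fin m → Par n Ω) : ∃ D : Derivation K Ω Ω, ∀ a i p, D (x a i p) =
      if i = i0 ∨ p ≠ τ a i then d a i p else 0 := by
  obtain ⟨D, hD⟩ := der_ext (zc i0 τ x) hz (fun q => d q.1.1 q.1.2.1 q.1.2.2)
  refine ⟨D, fun a i p => ?_⟩
  split_ifs with hq
  · exact hD ⟨(a, ⟨i, p⟩), hq⟩
  · push Not at hq
    rw [hq.2, h a i hq.1, Derivation.map_algebraMap]

lemma der_phi (D : Derivation K Ω Ω) (x : Fin m → Par n Ω) (t : Idx n) :
    D (phi x t) = ∑ a, dten (x a) (pmap D (x a)) t := by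
  rw [phi_apply, map_sum]
  exact Finset.sum_congr rfl fun a _ => der_ten D _ _

lemma TrGe_restrict (i0 : Fin s) {j l : ℕ} (x : Fin (j + l) → Par n Ω)
    (h : TrGe K (phi x) ((j + l) * (∑ i, n i + 1))) :
    TrGe K (phi (fun a : Fin j => x (Fin.castAdd l a))) (j * (∑ i, n i + 1)) := by
  obtain ⟨τ, y, hy, hc⟩ := chart_exists (K := K) i0 (fun a : Fin l => x (Fin.natAdd j a))
    (fun _ _ _ => 1) (by simp)
  have hch : IsChart K i0 τ (fun _ _ _ => 1) y := hc
  rw [TrGe_iff] at h ⊢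
  set x1 := (fun a : Fin j => x (Fin.castAdd l a))
  have hphi : phi x = phi x1 + phi y := by
    simp only [phi, Fin.sum_univ_add, x1, hy]
  have h1 : trk K (Set.range (phi x)) ≤ trk K (Set.range (phi x1) ∪ Set.range (zc i0 τ y)) := by
    apply trk_adjoin_le
    rintro _ ⟨t, rfl⟩
    rw [hphi, Pi.add_apply, SetLike.mem_coe]
    refine Subalgebra.add_mem _ (Algebra.subset_adjoin (Or.inl ⟨t, rfl⟩)) ?_
    exact Algebra.adjoin_mono Set.subset_union_right (hch.phi_mem t)
  have h2 : trk K (Set.range (phi x1) ∪ Set.range (zc i0 τ y)) ≤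
      trk K (Set.range (phi x1)) + (l * (∑ i, n i + 1) : ℕ) := by
    refine (Matroid.eRk_union_le_eRk_add_eRk _ _ _).trans ?_
    refine add_le_add le_rfl ?_
    rw [← card_CI i0 τ]
    exact trk_range_le _
  have h3 := h.trans (h1.trans h2)
  rw [add_mul] at h3
  push_cast at h3 ⊢
  refine (ENat.add_le_add_iff_right ?_).1 h3
  exact_mod_cast ENat.natCast_ne_top (l * (∑ i, n i + 1))

end chart

section gen
variable {s : ℕ} {n : Fin s → ℕ} {K : Type*} [Field K] [CharZero K]

lemma G1_Ag (i0 : Fin s) (m : ℕ) (ht : TrGe K (phi (Ag K n m)) (m * (∑ i, n i + 1))) :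
    G1 (Ag K n m) := by
  intro v hv
  obtain ⟨τ, y, hy, hc⟩ := chart_exists (K := K) i0 (Ag K n m) (fun _ _ _ => 1) (by simp)
  have hch : IsChart K i0 τ (fun _ _ _ => 1) y := hc
  have hphi : phi y = phi (Ag K n m) := by simp only [phi, hy]
  rw [← hphi] at ht
  obtain ⟨-, h2⟩ := hch.rank ht
  obtain ⟨D, hD⟩ := der_ext _ (algInd_Ag K n m) (fun q => v q.1 q.2.1 q.2.2)
  have hD' : ∀ a, pmap D (Ag K n m a) = v a := fun a => by
    funext i p; exact hD (a, ⟨i, p⟩)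
  have h0 : ∀ z ∈ Algebra.adjoin K (Set.range (phi y)), D z = 0 := by
    intro z hz
    have := Derivation.eqOn_adjoin (D1 := D) (D2 := 0) (s := Set.range (phi y)) (by
      rintro _ ⟨t, rfl⟩
      rw [hphi, der_phi]
      have := congrFun hv t
      simp only [Finset.sum_apply, Pi.zero_apply] at this
      simp only [hD', this, Derivation.coe_zero, Pi.zero_apply])
    exact this hz
  intro a
  funext t
  have h3 := der_ten D (Ag K n m a) t
  rw [hD', ← hy, der_ten] at h3
  have h4 : pmap D (y a) = 0 := by
    funext i p; exact der_kill_algebraic D _ h0 (h2 a i p)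
  rw [h4, map_zero] at h3
  exact h3.symm

end gen

end part6

section part7
set_option linter.unusedSectionVars false
set_option linter.unusedVariables false
open Finset Function


section cert

lemma cert1 {R F κ ι : Type*} [CommRing R] [IsDomain R] [Field F] [Fintype κ] [Fintype ι]
    (ψF : R →+* F) (hinj : Injective ψF) (L : ι → κ → R) (f : κ → R)
    (h : ∀ v : κ → F, (∀ i, ∑ k, v k * ψF (L i k) = 0) → ∑ k, v k * ψF (f k) = 0) :
    ∃ (g : R) (c : ι → R), g ≠ 0 ∧ ∀ k, g * f k = ∑ i, c i * L i k := by
  classical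
  let Q := FractionRing R
  let θ : Q →+* F := IsFractionRing.lift hinj
  have hθ : ∀ r : R, θ (algebraMap R Q r) = ψF r := fun r => IsFractionRing.lift_algebraMap hinj r
  let Lf : (κ → R) → ((κ → Q) →ₗ[Q] Q) := fun l =>
    ∑ k, (algebraMap R Q (l k)) • LinearMap.proj k
  have hLf : ∀ l v, Lf l v = ∑ k, v k * algebraMap R Q (l k) := by
    intro l v
    simp only [Lf, LinearMap.sum_apply, LinearMap.smul_apply, LinearMap.proj_apply, smul_eq_mul]
    exact Finset.sum_congr rfl fun k _ => mul_comm _ _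
  have hmem : Lf f ∈ Submodule.span Q (Set.range fun i => Lf (L i)) := by
    apply mem_span_of_iInf_ker_le_ker
    intro v hv
    simp only [Submodule.mem_iInf, LinearMap.mem_ker, hLf] at hv ⊢
    apply θ.injective
    have := h (fun k => θ (v k)) (fun i => by
      have := congrArg θ (hv i)
      simpa [map_sum, hθ] using this)
    simpa [map_sum, hθ] using this
  obtain ⟨c, hc⟩ := (Submodule.mem_span_range_iff_exists_fun Q).1 hmem
  obtain ⟨b, hb⟩ := IsLocalization.exist_integer_multiples_of_finite (nonZeroDivisors R) c
  choose c' hc' using hb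
  refine ⟨b, c', nonZeroDivisors.ne_zero b.2, fun k => ?_⟩
  apply IsFractionRing.injective R Q
  have h1 := congrArg (fun T => T (Pi.single k 1)) hc
  simp only [LinearMap.sum_apply, LinearMap.smul_apply, hLf, Pi.single_apply, ite_mul, one_mul,
    zero_mul, Finset.sum_ite_eq', mem_univ, if_true, smul_eq_mul] at h1
  rw [map_mul, map_sum, ← h1, Finset.mul_sum]
  refine Finset.sum_congr rfl fun i _ => ?_
  rw [map_mul, hc', Algebra.smul_def, mul_assoc]

lemma cert {R F κ ι ρ : Type*} [CommRing R] [IsDomain R] [Field F] [Fintype κ] [Fintype ι]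
    [Fintype ρ] (ψF : R →+* F) (hinj : Injective ψF) (L : ι → κ → R) (f : ρ → κ → R)
    (h : ∀ v : κ → F, (∀ i, ∑ k, v k * ψF (L i k) = 0) → ∀ e, ∑ k, v k * ψF (f e k) = 0) :
    ∃ g : R, g ≠ 0 ∧ ∀ (Ω : Type uK) [Field Ω] (ψ : R →+* Ω), ψ g ≠ 0 → ∀ v : κ → Ω,
      (∀ i, ∑ k, v k * ψ (L i k) = 0) → ∀ e, ∑ k, v k * ψ (f e k) = 0 := by
  choose g c hg hgc using fun e => cert1 ψF hinj L (f e) (fun v hv => h v hv e)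
  refine ⟨∏ e, g e, Finset.prod_ne_zero_iff.2 fun e _ => hg e, ?_⟩
  intro Ω _ ψ hψ v hv e
  rw [map_prod, Finset.prod_ne_zero_iff] at hψ
  have h1 := hψ e (mem_univ e)
  have h2 : ψ (g e) * ∑ k, v k * ψ (f e k) = 0 := by
    have : ∀ k, ψ (g e) * (v k * ψ (f e k)) = ∑ i, ψ (c e i) * (v k * ψ (L i k)) := by
      intro k
      have := congrArg ψ (hgc e k)
      rw [map_mul, map_sum] at this
      rw [mul_left_comm, this, Finset.mul_sum]
      refine Finset.sum_congr rfl fun i _ => ?_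
      rw [map_mul]; ring
    rw [Finset.mul_sum]
    simp only [this]
    rw [Finset.sum_comm]
    refine Finset.sum_eq_zero fun i _ => ?_
    rw [← Finset.mul_sum, hv i, mul_zero]
  exact (mul_eq_zero.1 h2).resolve_left h1

end cert

section good
variable {s : ℕ} {n : Fin s → ℕ}

abbrev Sg {s : ℕ} (n : Fin s → ℕ) : Type := Σ i : Fin s, Fin (n i + 1)

def eB {R : Type*} [CommRing R] (q : Sg n) : Par n R := fun i p => if (⟨i, p⟩ : Sg n) = q then 1 else 0

lemma par_eB {R : Type*} [CommRing R] (v : Par n R) : v = ∑ q : Sg n, v q.1 q.2 • eB q := by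
  funext i p
  simp only [Finset.sum_apply, Pi.smul_apply, eB, smul_eq_mul, mul_ite, mul_one, mul_zero,
    Finset.sum_ite_eq, mem_univ, if_true]

lemma lin_eB {R V : Type*} [CommRing R] [AddCommGroup V] [Module R V] (T : Par n R →ₗ[R] V)
    (v : Par n R) : T v = ∑ q : Sg n, v q.1 q.2 • T (eB q) := by
  conv_lhs => rw [par_eB v]
  rw [map_sum]; simp only [map_smul]

lemma lin_eB_apply {R : Type*} [CommRing R] (T : Par n R →ₗ[R] (Idx n → R))
    (v : Par n R) (t) : T v t = ∑ q : Sg n, v q.1 q.2 * T (eB q) t := by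
  rw [lin_eB T v]; simp

lemma pmap_eB {R S : Type*} [CommRing R] [CommRing S] (φ : R →+* S) (q : Sg n) :
    pmap φ (eB q : Par n R) = eB q := by
  funext i p; simp only [pmap, eB]; split_ifs <;> simp

structure Good {Ω : Type*} [Field Ω] {j : ℕ} (x : Fin j → Par n Ω) : Prop where
  nz : ∀ a i p, x a i p ≠ 0
  g1 : G1 x
  g2 : ∀ b, ZZ x Set.univ b ≤ UU (x b)

lemma pmap_ev {K Ω : Type*} [Field K] [Field Ω] [Algebra K Ω] {j : ℕ} (x : Fin j → Par n Ω) (a) :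
    pmap (ev K x : _ →+* Ω) (Xg K n j a) = x a := by
  funext i p; exact ev_Xg x a i p

lemma cert_G1 {K F : Type*} [Field K] [Field F] [Algebra K F] {j : ℕ} (A : Fin j → Par n F)
    (hinj : Injective (ev K A)) (h : G1 A) : ∃ g : MvPolynomial (Vr n j) K, g ≠ 0 ∧
      ∀ (Ω : Type uK) [Field Ω] [Algebra K Ω] (x : Fin j → Par n Ω), ev K x g ≠ 0 → G1 x := by
  have hL : ∀ (Ω : Type _) [Field Ω] [Algebra K Ω] (x : Fin j → Par n Ω) (a : Fin j) (q : Sg n) (t : Idx n),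
    (ev K x : _ →+* Ω) (dten (Xg K n j a) (eB q) t) = dten (x a) (eB q) t := by
    intro Ω _ _ x a q t
    rw [dten_map, pmap_eB, pmap_ev]
  have hL2 : ∀ (Ω : Type _) [Field Ω] [Algebra K Ω] (x : Fin j → Par n Ω) (a : Fin j) (q : Sg n) (t : Idx n),
    (ev K x : _ →+* Ω) (dten (Xg K n j a) (eB q) t) = dten (x a) (eB q) t := by
    intro Ω _ _ x a q t
    rw [dten_map, pmap_eB, pmap_ev]
  obtain ⟨g, hg, hc⟩ := cert.{uK} (κ := Vr n j) (ι := Idx n) (ρ := Fin j × Idx n)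
    (ev K A : MvPolynomial (Vr n j) K →+* F) hinj
    (fun t q => dten (Xg K n j q.1) (eB q.2) t)
    (fun e q => if q.1 = e.1 then dten (Xg K n j q.1) (eB q.2) e.2 else 0) (by
      intro v hv e
      have h1 := h (fun a i p => v (a, ⟨i, p⟩)) (by
        funext t
        have := hv t
        rw [Fintype.sum_prod_type] at this
        rw [Finset.sum_apply, Pi.zero_apply, ← this]
        refine Finset.sum_congr rfl fun a _ => ?_
        rw [lin_eB_apply]
        refine Finset.sum_congr rfl fun q _ => ?_
        rw [hL]) e.1
      have h2 := congrFun h1 e.2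
      rw [lin_eB_apply] at h2
      rw [Fintype.sum_prod_type, Finset.sum_eq_single e.1]
      · refine Eq.trans ?_ h2
        refine Finset.sum_congr rfl fun q _ => ?_
        simp only [if_true, hL]
      · intro a _ ha; simp [ha]
      · simp)
  refine ⟨g, hg, fun Ω _ _ x hx v hv a => ?_⟩
  funext t
  have h3 := hc Ω (ev K x : MvPolynomial (Vr n j) K →+* Ω) hx (fun q => v q.1 q.2.1 q.2.2) (by
    intro t
    have := congrFun hv t
    rw [Finset.sum_apply, Pi.zero_apply] at this
    rw [Fintype.sum_prod_type, ← this]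
    refine Finset.sum_congr rfl fun a _ => ?_
    rw [lin_eB_apply (dten (x a))]
    refine Finset.sum_congr rfl fun q _ => ?_
    rw [hL2]) (a, t)
  rw [Fintype.sum_prod_type, Finset.sum_eq_single a] at h3
  · rw [Pi.zero_apply, ← h3, lin_eB_apply (dten (x a))]
    refine Finset.sum_congr rfl fun q _ => ?_
    simp only [if_true, hL2]
  · intro a' _ ha; simp [ha]
  · simp

def LL (K : Type*) [Field K] (n : Fin s → ℕ) (j : ℕ) (b : Fin j) (e : Sg n × Idx n) :
    (Sg n ⊕ (Sg n × Vr n j)) → MvPolynomial (Vr n j) K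
  | Sum.inl q => II (Xg K n j b) (eB e.1) (eB q) e.2
  | Sum.inr q => if q.1 = e.1 then - dten (Xg K n j q.2.1) (eB q.2.2) e.2 else 0

lemma LL_sum {K Ω : Type*} [Field K] [Field Ω] [Algebra K Ω] {j : ℕ} (x : Fin j → Par n Ω)
    (b : Fin j) (e : Sg n × Idx n) (v : (Sg n ⊕ (Sg n × Vr n j)) → Ω) :
    ∑ k, v k * (ev K x : _ →+* Ω) (LL K n j b e k) =
      II (x b) (eB e.1) (fun i p => v (Sum.inl ⟨i, p⟩)) e.2
        - ∑ a, dten (x a) (fun i p => v (Sum.inr (e.1, (a, ⟨i, p⟩)))) e.2 := by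
  rw [Fintype.sum_sum_type, sub_eq_add_neg]
  congr 1
  · rw [lin_eB_apply]
    refine Finset.sum_congr rfl fun q _ => ?_
    simp only [LL]
    rw [II_map, pmap_eB, pmap_eB, pmap_ev]
  · rw [Fintype.sum_prod_type, Finset.sum_eq_single e.1]
    · rw [Fintype.sum_prod_type, ← Finset.sum_neg_distrib]
      refine Finset.sum_congr rfl fun a _ => ?_
      rw [lin_eB_apply, ← Finset.sum_neg_distrib]
      refine Finset.sum_congr rfl fun q _ => ?_
      simp only [LL, if_true, map_neg]
      rw [dten_map, pmap_eB, pmap_ev, mul_neg]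
    · intro q _ hq
      refine Finset.sum_eq_zero fun r _ => ?_
      simp only [LL, hq, if_false, map_zero, mul_zero]
    · simp

def LU (K : Type*) [Field K] (n : Fin s → ℕ) (j : ℕ) (b : Fin j) (e : Sg n × Sg n) :
    (Sg n ⊕ (Sg n × Vr n j)) → MvPolynomial (Vr n j) K
  | Sum.inl q => if e.1.1 = e.2.1 then ((if q = e.1 then Xg K n j b e.2.1 e.2.2 else 0)
      - (if q = e.2 then Xg K n j b e.1.1 e.1.2 else 0)) else 0
  | Sum.inr q => 0

lemma LU_sum {K Ω : Type*} [Field K] [Field Ω] [Algebra K Ω] {j : ℕ} (x : Fin j → Par n Ω)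
    (b : Fin j) (i p q) (v : (Sg n ⊕ (Sg n × Vr n j)) → Ω) :
    ∑ k, v k * (ev K x : _ →+* Ω) (LU K n j b (⟨i, p⟩, ⟨i, q⟩) k) =
      v (Sum.inl ⟨i, p⟩) * x b i q - v (Sum.inl ⟨i, q⟩) * x b i p := by
  rw [Fintype.sum_sum_type]
  have hX : ∀ i p, (ev K x : MvPolynomial (Vr n j) K →+* Ω) (Xg K n j b i p) = x b i p :=
    fun i p => ev_Xg x b i p
  have hI : ∀ (P : Prop) [Decidable P] (r : MvPolynomial (Vr n j) K),
      (ev K x : MvPolynomial (Vr n j) K →+* Ω) (if P then r else 0) =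
        if P then (ev K x : MvPolynomial (Vr n j) K →+* Ω) r else 0 := by
    intro P _ r; split_ifs <;> simp
  simp only [LU, if_true, map_sub, hI, hX, mul_sub, mul_ite, mul_zero, map_zero,
    Finset.sum_sub_distrib, Finset.sum_ite_eq', Finset.mem_univ, Finset.sum_const_zero, add_zero]

lemma cert_G2 {K F : Type*} [Field K] [Field F] [Algebra K F] {j : ℕ} (A : Fin j → Par n F)
    (hinj : Injective (ev K A)) (b : Fin j) (h : ZZ A Set.univ b ≤ UU (A b)) :
    ∃ g : MvPolynomial (Vr n j) K, g ≠ 0 ∧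
      ∀ (Ω : Type uK) [Field Ω] [Algebra K Ω] (x : Fin j → Par n Ω), ev K x g ≠ 0 →
        ZZ x Set.univ b ≤ UU (x b) := by
  obtain ⟨g, hg, hc⟩ := cert.{uK} (κ := Sg n ⊕ (Sg n × Vr n j)) (ι := Sg n × Idx n)
    (ρ := Σ i : Fin s, Fin (n i + 1) × Fin (n i + 1))
    (ev K A : MvPolynomial (Vr n j) K →+* F) hinj (LL K n j b)
    (fun e => LU K n j b (⟨e.1, e.2.1⟩, ⟨e.1, e.2.2⟩)) (by
      rintro v hv ⟨i, p, q⟩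
      rw [LU_sum, sub_eq_zero]
      refine mem_UU.1 (@h (fun i p => v (Sum.inl ⟨i, p⟩)) ?_) i p q
      rw [mem_ZZ]
      intro w
      rw [II_symm, lin_eB (II _ _) w]
      refine Submodule.sum_mem _ fun q _ => Submodule.smul_mem _ _ ?_
      rw [II_symm]
      refine ⟨fun a i p => v (Sum.inr (q, (a, ⟨i, p⟩))), by simp, ?_⟩
      funext t
      have := hv (q, t)
      rw [LL_sum, sub_eq_zero] at this
      rw [this, Finset.sum_apply])
  refine ⟨g, hg, fun Ω _ _ x hx v hv => ?_⟩
  rw [mem_ZZ] at hv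
  choose T hT0 hT using fun q : Sg n => hv (eB q)
  intro i p q
  have h3 := hc Ω (ev K x : MvPolynomial (Vr n j) K →+* Ω) hx
    (fun k => match k with
      | Sum.inl q => v q.1 q.2
      | Sum.inr q => T q.1 q.2.1 q.2.2.1 q.2.2.2) (by
    intro e
    rw [LL_sum, sub_eq_zero]
    have := congrFun (hT e.1) e.2
    rw [Finset.sum_apply] at this
    exact this) ⟨i, p, q⟩
  rw [LU_sum, sub_eq_zero] at h3
  exact h3

lemma cert_Good {K F : Type*} [Field K] [Field F] [Algebra K F] {j : ℕ} (A : Fin j → Par n F)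
    (hinj : Injective (ev K A)) (h : Good A) :
    ∃ g : MvPolynomial (Vr n j) K, g ≠ 0 ∧
      ∀ (Ω : Type uK) [Field Ω] [Algebra K Ω] (x : Fin j → Par n Ω), ev K x g ≠ 0 → Good x := by
  obtain ⟨g1, hg1, h1⟩ := cert_G1.{uK} A hinj h.g1
  choose g2 hg2 h2 using fun b => cert_G2.{uK} A hinj b (h.g2 b)
  refine ⟨g1 * (∏ b, g2 b) * ∏ q : Vr n j, MvPolynomial.X q, ?_, ?_⟩
  · refine mul_ne_zero (mul_ne_zero hg1 (Finset.prod_ne_zero_iff.2 fun b _ => hg2 b)) ?_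
    exact Finset.prod_ne_zero_iff.2 fun q _ => MvPolynomial.X_ne_zero q
  · intro Ω _ _ x hx
    rw [map_mul, map_mul, map_prod, map_prod] at hx
    have h3 := left_ne_zero_of_mul (left_ne_zero_of_mul hx)
    have h4 := Finset.prod_ne_zero_iff.1 (right_ne_zero_of_mul (left_ne_zero_of_mul hx))
    have h5 := Finset.prod_ne_zero_iff.1 (right_ne_zero_of_mul hx)
    refine ⟨fun a i p => ?_, h1 Ω x h3, fun b => h2 b Ω x (h4 b (mem_univ b))⟩
    have := h5 (a, ⟨i, p⟩) (mem_univ _)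
    rwa [show (MvPolynomial.X (a, ⟨i, p⟩) : MvPolynomial (Vr n j) K) = Xg K n j a i p from rfl,
      ev_Xg] at this

lemma Good_Ag {K : Type*} [Field K] [CharZero K] (hs : 2 ≤ s) (hn : ∀ i, 0 < n i) (k M : ℕ)
    (hk : 1 ≤ k) (hM : M = k + ∑ i, n i - 1)
    (ht : TrGe K (phi (Ag K n M)) (M * (∑ i, n i + 1)))
    (hcard : M * (∑ i, n i + 1) < Fintype.card (Idx n)) (j : ℕ) (ι : Fin j → Fin M)
    (hι : Injective ι) (hιk : ∀ a, (ι a).val < k) : Good (fun a => Ag K n M (ι a)) := by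
  have i0 : Fin s := ⟨0, by omega⟩
  have hG1 : G1 (Ag K n M) := G1_Ag i0 M ht
  have hnz : ∀ a i p, Ag K n M a i p ≠ 0 := by
    intro a i p
    unfold Ag
    rw [map_ne_zero_iff _ (IsFractionRing.injective _ _)]
    exact MvPolynomial.X_ne_zero _
  have hmain := main_generic (K := K) hs hn (Ag K n M) hnz (by
      intro d
      obtain ⟨D, hD⟩ := der_ext _ (algInd_Ag K n M) (fun q => d q.1 q.2.1 q.2.2)
      exact ⟨D, fun a i p => hD (a, ⟨i, p⟩)⟩) hG1 (by
      intro σ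
      let e := (MvPolynomial.renameEquiv K (σ.prodCongr (Equiv.refl (Sg n)))).toRingEquiv
      refine ⟨IsFractionRing.ringEquivOfRingEquiv (K := FF K n M) (L := FF K n M) e, fun a i p => ?_⟩
      unfold Ag
      rw [IsFractionRing.ringEquivOfRingEquiv_algebraMap]
      congr 1
      change MvPolynomial.rename _ (MvPolynomial.X _) = MvPolynomial.X _
      rw [MvPolynomial.rename_X]; rfl) hcard k hk hM
  refine ⟨fun a => hnz _, ?_, ?_⟩
  · intro v hv a
    have h1 := hG1 (extend ι v 0) (by
      rw [← hv]
      symm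
      refine Fintype.sum_of_injective ι hι _ _ (fun b hb => ?_) (fun b => ?_)
      · rw [extend_apply' _ _ _ (fun ⟨c, hc⟩ => hb ⟨c, hc⟩)]; simp
      · rw [hι.extend_apply]) (ι a)
    rwa [hι.extend_apply] at h1
  · intro b v hv
    refine hmain (ι b) (hιk b) ?_
    intro w
    obtain ⟨z, -, hz⟩ := hv w
    rw [hz]
    exact Submodule.sum_mem _ fun a _ =>
      dten_mem_MM (A := Ag K n M) (B := BB M k) (a := ι a) (hιk a) _

end good

end part7

section part8
set_option linter.unusedSectionVars false
set_option linter.unusedVariables false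
open Finset Function


section om
variable {s : ℕ} {n : Fin s → ℕ}

lemma dten_single {F : Type*} [Field F] (u : Par n F) (i : Fin s) (e : Fin (n i + 1) → F) :
    dten u (Pi.single i e) = ten (update u i e) := by
  classical
  rw [dten_apply, Finset.sum_eq_single i]
  · rw [Pi.single_eq_same]
  · intro l _ hl
    rw [Pi.single_eq_of_ne hl]
    exact ten_zero _ l (by rw [update_self])
  · simp

lemma ten_ne {F : Type*} [Field F] (u : Par n F) (h : ∀ i p, u i p ≠ 0) : ten u ≠ 0 := by
  intro h0
  have := congrFun h0 (fun _ => 0)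
  rw [ten_apply, Pi.zero_apply, Finset.prod_eq_zero_iff] at this
  obtain ⟨i, -, hi⟩ := this
  exact h i _ hi

lemma G1.indep {F : Type*} [Field F] {m : ℕ} {x : Fin m → Par n F} (h : G1 x) (i0 : Fin s)
    (hx : ∀ a i p, x a i p ≠ 0) (c : Fin m → F) (hc : ∑ a, c a • ten (x a) = 0) (a) : c a = 0 := by
  have h1 : ∀ a, dten (x a) (Pi.single i0 (c a • x a i0)) = c a • ten (x a) := by
    intro a
    rw [dten_single, ten_smul_update, update_eq_self]
  have h2 := h (fun a => Pi.single i0 (c a • x a i0)) (by simp only [h1]; exact hc) a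
  simp only [h1] at h2
  exact (smul_eq_zero.1 h2).resolve_right (ten_ne _ (hx a))

lemma rank_one_match {F : Type*} [Field F] {m : ℕ} {x : Fin m → Par n F} (h : G1 x)
    (hx : ∀ a i p, x a i p ≠ 0) (y : Par n F) (hy : ∀ i p, y i p ≠ 0) (ν : Fin m → F)
    (hν : ten y = ∑ a, ν a • ten (x a)) : ∃ (a : Fin m) (μ : F), ten y = μ • ten (x a) := by
  classical
  have key : ∀ i p q a, ν a * (y i q * x a i p - y i p * x a i q) = 0 := by
    intro i p q a
    have h1 := h (fun a => Pi.single i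
        ((ν a * (y i q * x a i p - y i p * x a i q)) • (fun _ => (1:F)))) (by
      funext t
      rw [Finset.sum_apply, Pi.zero_apply]
      have hp := congrFun hν (update t i p)
      have hq := congrFun hν (update t i q)
      rw [Finset.sum_apply] at hp hq
      simp only [Pi.smul_apply, smul_eq_mul, ten_at1] at hp hq
      have : y i q * (y i p * ∏ l ∈ univ.erase i, y l (t l))
        - y i p * (y i q * ∏ l ∈ univ.erase i, y l (t l)) = 0 := by ring
      rw [hp, hq, Finset.mul_sum, Finset.mul_sum, ← Finset.sum_sub_distrib] at this
      rw [← this]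
      refine Finset.sum_congr rfl fun b _ => ?_
      rw [dten_single, ten_smul_update, Pi.smul_apply, smul_eq_mul]
      have h3 := ten_at1 (update (x b) i (fun _ => (1:F))) t i (t i)
      rw [update_eq_self, update_self] at h3
      rw [h3, Finset.prod_congr rfl (g := fun l => x b l (t l)) (fun l hl => by
        rw [update_of_ne (Finset.ne_of_mem_erase hl)])]
      ring) a
    simp only [dten_single, ten_smul_update] at h1
    refine (smul_eq_zero.1 h1).resolve_right (ten_ne _ fun l r => ?_)
    by_cases hl : l = i
    · subst hl; rw [update_self]; exact one_ne_zero
    · rw [update_of_ne hl]; exact hx a l r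
  obtain ⟨a, ha⟩ : ∃ a, ν a ≠ 0 := by
    by_contra! hcon
    apply ten_ne y hy
    rw [hν]
    exact Finset.sum_eq_zero fun a _ => by rw [hcon, zero_smul]
  refine ⟨a, ∏ i, (y i 0 / x a i 0), ?_⟩
  funext t
  rw [Pi.smul_apply, smul_eq_mul, ten_apply, ten_apply, ← Finset.prod_mul_distrib]
  refine Finset.prod_congr rfl fun i _ => ?_
  have h1 := sub_eq_zero.1 ((mul_eq_zero.1 (key i (t i) 0 a)).resolve_left ha)
  have := hx a i 0
  field_simp
  rw [h1]

variable {K : Type uK} {Ω : Type uK} [Field K] [CharZero K] [Field Ω] [Algebra K Ω]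

lemma chart_MM_le {i0 : Fin s} {m : ℕ} {τ : Fin m → Idx n} {c : Fin m → Par n K}
    {x y : Fin m → Par n Ω} (hch : IsChart K i0 τ c x)
    (hz : AlgebraicIndependent K (zc i0 τ x)) (hx : ∀ a i p, x a i p ≠ 0)
    (hxy : phi x = phi y) : MM x Set.univ ≤ MM y Set.univ := by
  classical
  rintro _ ⟨v, -, rfl⟩
  let μ : Fin m → Fin s → Ω := fun a i => v a i (τ a i) / x a i (τ a i)
  let μ' : Fin m → Fin s → Ω := fun a => update (μ a) i0 (- ∑ i ∈ univ.erase i0, μ a i)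
  let d : Fin m → Par n Ω := fun a => v a - fun i => μ' a i • x a i
  have hd : ∀ a, dten (x a) (d a) = dten (x a) (v a) := by
    intro a
    simp only [d]
    rw [map_sub, dten_mu]
    have : ∑ i, μ' a i = 0 := by
      rw [← Finset.add_sum_erase univ _ (mem_univ i0)]
      simp only [μ', update_self]
      rw [neg_add_eq_zero]
      refine Finset.sum_congr rfl fun i hi => ?_
      rw [update_of_ne (Finset.ne_of_mem_erase hi)]
    rw [this, zero_smul, sub_zero]
  obtain ⟨D, hD⟩ := hch.der hz d
  have hDx : ∀ a, pmap D (x a) = d a := by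
    intro a
    funext i p
    rw [pmap, hD]
    split_ifs with h
    · rfl
    · push Not at h
      obtain ⟨h1, h2⟩ := h
      simp only [d, μ', Pi.sub_apply, update_of_ne h1, Pi.smul_apply, smul_eq_mul, μ, h2]
      have := hx a i (τ a i)
      field_simp
      simp
  refine ⟨fun b => pmap D (y b), by simp, ?_⟩
  funext t
  have h1 := der_phi D x t
  rw [hxy, der_phi] at h1
  rw [Finset.sum_apply, Finset.sum_apply, h1]
  exact Finset.sum_congr rfl fun a _ => by rw [hDx, hd]

lemma chart_span {i0 : Fin s} {m : ℕ} {τ : Fin m → Idx n} {c : Fin m → Par n K}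
    {x y : Fin m → Par n Ω} (hch : IsChart K i0 τ c x)
    (hz : AlgebraicIndependent K (zc i0 τ x)) (hgy : Good y)
    (hMM : MM x Set.univ = MM y Set.univ)
    (hxy : phi x = phi y) (a : Fin m) : ∃ ν : Fin m → Ω, ten (x a) = ∑ b, ν b • ten (y b) := by
  classical
  obtain ⟨D, hD⟩ := hch.der hz (fun b i => if b = a ∧ i = i0 then x b i else 0)
  let μ : Fin m → Fin s → Ω := fun b i => if b = a ∧ i = i0 then 1 else 0
  have hDx : ∀ b, pmap D (x b) = fun i => μ b i • x b i := by
    intro b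
    funext i p
    rw [pmap, hD]
    simp only [μ]
    by_cases h : b = a ∧ i = i0
    · simp [h]
    · simp [h]
  have hDM : ∀ z ∈ MM x Set.univ, (fun t => D (z t)) ∈ MM x Set.univ := by
    rintro _ ⟨v, -, rfl⟩
    have : (fun t => D ((∑ b, dten (x b) (v b)) t)) =
        ∑ b, (dten (x b) (pmap D (v b)) + II (x b) (v b) (pmap D (x b))) := by
      funext t
      rw [Finset.sum_apply, map_sum, Finset.sum_apply]
      exact Finset.sum_congr rfl fun b _ => by rw [der_dten]; rfl
    rw [this]
    refine Submodule.sum_mem _ fun b _ => ?_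
    rw [hDx, II_mu]
    exact add_mem (dten_mem_MM x (Set.mem_univ b) _) (dten_mem_MM x (Set.mem_univ b) _)
  have hU : ∀ b, pmap D (y b) ∈ UU (y b) := by
    intro b
    apply hgy.g2 b
    intro w
    have h1 : (fun t => D (dten (y b) w t)) ∈ MM y Set.univ := by
      rw [← hMM]; apply hDM; rw [hMM]; exact dten_mem_MM y (Set.mem_univ b) _
    have h2 : (fun t => D (dten (y b) w t)) = dten (y b) (pmap D w) + II (y b) w (pmap D (y b)) := by
      funext t; rw [der_dten]; rfl
    rw [h2] at h1
    have := sub_mem h1 (dten_mem_MM y (Set.mem_univ b) (pmap D w))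
    rwa [add_sub_cancel_left] at this
  choose ν hν using fun b => UU_exists
    (fun i h => hgy.nz b i 0 (by rw [h]; rfl)) (hU b)
  refine ⟨fun b => ∑ i, ν b i, ?_⟩
  funext t
  have h1 := der_phi D x t
  rw [hxy, der_phi] at h1
  rw [Finset.sum_apply]
  have h2 : ∀ b, dten (x b) (pmap D (x b)) t = if b = a then ten (x b) t else 0 := by
    intro b
    rw [hDx, dten_mu]
    by_cases h : b = a
    · simp [μ, h]
    · simp [μ, h]
  simp only [h2, Finset.sum_ite_eq', mem_univ, if_true] at h1
  rw [← h1]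
  exact Finset.sum_congr rfl fun b _ => by rw [hν b, dten_mu]

theorem omega_match (i0 : Fin s) {m : ℕ} (g : MvPolynomial (Vr n m) K) (hg : g ≠ 0)
    (hgood : ∀ (Ω : Type uK) [Field Ω] [Algebra K Ω] (x : Fin m → Par n Ω), ev K x g ≠ 0 → Good x)
    (x y : Fin m → Par n Ω) (hxy : phi x = phi y)
    (ht : TrGe K (phi x) (m * (∑ i, n i + 1))) :
    (∀ c : Fin m → Ω, ∑ a, c a • ten (x a) = 0 → ∀ a, c a = 0) ∧
      ∀ b, ∃ (a : Fin m) (μ : Ω), ten (y b) = μ • ten (x a) := by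
  obtain ⟨c, hc⟩ := ev_exists_ne hg
  have hcnz := (hgood K c hc).nz
  obtain ⟨τ, x', hx', hchx⟩ := chart_exists (K := K) i0 x c hcnz
  obtain ⟨σ, y', hy', hchy⟩ := chart_exists (K := K) i0 y c hcnz
  have hchx : IsChart K i0 τ c x' := hchx
  have hchy : IsChart K i0 σ c y' := hchy
  have e1 : phi x' = phi x := by simp only [phi, hx']
  have e2 : phi y' = phi y := by simp only [phi, hy']
  obtain ⟨zx, -⟩ := hchx.rank (by rw [e1]; exact ht)
  obtain ⟨zy, -⟩ := hchy.rank (by rw [e2, ← hxy]; exact ht)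
  have gx := hgood Ω x' (hchx.ne zx g hc)
  have gy := hgood Ω y' (hchy.ne zy g hc)
  have e : phi x' = phi y' := by rw [e1, e2, hxy]
  have hMM : MM x' Set.univ = MM y' Set.univ :=
    le_antisymm (chart_MM_le hchx zx gx.nz e) (chart_MM_le hchy zy gy.nz e.symm)
  constructor
  · intro c hc
    exact gx.g1.indep i0 gx.nz c (by simpa only [hx'] using hc)
  · intro b
    obtain ⟨ν, hν⟩ := chart_span hchy zy gx hMM.symm e.symm b
    obtain ⟨a, μ, h⟩ := rank_one_match gx.g1 gx.nz (y' b) (gy.nz b) ν hν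
    exact ⟨a, μ, by rw [← hx', ← hy', h]⟩

end om

end part8

section part9
set_option linter.unusedSectionVars false
set_option linter.unusedVariables false
open Finset Function


section tr
variable {s : ℕ} {n : Fin s → ℕ} {K : Type uK} [Field K]

lemma transfer {τ : Type} (E : Set (MvPolynomial τ K)) (q : Idx n → MvPolynomial τ K) (m : ℕ)
    (H : ∀ (Ω : Type uK) [Field Ω] [Algebra K Ω] (ω : τ → Ω),
      (∀ e ∈ E, MvPolynomial.aeval ω e = 0) →
      Gen K m (fun t => MvPolynomial.aeval ω (q t)) → False) :
    ∃ h, h ∉ PI K n m ∧ ∀ ω : τ → K, (∀ e ∈ E, MvPolynomial.aeval ω e = 0) →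
      MvPolynomial.aeval (fun t => MvPolynomial.aeval ω (q t)) h = 0 := by
  classical
  let θ : MvPolynomial (Idx n) K →ₐ[K] MvPolynomial τ K := MvPolynomial.aeval q
  have hθ : ∀ {S : Type uK} [CommRing S] [Algebra K S] (ω : τ → S) (f : MvPolynomial (Idx n) K),
      MvPolynomial.aeval ω (θ f) =
        MvPolynomial.aeval (fun t => MvPolynomial.aeval ω (q t)) f := by
    intro S _ _ ω f
    have : (MvPolynomial.aeval ω).comp θ =
      MvPolynomial.aeval (fun t => MvPolynomial.aeval ω (q t)) := by
      apply MvPolynomial.algHom_ext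
      intro t; simp [θ]
    exact DFunLike.congr_fun this f
  by_cases hd : Disjoint (Ideal.span E : Set (MvPolynomial τ K))
      ((PI K n m).primeCompl.map (θ : _ →* MvPolynomial τ K) : Set (MvPolynomial τ K))
  · exfalso
    obtain ⟨P, hP, hle, hdis⟩ := Ideal.exists_le_prime_disjoint _ _ hd
    let Q := MvPolynomial τ K ⧸ P
    let Ω := FractionRing Q
    let ω : τ → Ω := fun i => algebraMap Q Ω (Ideal.Quotient.mk P (MvPolynomial.X i))
    have hω : ∀ f, MvPolynomial.aeval ω f = algebraMap Q Ω (Ideal.Quotient.mk P f) := by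
      intro f
      have : (MvPolynomial.aeval ω : MvPolynomial τ K →ₐ[K] Ω) =
          (IsScalarTower.toAlgHom K Q Ω).comp (Ideal.Quotient.mkₐ K P) := by
        apply MvPolynomial.algHom_ext
        intro t; simp [ω]; rfl
      rw [this]; rfl
    have hω0 : ∀ f, MvPolynomial.aeval ω f = 0 ↔ f ∈ P := by
      intro f
      rw [hω, map_eq_zero_iff _ (IsFractionRing.injective Q Ω), Ideal.Quotient.eq_zero_iff_mem]
    refine H Ω ω (fun e he => (hω0 e).2 (hle (Ideal.subset_span he))) ?_
    intro f hf
    rw [← hθ, hω0] at hf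
    by_contra hcon
    exact Set.disjoint_left.1 hdis hf ⟨f, hcon, rfl⟩
  · rw [Set.not_disjoint_iff] at hd
    obtain ⟨_, h1, ⟨h, hh, rfl⟩⟩ := hd
    refine ⟨h, hh, fun ω hω => ?_⟩
    rw [← hθ]
    have : Ideal.span E ≤ RingHom.ker (MvPolynomial.aeval ω : MvPolynomial τ K →ₐ[K] K) :=
      Ideal.span_le.2 fun e he => hω e he
    exact this h1

lemma exist_dec [IsAlgClosed K] (m : ℕ) :
    ∃ h, h ∉ PI K n m ∧ ∀ v : Idx n → K, (∀ f ∈ PI K n m, MvPolynomial.eval v f = 0) →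
      MvPolynomial.eval v h ≠ 0 → ∃ x : Fin m → Par n K, phi x = v := by
  classical
  let F : MvPolynomial (Idx n) K →+* MvPolynomial (Vr n m) K :=
    (MvPolynomial.aeval (phi (Xg K n m)) : MvPolynomial (Idx n) K →ₐ[K] _).toRingHom
  have hF : F.FinitePresentation := by
    rw [← RingHom.FinitePresentation.of_finiteType]
    have h1 : (F.comp (MvPolynomial.C : K →+* MvPolynomial (Idx n) K)).FiniteType := by
      have : F.comp (MvPolynomial.C : K →+* MvPolynomial (Idx n) K) =
          algebraMap K (MvPolynomial (Vr n m) K) := by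
        ext a; simp [F]
      rw [this, RingHom.finiteType_algebraMap]
      infer_instance
    exact RingHom.FiniteType.of_comp_finiteType h1
  obtain ⟨S, hS⟩ := PrimeSpectrum.exists_constructibleSetData_iff.2
    (PrimeSpectrum.isConstructible_range_comap hF)
  let p0 : PrimeSpectrum (MvPolynomial (Idx n) K) := ⟨PI K n m, inferInstance⟩
  have h0 : p0 ∈ Set.range (PrimeSpectrum.comap F) := by
    refine ⟨⟨⊥, Ideal.isPrime_bot⟩, ?_⟩
    ext f
    simp [p0, PI, F, RingHom.mem_ker]
  rw [← hS, PrimeSpectrum.ConstructibleSetData.toSet] at h0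
  simp only [Set.mem_iUnion] at h0
  obtain ⟨C, hC, hp, hf⟩ := h0
  refine ⟨C.f, ?_, ?_⟩
  · intro h; apply hf; rw [PrimeSpectrum.mem_zeroLocus]; simpa [p0] using h
  intro v hv hvf
  let pv : PrimeSpectrum (MvPolynomial (Idx n) K) :=
    ⟨RingHom.ker (MvPolynomial.eval v), RingHom.ker_isPrime _⟩
  have h1 : pv ∈ Set.range (PrimeSpectrum.comap F) := by
    rw [← hS, PrimeSpectrum.ConstructibleSetData.toSet]
    simp only [Set.mem_iUnion]
    refine ⟨C, hC, ?_, ?_⟩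
    · rw [PrimeSpectrum.mem_zeroLocus] at hp ⊢
      exact fun g hg => hv g (hp hg)
    · rw [PrimeSpectrum.mem_zeroLocus]
      intro h
      exact hvf (h (Set.mem_singleton _))
  obtain ⟨P, hP⟩ := h1
  obtain ⟨M, hM, hPM⟩ := Ideal.exists_le_maximal P.asIdeal P.isPrime.ne_top
  obtain ⟨z, hz⟩ := MvPolynomial.isMaximal_iff_eq_vanishingIdeal_singleton.1 hM
  refine ⟨fun a i p => z (a, ⟨i, p⟩), ?_⟩
  funext t
  have h2 : (MvPolynomial.X t - MvPolynomial.C (v t) : MvPolynomial (Idx n) K) ∈ pv.asIdeal := by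
    change MvPolynomial.eval v _ = 0
    simp
  rw [← hP] at h2
  have h3 := hPM h2
  rw [hz] at h3
  have h4 := (MvPolynomial.mem_vanishingIdeal_singleton_iff _ _).1 h3
  have h5 := aeval_phi (K := K) (fun a i p => z (a, ⟨i, p⟩))
    (MvPolynomial.X t - MvPolynomial.C (v t) : MvPolynomial (Idx n) K)
  have h6 : phi (fun a i p => z (a, ⟨i, p⟩)) t - v t = 0 := by
    refine Eq.trans ?_ h4
    refine Eq.trans ?_ h5
    simp
  exact sub_eq_zero.1 h6


lemma aeval_phiX {τ : Type} {m : ℕ} {Ω : Type*} [Field Ω] [Algebra K Ω] (ω : τ → Ω)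
    (x : Fin m → Par n (MvPolynomial τ K)) (t : Idx n) :
    MvPolynomial.aeval ω (phi x t) = phi (fun a i p => MvPolynomial.aeval ω (x a i p)) t :=
  phi_map (MvPolynomial.aeval ω : MvPolynomial τ K →ₐ[K] Ω).toRingHom x t

lemma aeval_tenX {τ : Type} {Ω : Type*} [Field Ω] [Algebra K Ω] (ω : τ → Ω)
    (x : Par n (MvPolynomial τ K)) (t : Idx n) :
    MvPolynomial.aeval ω (ten x t) = ten (fun i p => MvPolynomial.aeval ω (x i p)) t := by
  rw [ten_apply, ten_apply, map_prod]

variable [CharZero K]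

lemma dep_h (m : ℕ)
    (HM : ∀ (Ω : Type uK) [Field Ω] [Algebra K Ω] (x y : Fin m → Par n Ω), phi x = phi y →
      Gen K m (phi x) → (∀ c : Fin m → Ω, ∑ a, c a • ten (x a) = 0 → ∀ a, c a = 0) ∧
      ∀ b, ∃ (a : Fin m) (μ : Ω), ten (y b) = μ • ten (x a)) :
    ∃ h, h ∉ PI K n m ∧ ∀ x : Fin m → Par n K, MvPolynomial.aeval (phi x) h ≠ 0 →
      ∀ c : Fin m → K, ∑ a, c a • ten (x a) = 0 → ∀ a, c a = 0 := by
  classical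
  have key : ∀ a0 : Fin m, ∃ h, h ∉ PI K n m ∧ ∀ x : Fin m → Par n K,
      ∀ c : Fin m → K, ∑ a, c a • ten (x a) = 0 → c a0 = 1 →
        MvPolynomial.aeval (phi x) h = 0 := by
    intro a0
    let X : Fin m → Par n (MvPolynomial (Vr n m ⊕ Fin m) K) :=
      fun a i p => MvPolynomial.X (Sum.inl (a, ⟨i, p⟩))
    let L : Fin m → MvPolynomial (Vr n m ⊕ Fin m) K := fun a => MvPolynomial.X (Sum.inr a)
    obtain ⟨h, hh, h1⟩ := transfer (insert (L a0 - 1)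
      (Set.range fun t => ∑ a, L a * ten (X a) t)) (phi X) m (by
        intro Ω _ _ ω hE hg
        let x : Fin m → Par n Ω := fun a i p => ω (Sum.inl (a, ⟨i, p⟩))
        have e1 : (fun t => MvPolynomial.aeval ω (phi X t)) = phi x := by
          funext t; rw [aeval_phiX]; simp [X, x]
        rw [e1] at hg
        have h2 := (HM Ω x x rfl hg).1 (fun a => ω (Sum.inr a)) (by
          funext t
          have := hE _ (Set.mem_insert_of_mem _ ⟨t, rfl⟩)
          rw [map_sum] at this
          rw [Finset.sum_apply, Pi.zero_apply, ← this]
          refine Finset.sum_congr rfl fun a _ => ?_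
          rw [map_mul, aeval_tenX]; simp [L, X, x]) a0
        have h3 := hE _ (Set.mem_insert _ _)
        simp [L, h2] at h3)
    refine ⟨h, hh, fun x c hc hc0 => ?_⟩
    let ω : Vr n m ⊕ Fin m → K := Sum.elim (fun q => x q.1 q.2.1 q.2.2) c
    have e1 : (fun t => MvPolynomial.aeval ω (phi X t)) = phi x := by
      funext t; rw [aeval_phiX]; simp [X, ω]
    rw [← e1]
    apply h1
    rintro e (rfl | ⟨t, rfl⟩)
    · simp [L, ω, hc0]
    · have := congrFun hc t
      rw [Finset.sum_apply, Pi.zero_apply] at this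
      rw [map_sum, ← this]
      refine Finset.sum_congr rfl fun a _ => ?_
      rw [map_mul, aeval_tenX]; simp [L, X, ω]
  choose h hh hk using key
  refine ⟨∏ a, h a, ?_, ?_⟩
  · intro hcon
    obtain ⟨a, -, ha⟩ := (Ideal.IsPrime.prod_mem_iff (p := PI K n m)).1 hcon
    exact hh a ha
  · intro x hx c hc a
    by_contra hca
    rw [map_prod, Finset.prod_ne_zero_iff] at hx
    refine hx a (mem_univ a) (hk a x (fun b => (c a)⁻¹ * c b) ?_ (inv_mul_cancel₀ hca))
    simp only [mul_smul]
    rw [← Finset.smul_sum, hc, smul_zero]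

lemma match_h (m : ℕ)
    (HM : ∀ (Ω : Type uK) [Field Ω] [Algebra K Ω] (x y : Fin m → Par n Ω), phi x = phi y →
      Gen K m (phi x) → (∀ c : Fin m → Ω, ∑ a, c a • ten (x a) = 0 → ∀ a, c a = 0) ∧
      ∀ b, ∃ (a : Fin m) (μ : Ω), ten (y b) = μ • ten (x a)) :
    ∃ h, h ∉ PI K n m ∧ ∀ x y : Fin m → Par n K, phi x = phi y →
      MvPolynomial.aeval (phi x) h ≠ 0 →
      ∀ b, ∃ a, ∀ t t', ten (y b) t * ten (x a) t' = ten (y b) t' * ten (x a) t := by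
  classical
  have key : ∀ z : Fin m × (Fin m → Idx n × Idx n), ∃ h, h ∉ PI K n m ∧ ∀ x y : Fin m → Par n K,
      phi x = phi y → (∀ a, ten (y z.1) (z.2 a).1 * ten (x a) (z.2 a).2 ≠
          ten (y z.1) (z.2 a).2 * ten (x a) (z.2 a).1) →
        MvPolynomial.aeval (phi x) h = 0 := by
    rintro ⟨b, T⟩
    let τ := (Vr n m ⊕ Vr n m) ⊕ Unit
    let X : Fin m → Par n (MvPolynomial τ K) :=
      fun a i p => MvPolynomial.X (Sum.inl (Sum.inl (a, ⟨i, p⟩)))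
    let Y : Fin m → Par n (MvPolynomial τ K) :=
      fun a i p => MvPolynomial.X (Sum.inl (Sum.inr (a, ⟨i, p⟩)))
    let W : MvPolynomial τ K := MvPolynomial.X (Sum.inr ())
    obtain ⟨h, hh, h1⟩ := transfer (insert (W * ∏ a, (ten (Y b) (T a).1 * ten (X a) (T a).2
        - ten (Y b) (T a).2 * ten (X a) (T a).1) - 1)
      (Set.range fun t => phi X t - phi Y t)) (phi X) m (by
        intro Ω _ _ ω hE hg
        let x : Fin m → Par n Ω := fun a i p => ω (Sum.inl (Sum.inl (a, ⟨i, p⟩)))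
        let y : Fin m → Par n Ω := fun a i p => ω (Sum.inl (Sum.inr (a, ⟨i, p⟩)))
        have ex : ∀ a t, MvPolynomial.aeval ω (ten (X a) t) = ten (x a) t := by
          intro a t; rw [aeval_tenX]; simp [X, x]
        have ey : ∀ a t, MvPolynomial.aeval ω (ten (Y a) t) = ten (y a) t := by
          intro a t; rw [aeval_tenX]; simp [Y, y]
        have e1 : ∀ t, MvPolynomial.aeval ω (phi X t) = phi x t := by
          intro t; rw [aeval_phiX]; simp [X, x]
        have e2 : ∀ t, MvPolynomial.aeval ω (phi Y t) = phi y t := by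
          intro t; rw [aeval_phiX]; simp [Y, y]
        have e3 : phi x = phi y := by
          funext t
          have := hE _ (Set.mem_insert_of_mem _ ⟨t, rfl⟩)
          rw [map_sub, e1, e2, sub_eq_zero] at this
          exact this
        have h3 := hE _ (Set.mem_insert _ _)
        obtain ⟨a, μ, hμ⟩ := (HM Ω x y e3 (by rw [funext e1] at hg; exact hg)).2 b
        rw [map_sub, map_mul, map_prod, Finset.prod_eq_zero (mem_univ a)] at h3
        · simp at h3
        · rw [map_sub, map_mul, map_mul, ex, ex, ey, ey, hμ]
          simp only [Pi.smul_apply, smul_eq_mul]; ring)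
    refine ⟨h, hh, fun x y hxy hT => ?_⟩
    let w : K := (∏ a, (ten (y b) (T a).1 * ten (x a) (T a).2
        - ten (y b) (T a).2 * ten (x a) (T a).1))⁻¹
    let ω : τ → K := Sum.elim (Sum.elim (fun q => x q.1 q.2.1 q.2.2) (fun q => y q.1 q.2.1 q.2.2))
      (fun _ => w)
    have ex : ∀ a t, MvPolynomial.aeval ω (ten (X a) t) = ten (x a) t := by
      intro a t; rw [aeval_tenX]; simp [X, ω]
    have ey : ∀ a t, MvPolynomial.aeval ω (ten (Y a) t) = ten (y a) t := by
      intro a t; rw [aeval_tenX]; simp [Y, ω]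
    have e1 : ∀ t, MvPolynomial.aeval ω (phi X t) = phi x t := by
      intro t; rw [aeval_phiX]; simp [X, ω]
    have e2 : ∀ t, MvPolynomial.aeval ω (phi Y t) = phi y t := by
      intro t; rw [aeval_phiX]; simp [Y, ω]
    rw [← funext e1]
    apply h1
    rintro e (rfl | ⟨t, rfl⟩)
    · rw [map_sub, map_mul, map_prod, map_one, sub_eq_zero]
      simp only [map_sub, map_mul, ex, ey]
      have : MvPolynomial.aeval ω W = w := by simp [W, ω]
      rw [this]
      refine inv_mul_cancel₀ (Finset.prod_ne_zero_iff.2 fun a _ => ?_)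
      exact sub_ne_zero.2 (hT a)
    · rw [map_sub, e1, e2, hxy, sub_self]
  choose h hh hk using key
  refine ⟨∏ a, h a, ?_, ?_⟩
  · intro hcon
    obtain ⟨a, -, ha⟩ := (Ideal.IsPrime.prod_mem_iff (p := PI K n m)).1 hcon
    exact hh a ha
  · intro x y hxy hx b
    by_contra! hcon
    choose t t' htt using hcon
    rw [map_prod, Finset.prod_ne_zero_iff] at hx
    exact hx (b, fun a => (t a, t' a)) (mem_univ _) (hk _ x y hxy htt)

lemma exists_h [IsAlgClosed K] (i0 : Fin s) (m : ℕ) (g : MvPolynomial (Vr n m) K) (hg : g ≠ 0)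
    (hgood : ∀ (Ω : Type uK) [Field Ω] [Algebra K Ω] (x : Fin m → Par n Ω), ev K x g ≠ 0 → Good x)
    {Ω' : Type*} [Field Ω'] [Algebra K Ω'] (x' : Fin m → Par n Ω')
    (ht : TrGe K (phi x') (m * (∑ i, n i + 1))) :
    ∃ h, h ∉ PI K n m ∧ ∀ v : Idx n → K, (∀ f ∈ PI K n m, MvPolynomial.eval v f = 0) →
      MvPolynomial.eval v h ≠ 0 → (∃ x : Fin m → Par n K, phi x = v) ∧
      ∀ x : Fin m → Par n K, phi x = v →
        (∀ c : Fin m → K, ∑ a, c a • ten (x a) = 0 → ∀ a, c a = 0) ∧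
        ∀ y : Fin m → Par n K, phi y = v → ∀ b, ∃ a, ∃ μ : K, ten (y b) = μ • ten (x a) := by
  have HM := fun (Ω : Type uK) [Field Ω] [Algebra K Ω] (x y : Fin m → Par n Ω) (hxy : phi x = phi y)
    (hG : Gen K m (phi x)) => omega_match i0 g hg hgood x y hxy (TrGe_transfer hG ht)
  obtain ⟨h1, hh1, H1⟩ := exist_dec (K := K) (n := n) m
  obtain ⟨h2, hh2, H2⟩ := dep_h (K := K) (n := n) m HM
  obtain ⟨h3, hh3, H3⟩ := match_h (K := K) (n := n) m HM
  refine ⟨h1 * h2 * h3, ?_, ?_⟩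
  · intro h
    rcases (PI_prime K m).mem_or_mem h with h | h
    · rcases (PI_prime K m).mem_or_mem h with h | h
      · exact hh1 h
      · exact hh2 h
    · exact hh3 h
  intro v hv hvh
  rw [map_mul, map_mul] at hvh
  refine ⟨H1 v hv (left_ne_zero_of_mul (left_ne_zero_of_mul hvh)), ?_⟩
  rintro x rfl
  have d := H2 x (by
    rw [MvPolynomial.aeval_eq_eval]; exact right_ne_zero_of_mul (left_ne_zero_of_mul hvh))
  refine ⟨d, fun y hy b => ?_⟩
  obtain ⟨a, ha⟩ := H3 x y hy.symm (by
    rw [MvPolynomial.aeval_eq_eval]; exact right_ne_zero_of_mul hvh) b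
  refine ⟨a, ?_⟩
  have hne : ten (x a) ≠ 0 := by
    classical
    intro h0
    have := d (Pi.single a 1) (by
      rw [Finset.sum_eq_single a]
      · rw [h0, smul_zero]
      · intro b _ hb; rw [Pi.single_eq_of_ne hb, zero_smul]
      · simp) a
    rw [Pi.single_eq_same] at this
    exact one_ne_zero this
  obtain ⟨t0, h0⟩ := Function.ne_iff.1 hne
  rw [Pi.zero_apply] at h0
  refine ⟨ten (y b) t0 / ten (x a) t0, ?_⟩
  funext t
  rw [Pi.smul_apply, smul_eq_mul, div_mul_eq_mul_div, eq_div_iff h0]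
  exact ha t t0

end tr

end part9

section part10
set_option linter.unusedSectionVars false
set_option linter.unusedVariables false
open Finset Function


section ident
variable {s : ℕ} {n : Fin s → ℕ} {K : Type uK} [Field K]

lemma mk_segre (u : Par n K) (h : ten u ≠ 0) : Projectivization.mk K (ten u) h ∈ segreVariety K s n :=
  mem_segre.2 ⟨u, Projectivization.submodule_mk _ _⟩

lemma eq_mk_of_mem {ι : Type*} {p : PP K ι} {v : ι → K} (hv : v ≠ 0) (h : v ∈ p.submodule) :
    p = Projectivization.mk K v hv := by
  rw [Projectivization.submodule_eq] at h
  obtain ⟨c, hc⟩ := Submodule.mem_span_singleton.1 h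
  have hc0 : c ≠ 0 := by rintro rfl; rw [zero_smul] at hc; exact hv hc.symm
  rw [← Projectivization.mk_rep p, Projectivization.mk_eq_mk_iff']
  refine ⟨c⁻¹, ?_⟩
  rw [← hc, smul_smul, inv_mul_cancel₀ hc0, one_smul]

lemma indep_ne {m : ℕ} {x : Fin m → Par n K}
    (h : ∀ c : Fin m → K, ∑ a, c a • ten (x a) = 0 → ∀ a, c a = 0) (a : Fin m) : ten (x a) ≠ 0 := by
  classical
  intro h0
  have := h (Pi.single a 1) (by
    rw [Finset.sum_eq_single a]
    · rw [h0, smul_zero]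
    · intro b _ hb; rw [Pi.single_eq_of_ne hb, zero_smul]
    · simp) a
  rw [Pi.single_eq_same] at this
  exact one_ne_zero this

lemma indep_inj {m : ℕ} {x : Fin m → Par n K}
    (h : ∀ c : Fin m → K, ∑ a, c a • ten (x a) = 0 → ∀ a, c a = 0) :
    Injective (fun a => Projectivization.mk K (ten (x a)) (indep_ne h a)) := by
  classical
  intro a b hab
  by_contra hne
  rw [Projectivization.mk_eq_mk_iff'] at hab
  obtain ⟨c, hc⟩ := hab
  have := h (Pi.single a 1 - Pi.single b c) (by
    simp only [Pi.sub_apply, sub_smul, Finset.sum_sub_distrib]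
    rw [Finset.sum_eq_single a, Finset.sum_eq_single b]
    · simp [hc]
    · intro d _ hd; rw [Pi.single_eq_of_ne hd, zero_smul]
    · simp
    · intro d _ hd; rw [Pi.single_eq_of_ne hd, zero_smul]
    · simp) a
  rw [Pi.sub_apply, Pi.single_eq_same, Pi.single_eq_of_ne hne, sub_zero] at this
  exact one_ne_zero this

lemma dec_set {m : ℕ} {x : Fin m → Par n K}
    (h : ∀ c : Fin m → K, ∑ a, c a • ten (x a) = 0 → ∀ a, c a = 0) {q : PP K (Idx n)}
    (hv : phi x ∈ q.submodule) (hv0 : phi x ≠ 0) :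
    ∃ S : Finset (PP K (Idx n)), (S : Set _) ⊆ segreVariety K s n ∧ S.card = m ∧
      q ∈ projSpan (S : Set (PP K (Idx n))) ∧ ∀ a (p : PP K (Idx n)), ten (x a) ∈ p.submodule → p ∈ S := by
  classical
  refine ⟨univ.image (fun a => Projectivization.mk K (ten (x a)) (indep_ne h a)), ?_, ?_, ?_, ?_⟩
  · intro p hp
    simp only [coe_image, coe_univ, Set.image_univ, Set.mem_range] at hp
    obtain ⟨a, rfl⟩ := hp
    exact mk_segre _ _
  · rw [Finset.card_image_of_injective _ (indep_inj h), Finset.card_univ, Fintype.card_fin]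
  · change q.submodule ≤ vspan _
    intro w hw
    obtain ⟨c, rfl⟩ : ∃ c : K, w = c • phi x := by
      rw [eq_mk_of_mem hv0 hv, Projectivization.submodule_mk] at hw
      obtain ⟨c, hc⟩ := Submodule.mem_span_singleton.1 hw
      exact ⟨c, hc.symm⟩
    refine Submodule.smul_mem _ _ (Submodule.sum_mem _ fun a _ => Submodule.subset_span ?_)
    refine Set.mem_biUnion (x := Projectivization.mk K (ten (x a)) (indep_ne h a)) (by simp) ?_
    rw [Projectivization.submodule_mk]
    exact Submodule.mem_span_singleton_self _
  · intro a p hp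
    rw [eq_mk_of_mem (indep_ne h a) hp]
    exact Finset.mem_image_of_mem _ (mem_univ a)

theorem identifiable_of [Infinite K] (i0 : Fin s) (m : ℕ) (hm : 1 ≤ m) (h : MvPolynomial (Idx n) K)
    (hh : h ∉ PI K n m)
    (H : ∀ v : Idx n → K, (∀ f ∈ PI K n m, MvPolynomial.eval v f = 0) →
      MvPolynomial.eval v h ≠ 0 → (∃ x : Fin m → Par n K, phi x = v) ∧
      ∀ x : Fin m → Par n K, phi x = v →
        (∀ c : Fin m → K, ∑ a, c a • ten (x a) = 0 → ∀ a, c a = 0) ∧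
        ∀ y : Fin m → Par n K, phi y = v → ∀ b, ∃ a, ∃ μ : K, ten (y b) = μ • ten (x a)) :
    Identifiable (segreVariety K s n) m := by
  classical
  let a0 : Fin m := ⟨0, hm⟩
  have hne0 : ∀ x : Fin m → Par n K,
      (∀ c : Fin m → K, ∑ a, c a • ten (x a) = 0 → ∀ a, c a = 0) → phi x ≠ 0 := by
    intro x hx h0
    have := hx (fun _ => 1) (by simpa [phi] using h0) a0
    exact one_ne_zero this
  refine ⟨zeroLocus (Set.range fun d => MvPolynomial.homogeneousComponent d h),
    ⟨_, ?_, rfl⟩, ?_, ?_⟩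
  · rintro _ ⟨d, rfl⟩
    exact ⟨d, MvPolynomial.homogeneousComponent_isHomogeneous d h⟩
  · intro hsub
    obtain ⟨A, hA⟩ := ev_exists_ne (K := K) (f := MvPolynomial.aeval (phi (Xg K n m)) h) hh
    rw [← aeval_phi, MvPolynomial.aeval_eq_eval] at hA
    have hA : MvPolynomial.eval (phi A) h ≠ 0 := hA
    obtain ⟨hi, -⟩ := (H (phi A) (fun f hf => by
      have := PI_vanish A hf
      rwa [MvPolynomial.aeval_eq_eval] at this) hA).2 A rfl
    let q := Projectivization.mk K (phi A) (hne0 A hi)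
    have hq : phi A ∈ q.submodule := by
      rw [Projectivization.submodule_mk]; exact Submodule.mem_span_singleton_self _
    obtain ⟨S, hS, hc, hqS, -⟩ := dec_set hi hq (hne0 A hi)
    have h1 := hsub (subset_zclosure _ ⟨S, hS, hc, hqS⟩ : q ∈ secant m (segreVariety K s n))
    apply hA
    rw [← MvPolynomial.sum_homogeneousComponent h, map_sum]
    exact Finset.sum_eq_zero fun d _ => h1 _ ⟨d, rfl⟩ _ hq
  · rintro q ⟨hq, hqY⟩
    obtain ⟨v, hv, hvh⟩ : ∃ v ∈ q.submodule, MvPolynomial.eval v h ≠ 0 := by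
      by_contra! hcon
      apply hqY
      rintro _ ⟨d, rfl⟩ v hv
      exact hom_comp_vanish (fun c => hcon _ (q.submodule.smul_mem c hv)) d
    obtain ⟨⟨x, rfl⟩, hx⟩ := H v (fun f hf => PI_le_IC i0 m hf q hq v hv) hvh
    obtain ⟨hi, hmatch⟩ := hx x rfl
    have hv0 := hne0 x hi
    obtain ⟨S, hS, hc, hqS, hmem⟩ := dec_set hi hv hv0
    have hcard : ∀ S' : Finset (PP K (Idx n)), (S' : Set _) ⊆ segreVariety K s n →
        q ∈ projSpan (S' : Set (PP K (Idx n))) → m ≤ S'.card := by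
      intro S' hS' hqS'
      by_contra! hlt
      obtain ⟨y, hy, -, -, hz⟩ := vspan_fin i0 S' hS' hlt.le (hqS' hv)
      obtain ⟨a, ha⟩ := hz hlt
      exact indep_ne (hx y hy.symm).1 a ha
    have hrank : xrank (segreVariety K s n) q = m := by
      apply le_antisymm
      · exact Nat.sInf_le ⟨S, hS, hc, hqS⟩
      · obtain ⟨S', h1, h2, h3⟩ := Nat.sInf_mem
          (s := {k | ∃ S : Finset (PP K (Idx n)), ↑S ⊆ segreVariety K s n ∧ S.card = k ∧
            q ∈ projSpan (S : Set (PP K (Idx n)))}) ⟨m, S, hS, hc, hqS⟩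
        unfold xrank
        rw [← h2]
        exact hcard S' h1 h3
    refine ⟨S, ⟨hS, by rw [hrank, hc], hqS⟩, ?_⟩
    rintro S' ⟨h1, h2, h3⟩
    rw [hrank] at h2
    apply Finset.eq_of_subset_of_card_le ?_ (by rw [hc, h2])
    intro p hp
    obtain ⟨y, hy, hy1, -, -⟩ := vspan_fin i0 S' h1 h2.le (h3 hv)
    obtain ⟨b, hb⟩ := hy1 p hp
    obtain ⟨a, μ, hμ⟩ := hmatch y hy.symm b
    have hb0 := indep_ne (hx y hy.symm).1 b
    have hμ0 : μ ≠ 0 := by rintro rfl; rw [zero_smul] at hμ; exact hb0 hμ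
    refine hmem a p ?_
    have := p.submodule.smul_mem μ⁻¹ hb
    rwa [hμ, smul_smul, inv_mul_cancel₀ hμ0, one_smul] at this

end ident

end part10

section part11
set_option linter.unusedSectionVars false
set_option linter.unusedVariables false
open Finset Function


section scal
variable {s : ℕ} {n : Fin s → ℕ} {R : Type*} [CommRing R]

def sc (γ : Fin s → R) (u : Par n R) : Par n R := fun i => γ i • u i

lemma sc_update (γ : Fin s → R) (u : Par n R) (i : Fin s) (x : Fin (n i + 1) → R) :
    update (sc γ u) i (γ i • x) = sc γ (update u i x) := by
  funext l
  by_cases h : l = i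
  · subst h; simp [sc]
  · simp [sc, h]

lemma ten_sc (γ : Fin s → R) (u : Par n R) : ten (sc γ u) = (∏ i, γ i) • ten u :=
  (tenM n R).map_smul_univ γ u

lemma II_sc (γ : Fin s → R) (u w v : Par n R) :
    II (sc γ u) (sc γ w) (sc γ v) = (∏ i, γ i) • II u w v := by
  simp only [II_apply, Finset.smul_sum]
  refine Finset.sum_congr rfl fun i _ => Finset.sum_congr rfl fun j _ => ?_
  rw [← ten_sc, ← sc_update, ← sc_update]; rfl

lemma dten_sc (γ : Fin s → R) (u e : Par n R) :
    dten (sc γ u) e = dten u (fun i => (∏ l ∈ univ.erase i, γ l) • e i) := by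
  rw [dten_apply, dten_apply]
  refine Finset.sum_congr rfl fun i _ => ?_
  funext t
  rw [ten_update_apply, ten_update_apply]
  simp only [sc, Pi.smul_apply, smul_eq_mul, Finset.prod_mul_distrib]
  ring

end scal

section tang
variable {K : Type*} [Field K]

lemma chain_rule {τ : Type*} [Fintype τ] {R : Type*} [CommRing R] [Algebra K R]
    (D : Derivation K R R) (q : τ → R) (f : MvPolynomial τ K) :
    D (MvPolynomial.aeval q f) = ∑ t, MvPolynomial.aeval q (MvPolynomial.pderiv t f) * D (q t) := by
  classical
  induction f using MvPolynomial.induction_on with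
  | C a => simp
  | add f g hf hg => simp only [map_add, hf, hg, add_mul, Finset.sum_add_distrib]
  | mul_X f t hf =>
    rw [map_mul, D.leibniz, hf, MvPolynomial.aeval_X]
    simp only [Derivation.leibniz, map_add, smul_eq_mul, map_mul, MvPolynomial.aeval_X, add_mul,
      Finset.sum_add_distrib, MvPolynomial.pderiv_X]
    congr 1
    · rw [Finset.sum_eq_single t]
      · simp
      · intro b _ hb; simp [Ne.symm hb]
      · simp
    · rw [Finset.mul_sum]
      refine Finset.sum_congr rfl fun x _ => by ring

variable {s : ℕ} {n : Fin s → ℕ}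

/-- points of the cone over the Segre variety are pure tensors -/
lemma segre_ten (i0 : Fin s) {x : PP K (Idx n)} (hx : x ∈ segreVariety K s n) {v : Idx n → K}
    (hv : v ∈ x.submodule) : ∃ w : Par n K, v = ten w := by
  obtain ⟨u, hu⟩ := mem_segre.1 hx
  rw [hu] at hv
  obtain ⟨c, rfl⟩ := Submodule.mem_span_singleton.1 hv
  exact ⟨update u i0 (c • u i0), by rw [ten_smul_update, update_eq_self]⟩

lemma hvi_ten {f : MvPolynomial (Idx n) K} (hf : f ∈ homogVanishingIdeal (segreVariety K s n))
    (w : Par n K) (h0 : ten w ≠ 0) : MvPolynomial.eval (ten w) f = 0 :=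
  hf.2 _ (mk_segre w h0) _ (by rw [Projectivization.submodule_mk]; exact Submodule.mem_span_singleton_self _)

lemma hvi_ten' (i0 : Fin s) [Infinite K] {f : MvPolynomial (Idx n) K}
    (hf : f ∈ homogVanishingIdeal (segreVariety K s n))
    (w : Par n K) : MvPolynomial.eval (ten w) f = 0 := by
  by_cases h0 : ten w = 0
  · rw [h0]
    let w1 : Par n K := fun i p => 1
    have h1 : ten w1 ≠ 0 := ten_ne w1 (by simp [w1])
    exact hf.2 _ (mk_segre w1 h1) _ (Submodule.zero_mem _)
  · exact hvi_ten hf w h0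

lemma tan_a (i0 : Fin s) [Infinite K] {f : MvPolynomial (Idx n) K}
    (hf : f ∈ homogVanishingIdeal (segreVariety K s n)) (w e : Par n K) :
    ∑ t, dten w e t * MvPolynomial.eval (ten w) (MvPolynomial.pderiv t f) = 0 := by
  let y : Par n (Polynomial K) := fun i p => Polynomial.C (w i p) + Polynomial.X * Polynomial.C (e i p)
  have hev : ∀ (c : K) g, Polynomial.eval c (MvPolynomial.aeval (ten y) g)
      = MvPolynomial.eval (ten (pmap (Polynomial.evalRingHom c) y)) g := by
    intro c g
    have : Polynomial.eval c (MvPolynomial.aeval (ten y) g)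
      = Polynomial.aeval c (MvPolynomial.aeval (ten y) g) := by
        rw [Polynomial.coe_aeval_eq_eval]
    rw [this, ← AlgHom.comp_apply, MvPolynomial.comp_aeval, ← MvPolynomial.aeval_eq_eval]
    congr 2
    funext t
    rw [← ten_map]
    simp [Polynomial.coe_aeval_eq_eval]
  have h0 : MvPolynomial.aeval (ten y) f = 0 := by
    apply Polynomial.funext
    intro c
    rw [hev, hvi_ten' i0 hf]; simp
  have h1 := chain_rule (Polynomial.derivative' : Derivation K _ _) (ten y) f
  rw [h0, map_zero] at h1
  have h2 := congrArg (Polynomial.eval 0) h1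
  have hw : pmap (Polynomial.evalRingHom (0:K)) y = w := by funext i p; simp [pmap, y]
  rw [Polynomial.eval_finsetSum] at h2
  simp only [Polynomial.eval_mul, hev, hw, der_ten, Polynomial.eval_zero] at h2
  rw [h2]
  refine Finset.sum_congr rfl fun t _ => ?_
  rw [mul_comm]; congr 1
  have := dten_map (Polynomial.evalRingHom (0:K)) y (pmap (Polynomial.derivative' : Derivation K (Polynomial K) (Polynomial K)) y) t
  rw [hw, Polynomial.coe_evalRingHom] at this
  rw [this]
  have he : pmap (Polynomial.eval (0:K)) (pmap (Polynomial.derivative' : Derivation K (Polynomial K) (Polynomial K)) y) = e := by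
    funext i p
    simp [pmap, y, Polynomial.derivative']
  rw [he]

/-- minors -/
def minor (K : Type*) [Field K] (t0 t : Idx n) (i : Fin s) : MvPolynomial (Idx n) K :=
  MvPolynomial.X t * MvPolynomial.X t0 -
    MvPolynomial.X (update t i (t0 i)) * MvPolynomial.X (update t0 i (t i))

lemma ten_minor {R : Type*} [CommRing R] (w : Par n R) (t0 t : Idx n) (i : Fin s) :
    ten w t * ten w t0 = ten w (update t i (t0 i)) * ten w (update t0 i (t i)) := by
  rw [ten_at1, ten_at1, ten_apply, ten_apply, ← Finset.mul_prod_erase univ _ (mem_univ i),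
    ← Finset.mul_prod_erase univ (fun l => w l (t0 l)) (mem_univ i)]
  ring

lemma minor_hvi (i0 : Fin s) (t0 t : Idx n) (i : Fin s) :
    minor K t0 t i ∈ homogVanishingIdeal (segreVariety K s n) := by
  refine ⟨⟨2, ?_⟩, ?_⟩
  · exact MvPolynomial.IsHomogeneous.sub
      ((MvPolynomial.isHomogeneous_X _ _).mul (MvPolynomial.isHomogeneous_X _ _))
      ((MvPolynomial.isHomogeneous_X _ _).mul (MvPolynomial.isHomogeneous_X _ _))
  · intro x hx v hv
    obtain ⟨w, rfl⟩ := segre_ten i0 hx hv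
    simp [minor, ten_minor w t0 t i]

end tang

end part11

section part12
set_option linter.unusedSectionVars false
set_option linter.unusedVariables false
open Finset Function


section tang2
variable {s : ℕ} {n : Fin s → ℕ} {K : Type uK} [Field K]

lemma minor_lin (t0 t : Idx n) (i : Fin s) (a z : Idx n → K) :
    ∑ x, z x * MvPolynomial.eval a (MvPolynomial.pderiv x (minor K t0 t i)) =
      a t * z t0 + a t0 * z t -
      (a (update t i (t0 i)) * z (update t0 i (t i)) + a (update t0 i (t i)) * z (update t i (t0 i))) := by
  classical
  simp only [minor, map_sub, Derivation.leibniz, map_add, smul_eq_mul, map_mul, MvPolynomial.eval_X,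
    MvPolynomial.pderiv_X, mul_sub, mul_add, Finset.sum_sub_distrib, Finset.sum_add_distrib]
  have h : ∀ (b : K) (u : Idx n), ∑ x, z x * (b * MvPolynomial.eval a
      ((Pi.single x 1 : Idx n → MvPolynomial (Idx n) K) u)) = b * z u := by
    intro b u
    rw [Finset.sum_eq_single u]
    · simp [mul_comm]
    · intro x _ hx; rw [Pi.single_eq_of_ne (Ne.symm hx)]; simp
    · simp
  simp only [h]

lemma idx_induction (t0 : Idx n) (P : Idx n → Prop) (h0 : P t0)
    (hstep : ∀ t i, P (update t i (t0 i)) → P t) (t : Idx n) : P t := by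
  have key : ∀ S : Finset (Fin s), ∀ t : Idx n, (∀ i, i ∉ S → t i = t0 i) → P t := by
    intro S
    induction S using Finset.induction_on with
    | empty => intro t ht; rwa [show t = t0 from funext fun i => ht i (by simp)]
    | insert i S hi ih =>
      intro t ht
      apply hstep t i
      apply ih
      intro l hl
      by_cases h : l = i
      · subst h; simp
      · rw [update_of_ne h]; exact ht l (by simp [h, hl])
  exact key univ t (by simp)

lemma tan_b (i0 : Fin s) [Infinite K] (A : Par n K) (hA : ∀ i p, A i p ≠ 0) (z : Idx n → K)
    (hz : ∀ f ∈ homogVanishingIdeal (segreVariety K s n),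
      ∑ t, z t * MvPolynomial.eval (ten A) (MvPolynomial.pderiv t f) = 0) :
    ∃ v, z = dten A v := by
  let W : Submodule K (Idx n → K) :=
    { carrier := {z | ∀ f ∈ homogVanishingIdeal (segreVariety K s n),
        ∑ t, z t * MvPolynomial.eval (ten A) (MvPolynomial.pderiv t f) = 0}
      add_mem' := by
        intro x y hx hy f hf
        simp only [Pi.add_apply, add_mul, Finset.sum_add_distrib, hx f hf, hy f hf, add_zero]
      zero_mem' := by intro f hf; simp
      smul_mem' := by
        intro c x hx f hf
        simp only [Pi.smul_apply, smul_eq_mul, mul_assoc, ← Finset.mul_sum, hx f hf, mul_zero] }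
  have hdW : ∀ v, dten A v ∈ W := fun v f hf => tan_a i0 hf A v
  have hzW : z ∈ W := hz
  let t0 : Idx n := fun _ => 0
  have ha : ∀ t, ten A t ≠ 0 := fun t => by
    rw [ten_apply]; exact Finset.prod_ne_zero_iff.2 fun i _ => hA _ _
  let z1 : Idx n → K := z - dten A (Pi.single i0 ((z t0 / ten A t0) • A i0))
  have hz1t : z1 t0 = 0 := by
    simp only [z1, dten_single, ten_smul_update, update_eq_self, Pi.sub_apply, Pi.smul_apply,
      smul_eq_mul]
    rw [div_mul_cancel₀ _ (ha t0), sub_self]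
  let cc : Fin s → K := fun l => ∏ m ∈ univ.erase l, A m (t0 m)
  have hcc : ∀ l, cc l ≠ 0 := fun l => Finset.prod_ne_zero_iff.2 fun i _ => hA _ _
  let v : Par n K := fun l p => z1 (update t0 l p) / cc l
  let z2 : Idx n → K := z1 - dten A v
  have hv0 : ∀ l, v l (t0 l) = 0 := by
    intro l; simp only [v, update_eq_self, hz1t, zero_div]
  have hd : ∀ i p, dten A v (update t0 i p) = z1 (update t0 i p) := by
    intro i p
    rw [dten_apply, Finset.sum_apply, Finset.sum_eq_single i]
    · rw [ten_update_apply, update_self]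
      have : ∏ l ∈ univ.erase i, A l (update t0 i p l) = cc i :=
        Finset.prod_congr rfl fun l hl => by rw [update_of_ne (Finset.ne_of_mem_erase hl)]
      rw [this]
      exact div_mul_cancel₀ _ (hcc i)
    · intro l _ hl
      rw [ten_update_apply, update_of_ne hl, hv0, zero_mul]
    · simp
  have h2 : ∀ i p, z2 (update t0 i p) = 0 := by
    intro i p; simp only [z2, Pi.sub_apply, hd, sub_self]
  have h20 : z2 t0 = 0 := by have := h2 i0 (t0 i0); rwa [update_eq_self] at this
  have hz2W : z2 ∈ W := W.sub_mem (W.sub_mem hzW (hdW _)) (hdW _)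
  have hz2 : ∀ t, z2 t = 0 := by
    apply idx_induction t0 (fun t => z2 t = 0) h20
    intro t i ih
    have := hz2W _ (minor_hvi i0 t0 t i)
    rw [minor_lin, h20, h2, ih] at this
    simpa [ha t0] using this
  refine ⟨v + Pi.single i0 ((z t0 / ten A t0) • A i0), ?_⟩
  rw [map_add]
  funext t
  have := hz2 t
  simp only [z2, z1, Pi.sub_apply] at this
  simp only [Pi.add_apply]
  linear_combination this

lemma sc_inv_dten (γ : Fin s → K) (hγ : ∀ i, γ i ≠ 0) (u e : Par n K) :
    ∃ e', dten u e = dten (sc γ u) e' := by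
  refine ⟨fun i => (∏ l ∈ univ.erase i, γ l)⁻¹ • e i, ?_⟩
  rw [dten_sc]
  congr 1
  funext i
  rw [smul_smul, mul_inv_cancel₀, one_smul]
  exact Finset.prod_ne_zero_iff.2 fun l _ => hγ l

lemma smul_ten_sc (i0 : Fin s) (c : K) (u : Par n K) :
    c • ten u = ten (sc (update (fun _ => 1) i0 c) u) := by
  rw [ten_sc]
  congr 1
  rw [← Finset.mul_prod_erase univ _ (mem_univ i0), update_self, Finset.prod_eq_one, mul_one]
  intro i hi
  rw [update_of_ne (Finset.ne_of_mem_erase hi)]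

lemma upd_ne (i0 : Fin s) (c : K) (hc : c ≠ 0) (i : Fin s) :
    (update (fun _ => 1) i0 c : Fin s → K) i ≠ 0 := by
  by_cases h : i = i0
  · subst h; simpa
  · simp [h]

lemma rep_scale [Infinite K] {ι : Type*} [Fintype ι] {x : PP K ι} {v : ι → K} (hv : v ∈ x.submodule) (h0 : v ≠ 0) :
    ∃ c : K, c ≠ 0 ∧ x.rep = c • v := by
  obtain ⟨c, hc⟩ := mem_submodule_smul hv h0 (rep_mem x)
  refine ⟨c, ?_, hc⟩
  rintro rfl
  exact x.rep_nonzero (by simpa using hc)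

lemma emb_le (i0 : Fin s) [Infinite K] (A : Par n K) (hA : ∀ i p, A i p ≠ 0) {x y : PP K (Idx n)}
    (hx : ten A ∈ x.submodule) (hy : y ∈ embTangentSpace (segreVariety K s n) x) :
    ∃ v, y.rep = dten A v := by
  obtain ⟨c, hc, hr⟩ := rep_scale hx (ten_ne A hA)
  rw [smul_ten_sc i0] at hr
  set γ : Fin s → K := update (fun _ => 1) i0 c
  have hγ : ∀ i, γ i ≠ 0 := upd_ne i0 c hc
  obtain ⟨v, hv⟩ := tan_b i0 (sc γ A) (fun i p => by simp [sc, hγ i, hA i p]) y.rep (by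
    intro f hf; rw [← hr]; exact hy f hf)
  rw [dten_sc] at hv
  exact ⟨_, hv⟩

lemma vspan_emb_le (i0 : Fin s) [Infinite K] {m : ℕ} (A : Fin m → Par n K)
    (hA : ∀ a i p, A a i p ≠ 0) (u : Fin m → PP K (Idx n)) (hu : ∀ a, ten (A a) ∈ (u a).submodule) :
    vspan (⋃ a ∈ Set.range u, embTangentSpace (segreVariety K s n) a) ≤ MM A Set.univ := by
  refine Submodule.span_le.2 fun v hv => ?_
  simp only [coneOf, Set.mem_iUnion] at hv
  obtain ⟨y, ⟨x, ⟨a, rfl⟩, hy⟩, hv⟩ := hv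
  obtain ⟨w, hw⟩ := emb_le i0 (A a) (hA a) (hu a) hy
  have hv' : v ∈ y.submodule := hv
  obtain ⟨c, rfl⟩ := mem_submodule_smul (rep_mem y) y.rep_nonzero hv'
  rw [hw]
  exact Submodule.smul_mem _ _ (dten_mem_MM A (Set.mem_univ a) w)

lemma tang_mem (i0 : Fin s) [Infinite K] {m : ℕ} (A : Fin m → Par n K)
    (hA : ∀ a i p, A a i p ≠ 0) (u : Fin m → PP K (Idx n)) (hu : ∀ a, ten (A a) ∈ (u a).submodule)
    {x : PP K (Idx n)} (hx : x ∈ tangencyLocus (segreVariety K s n) (Set.range u))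
    (w : Par n K) (hw : ten w ∈ x.submodule) (hw0 : ten w ≠ 0) (e : Par n K) :
    dten w e ∈ MM A Set.univ := by
  by_cases h0 : dten w e = 0
  · rw [h0]; exact zero_mem _
  obtain ⟨c, hc, hr⟩ := rep_scale hw hw0
  rw [smul_ten_sc i0] at hr
  set γ : Fin s → K := update (fun _ => 1) i0 c
  have hγ : ∀ i, γ i ≠ 0 := upd_ne i0 c hc
  let y : PP K (Idx n) := Projectivization.mk K (dten w e) h0
  have hm : dten w e ∈ y.submodule := by
    rw [Projectivization.submodule_mk]; exact Submodule.mem_span_singleton_self _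
  have hy : y ∈ embTangentSpace (segreVariety K s n) x := by
    intro f hf
    obtain ⟨d, hd, hr2⟩ := rep_scale hm h0
    obtain ⟨e', he'⟩ := sc_inv_dten γ hγ w (d • e)
    rw [hr2, ← map_smul, he', hr]
    exact tan_a i0 hf _ _
  exact vspan_emb_le i0 A hA u hu (hx.2 hy hm)

end tang2

end part12

section part13
set_option linter.unusedSectionVars false
set_option linter.unusedVariables false
open Finset Function


section iso
variable {s : ℕ} {n : Fin s → ℕ} {K : Type uK} [Field K]

lemma inj_open {R Ω ρ κ : Type*} [CommRing R] [Algebra K R] [Field Ω] [Fintype κ] [DecidableEq κ]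
    (ψ0 : R →ₐ[K] K) (ψ : R →+* Ω) (hψ : ∀ f, ψ f = 0 → ψ0 f = 0) (L : ρ → κ → R)
    (h0 : ∀ v : κ → K, (∀ r, ∑ k, ψ0 (L r k) * v k = 0) → v = 0)
    (v : κ → Ω) (hv : ∀ r, ∑ k, ψ (L r k) * v k = 0) : v = 0 := by
  have hspan : Submodule.span K (Set.range fun r => fun k => ψ0 (L r k)) = ⊤ := by
    by_contra hne
    obtain ⟨f, hf0, hf⟩ := Submodule.exists_le_ker_of_lt_top _ (lt_top_iff_ne_top.2 hne)
    apply hf0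
    have hexp : ∀ x : κ → K, f x = ∑ k, x k * f (Pi.single k 1) := by
      intro x
      conv_lhs => rw [pi_eq_sum_univ' x, map_sum]
      refine Finset.sum_congr rfl fun k _ => ?_
      rw [map_smul, smul_eq_mul]
    have := h0 (fun k => f (Pi.single k 1)) (fun r => by
      rw [← hexp (fun k => ψ0 (L r k))]
      exact hf (Submodule.subset_span ⟨r, rfl⟩))
    apply LinearMap.ext
    intro x
    rw [hexp]
    simp [funext_iff] at this
    simp [this]
  have hc : ∀ k : κ, ∃ c : ρ →₀ K, ∀ k', (c.sum fun r a => a * ψ0 (L r k')) = (1 : Matrix κ κ K) k k' := by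
    intro k
    have : (1 : Matrix κ κ K) k ∈ Submodule.span K (Set.range fun r => fun k => ψ0 (L r k)) := by
      rw [hspan]; trivial
    obtain ⟨c, hc⟩ := Finsupp.mem_span_range_iff_exists_finsupp.1 this
    refine ⟨c, fun k' => ?_⟩
    rw [← hc]
    simp [Finsupp.sum, Finset.sum_apply]
  choose c hc using hc
  let N : Matrix κ κ R := fun k k' => (c k).sum fun r a => algebraMap K R a * L r k'
  have hN : ψ0 N.det = 1 := by
    rw [AlgHom.map_det]
    have : ψ0.mapMatrix N = 1 := by
      ext k k'
      rw [AlgHom.mapMatrix_apply, Matrix.map_apply, ← hc k k']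
      simp [N, Finsupp.sum, map_sum]
    rw [this, Matrix.det_one]
  have hdet : (ψ.mapMatrix N).det ≠ 0 := by
    rw [← RingHom.map_det]
    intro h
    have := hψ _ h
    rw [hN] at this
    exact one_ne_zero this
  apply Matrix.eq_zero_of_mulVec_eq_zero hdet
  funext k
  have hNe : ∀ k', ψ.mapMatrix N k k' = ∑ r ∈ (c k).support, ψ (algebraMap K R (c k r)) * ψ (L r k') := by
    intro k'
    rw [RingHom.mapMatrix_apply, Matrix.map_apply]
    simp only [N, Finsupp.sum, map_sum, map_mul]
  simp only [Matrix.mulVec, dotProduct, hNe, Finset.sum_mul, Pi.zero_apply]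
  rw [Finset.sum_comm]
  refine Finset.sum_eq_zero fun r _ => ?_
  simp only [mul_assoc]
  rw [← Finset.mul_sum, hv, mul_zero]

lemma alg_of_der_zero {Ω : Type*} [Field Ω] [Algebra K Ω] [IsAlgClosed K] [CharZero K] (z : Ω)
    (h : ∀ D : Derivation K Ω Ω, D z = 0) : ∃ c : K, algebraMap K Ω c = z := by
  have halg : IsAlgebraic K z := by
    by_contra hn
    have : AlgebraicIndependent K (fun _ : Unit => z) := algebraicIndependent_unique_type_iff.2 hn
    obtain ⟨D, hD⟩ := der_ext _ this (fun _ => 1)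
    have := hD ()
    rw [h D] at this
    exact zero_ne_one this
  have hi : IsIntegral K z := halg.isIntegral
  obtain ⟨c, hc⟩ := minpoly.mem_range_of_degree_eq_one K z
    (IsAlgClosed.degree_eq_one_of_irreducible K (minpoly.irreducible hi))
  exact ⟨c, hc⟩

/-- the recovered factors -/
def Yp (K : Type*) [Field K] (t0 : Idx n) : Par n (MvPolynomial (Idx n) K) :=
  fun i p => MvPolynomial.X (update t0 i p)

def ctr {R : Type*} [CommRing R] (w : Par n R) (t0 : Idx n) : Fin s → R :=
  fun i => ∏ l ∈ univ.erase i, w l (t0 l)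

lemma Yp_ten (t0 : Idx n) (w : Par n K) :
    pmap (MvPolynomial.eval (ten w)) (Yp K t0) = sc (ctr w t0) w := by
  funext i p
  simp [pmap, Yp, sc, ctr, ten_at1, mul_comm]

def perp {m : ℕ} (A : Fin m → Par n K) : Set (Idx n → K) :=
  {l | ∀ x ∈ MM A Set.univ, ∑ t, l t * x t = 0}

lemma mem_of_perp {m : ℕ} (A : Fin m → Par n K) (x : Idx n → K)
    (h : ∀ l ∈ perp A, ∑ t, l t * x t = 0) : x ∈ MM A Set.univ := by
  by_contra hx
  obtain ⟨f, hf0, hf⟩ := Submodule.exists_le_ker_of_notMem hx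
  have hexp : ∀ x : Idx n → K, f x = ∑ k, f (Pi.single k 1) * x k := by
    intro x
    conv_lhs => rw [pi_eq_sum_univ' x, map_sum]
    refine Finset.sum_congr rfl fun k _ => ?_
    rw [map_smul, smul_eq_mul, mul_comm]
  apply hf0
  rw [hexp]
  apply h
  intro y hy
  rw [← hexp]
  exact hf hy

lemma row_eval {R S : Type*} [CommRing R] [CommRing S] (φ : R →+* S) (Y e : Par n R)
    (l : Idx n → R) (v : Sg n → S) :
    ∑ k, φ (∑ t, l t * II Y e (eB k) t) * v k =
      ∑ t, φ (l t) * II (pmap φ Y) (pmap φ e) (fun i p => v ⟨i, p⟩) t := by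
  simp only [map_sum, map_mul, Finset.sum_mul, II_map, pmap_eB]
  rw [Finset.sum_comm]
  refine Finset.sum_congr rfl fun t _ => ?_
  rw [lin_eB_apply, Finset.mul_sum]
  refine Finset.sum_congr rfl fun k _ => ?_
  ring

lemma dten_zero_zero (hs : 2 ≤ s) (e : Par n K) : dten (0 : Par n K) e = 0 := by
  rw [dten_apply]
  refine Finset.sum_eq_zero fun i _ => ?_
  have : Nontrivial (Fin s) := Fin.nontrivial_iff_two_le.2 hs
  obtain ⟨j, hj⟩ := exists_ne i
  exact ten_zero _ j (by rw [update_of_ne hj]; rfl)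

lemma tan_IC (hs : 2 ≤ s) [Infinite K] {m : ℕ} (A : Fin m → Par n K) (hA : ∀ a i p, A a i p ≠ 0)
    (u : Fin m → PP K (Idx n)) (hu : ∀ a, ten (A a) ∈ (u a).submodule) (C : Set (PP K (Idx n)))
    (hC : C ⊆ tangencyLocus (segreVariety K s n) (Set.range u)) (t0 : Idx n)
    (l : Idx n → K) (hl : l ∈ perp A) (e : Par n K) :
    (∑ t, MvPolynomial.C (l t) * dten (Yp K t0) (pmap MvPolynomial.C e) t) ∈ IC C := by
  intro x hx v hv
  have i0 : Fin s := ⟨0, by omega⟩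
  obtain ⟨w, rfl⟩ := segre_ten i0 (hC hx).1.1 hv
  have h1 : MvPolynomial.eval (ten w) (∑ t, MvPolynomial.C (l t) * dten (Yp K t0) (pmap MvPolynomial.C e) t)
      = ∑ t, l t * dten (sc (ctr w t0) w) e t := by
    rw [map_sum]
    refine Finset.sum_congr rfl fun t _ => ?_
    rw [map_mul, MvPolynomial.eval_C, dten_map, Yp_ten]
    have he : pmap (MvPolynomial.eval (ten w)) (pmap MvPolynomial.C e) = e := by
      funext i p
      simp [pmap]
    rw [he]
  rw [h1]
  by_cases h0 : ten w = 0
  · have : sc (ctr w t0) w = 0 := by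
      rw [← Yp_ten, h0]
      funext i p
      simp [pmap, Yp]
    rw [this, dten_zero_zero hs]; simp
  · rw [dten_sc]
    exact hl _ (tang_mem i0 A hA u hu (hC hx) w hv h0 _)

/-- the linear system at the point `u b` has trivial kernel -/
lemma ker_at {m : ℕ} (A : Fin m → Par n K) (hG : Good A) (b : Fin m) (t0 : Idx n) (v : Par n K)
    (h : ∀ l ∈ perp A, ∀ e, ∑ t, l t * II (sc (ctr (A b) t0) (A b)) e v t = 0)
    (h' : ∀ i, v i (t0 i) = 0) : v = 0 := by
  set γ := ctr (A b) t0 with hγ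
  have hγ0 : ∀ i, γ i ≠ 0 := fun i => Finset.prod_ne_zero_iff.2 fun l _ => hG.nz _ _ _
  let v' : Par n K := sc (fun i => (γ i)⁻¹) v
  have hvv : v = sc γ v' := by
    funext i p; simp [v', sc, hγ0 i]
  have hZ : v' ∈ ZZ A Set.univ b := by
    intro w
    have hm := mem_of_perp A (II (sc γ (A b)) (sc γ w) v) (fun l hl => h l hl _)
    rw [hvv, II_sc] at hm
    exact (Submodule.smul_mem_iff _ (Finset.prod_ne_zero_iff.2 fun i _ => hγ0 i)).1 hm
  have hU := mem_UU.1 (hG.g2 b hZ)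
  have : v' = 0 := by
    funext i p
    have h1 := hU i p (t0 i)
    have h2 : v' i (t0 i) = 0 := by simp [v', sc, h' i]
    rw [h2, zero_mul] at h1
    exact (mul_eq_zero.1 h1).resolve_right (hG.nz _ _ _)
  rw [hvv, this]; funext i p; simp [sc]

end iso

end part13

section part14
set_option linter.unusedSectionVars false
set_option linter.unusedVariables false
open Finset Function


section iso2
variable {s : ℕ} {n : Fin s → ℕ} {K : Type uK} [Field K]

lemma der_ratio {m : ℕ} (A : Fin m → Par n K) (hG : Good A) (b : Fin m)
    {Ω : Type*} [Field Ω] [Algebra K Ω] (q : Idx n → Ω) (t0 : Idx n)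
    (hq : ∀ f, MvPolynomial.aeval q f = 0 → MvPolynomial.eval (ten (A b)) f = 0)
    (htan : ∀ l ∈ perp A, ∀ e : Par n K,
      MvPolynomial.aeval q (∑ t, MvPolynomial.C (l t) * dten (Yp K t0) (pmap MvPolynomial.C e) t) = 0)
    (D : Derivation K Ω Ω) (hq0 : q t0 ≠ 0) (i : Fin s) (p : Fin (n i + 1)) :
    D (q (update t0 i p)) = D (q t0) / q t0 * q (update t0 i p) := by
  classical
  let ψ : MvPolynomial (Idx n) K →+* Ω := (MvPolynomial.aeval q : _ →ₐ[K] Ω).toRingHom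
  let y : Par n Ω := fun i p => q (update t0 i p)
  have hψC : ∀ c, ψ (MvPolynomial.C c) = algebraMap K Ω c := fun c => by simp [ψ]
  have hy : pmap ψ (Yp K t0) = y := by
    funext i p; simp [pmap, Yp, ψ, y]
  have heC : ∀ e : Par n K, pmap ψ (pmap MvPolynomial.C e) = pmap (algebraMap K Ω) e := by
    intro e; funext i p; simp only [pmap, hψC]
  have h1 : ∀ l ∈ perp A, ∀ e : Par n K,
      ∑ t, algebraMap K Ω (l t) * dten y (pmap (algebraMap K Ω) e) t = 0 := by
    intro l hl e
    have := htan l hl e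
    change ψ _ = 0 at this
    simp only [map_sum, map_mul, dten_map, hy, hψC, heC] at this
    exact this
  have h2 : ∀ l ∈ perp A, ∀ e : Par n Ω, ∑ t, algebraMap K Ω (l t) * dten y e t = 0 := by
    intro l hl e
    have : ∀ t, algebraMap K Ω (l t) * dten y e t
        = ∑ k : Sg n, e k.1 k.2 * (algebraMap K Ω (l t) * dten y (eB k) t) := by
      intro t
      rw [lin_eB_apply, Finset.mul_sum]
      refine Finset.sum_congr rfl fun k _ => by ring
    simp only [this]
    rw [Finset.sum_comm]
    refine Finset.sum_eq_zero fun k _ => ?_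
    rw [← Finset.mul_sum]
    have h := h1 l hl (eB k)
    rw [pmap_eB] at h
    rw [h, mul_zero]
  have h3 : ∀ l ∈ perp A, ∀ e : Par n K,
      ∑ t, algebraMap K Ω (l t) * II y (pmap (algebraMap K Ω) e) (pmap D y) t = 0 := by
    intro l hl e
    have := congrArg D (h1 l hl e)
    rw [map_zero, map_sum] at this
    have hD0 : pmap D (pmap (algebraMap K Ω) e) = (0 : Par n Ω) := by
      funext i p; simp [pmap]
    simpa only [D.leibniz, D.map_algebraMap, der_dten, hD0, map_zero, smul_eq_mul, mul_zero,
      add_zero, Pi.zero_apply, zero_add] using this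
  let μ : Ω := D (q t0) / q t0
  let v : Par n Ω := pmap D y - fun i => μ • y i
  let L : ((perp A × Par n K) ⊕ Fin s) → Sg n → MvPolynomial (Idx n) K := fun r k =>
    match r with
    | .inl x => ∑ t, MvPolynomial.C (x.1.1 t) * II (Yp K t0) (pmap MvPolynomial.C x.2) (eB k) t
    | .inr i => if k = ⟨i, t0 i⟩ then 1 else 0
  have hL := inj_open (MvPolynomial.aeval (ten (A b)) : MvPolynomial (Idx n) K →ₐ[K] K) ψ
    (fun f hf => by rw [MvPolynomial.aeval_eq_eval]; exact hq f hf) L (by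
      intro w hw
      have hk := ker_at A hG b t0 (fun i p => w ⟨i, p⟩) (by
        intro l hl e
        have := hw (.inl (⟨l, hl⟩, e))
        simp only [L] at this
        have h4 := row_eval (MvPolynomial.eval (ten (A b))) (Yp K t0) (pmap MvPolynomial.C e)
          (fun t => MvPolynomial.C (l t)) w
        rw [Yp_ten] at h4
        have he : pmap (MvPolynomial.eval (ten (A b))) (pmap MvPolynomial.C e) = e := by
          funext i p; simp [pmap]
        rw [he] at h4
        simp only [MvPolynomial.eval_C] at h4
        rw [← h4]
        simpa only [MvPolynomial.aeval_eq_eval] using this) (by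
        intro i
        have := hw (.inr i)
        simpa [L] using this)
      funext k
      have := congrFun (congrFun hk k.1) k.2
      simpa using this) (fun k => v k.1 k.2) (by
      rintro (⟨⟨l, hl⟩, e⟩ | i)
      · simp only [L]
        rw [row_eval ψ (Yp K t0) (pmap MvPolynomial.C e) (fun t => MvPolynomial.C (l t))
          (fun k : Sg n => v k.1 k.2), hy, heC]
        simp only [hψC]
        have hv : (fun i p => v i p : Par n Ω) = pmap D y - fun i => (fun _ => μ) i • y i := rfl
        rw [hv, map_sub]
        simp only [Pi.sub_apply, mul_sub, Finset.sum_sub_distrib]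
        rw [h3 l hl e, II_mu, h2 l hl, sub_zero]
      · have : ∀ k : Sg n, ψ (L (.inr i) k) * v k.1 k.2 = if k = ⟨i, t0 i⟩ then v k.1 k.2 else 0 := by
          intro k; simp only [L]; split_ifs <;> simp
        simp only [this]
        rw [Finset.sum_ite_eq' univ (⟨i, t0 i⟩ : Sg n) (fun k => v k.1 k.2), if_pos (mem_univ _)]
        simp only [v, μ, y, pmap, Pi.sub_apply, Pi.smul_apply, smul_eq_mul, update_eq_self]
        rw [div_mul_cancel₀ _ hq0, sub_self])
  have := congrFun hL ⟨i, p⟩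
  simp only [v, μ, y, pmap, Pi.sub_apply, Pi.smul_apply, smul_eq_mul, Pi.zero_apply] at this
  exact sub_eq_zero.1 this

lemma isolated [IsAlgClosed K] [CharZero K] (hs : 2 ≤ s) {m : ℕ} (A : Fin m → Par n K) (hG : Good A)
    (u : Fin m → PP K (Idx n)) (hu : ∀ a, ten (A a) ∈ (u a).submodule) (C : Set (PP K (Idx n)))
    (hirr : IsZIrreducible C)
    (hC : C ⊆ tangencyLocus (segreVariety K s n) (Set.range u)) (b : Fin m) (hb : u b ∈ C) :
    C ⊆ {u b} := by
  have : Infinite K := inferInstance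
  have i0 : Fin s := ⟨0, by omega⟩
  have hP : (IC C).IsPrime := IC_prime hirr
  let B := MvPolynomial (Idx n) K ⧸ IC C
  let Ω := FractionRing B
  let q : Idx n → Ω := fun t => algebraMap B Ω (Ideal.Quotient.mk (IC C) (MvPolynomial.X t))
  have hae : ∀ f, MvPolynomial.aeval q f = algebraMap B Ω (Ideal.Quotient.mk (IC C) f) := by
    intro f
    have : (MvPolynomial.aeval q : MvPolynomial (Idx n) K →ₐ[K] Ω)
        = (IsScalarTower.toAlgHom K B Ω).comp (Ideal.Quotient.mkₐ K (IC C)) := by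
      apply MvPolynomial.algHom_ext
      intro t; simp [q]; rfl
    rw [this]; simp; rfl
  have hq : ∀ f, MvPolynomial.aeval q f = 0 ↔ f ∈ IC C := by
    intro f
    rw [hae, map_eq_zero_iff _ (IsFractionRing.injective B Ω), Ideal.Quotient.eq_zero_iff_mem]
  let t0 : Idx n := fun _ => 0
  have ha0 : ten (A b) t0 ≠ 0 := by
    rw [ten_apply]; exact Finset.prod_ne_zero_iff.2 fun i _ => hG.nz _ _ _
  have hq0 : q t0 ≠ 0 := by
    intro h
    have h1 : MvPolynomial.X t0 ∈ IC C := (hq _).1 (by rw [MvPolynomial.aeval_X]; exact h)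
    have := h1 _ hb _ (hu b)
    rw [MvPolynomial.eval_X] at this
    exact ha0 this
  have hrat : ∀ i p, ∃ c : K, q (update t0 i p) = algebraMap K Ω c * q t0 := by
    intro i p
    obtain ⟨c, hc⟩ := alg_of_der_zero (K := K) (q (update t0 i p) / q t0) (by
      intro D
      have h := der_ratio A hG b q t0 (fun f hf => (hq f).1 hf _ hb _ (hu b))
        (fun l hl e => (hq _).2 (tan_IC hs A hG.nz u hu C hC t0 l hl e)) D hq0 i p
      have h5 : D (q (update t0 i p)) = D (q (update t0 i p) / q t0 * q t0) := by
        rw [div_mul_cancel₀ _ hq0]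
      rw [h, D.leibniz, smul_eq_mul, smul_eq_mul] at h5
      have h6 : q t0 * D (q (update t0 i p) / q t0) = 0 := by
        have : D (q t0) / q t0 * q (update t0 i p) = q (update t0 i p) / q t0 * D (q t0) := by ring
        rw [this] at h5
        exact left_eq_add.1 h5
      exact (mul_eq_zero.1 h6).resolve_left hq0)
    exact ⟨c, by rw [hc, div_mul_cancel₀ _ hq0]⟩
  have hall : ∀ t, ∃ c : K, q t = algebraMap K Ω c * q t0 := by
    apply idx_induction t0 (fun t => ∃ c : K, q t = algebraMap K Ω c * q t0) ⟨1, by simp⟩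
    rintro t i ⟨c, hc⟩
    obtain ⟨c', hc'⟩ := hrat i (t i)
    refine ⟨c * c', ?_⟩
    have hm : minor K t0 t i ∈ IC C := fun x hx v hv => (minor_hvi i0 t0 t i).2 x (hC hx).1.1 v hv
    have := (hq _).2 hm
    simp only [minor, map_sub, map_mul, MvPolynomial.aeval_X, hc, hc'] at this
    apply mul_right_cancel₀ hq0
    rw [map_mul]
    linear_combination this
  choose c hc using hall
  have hlin : ∀ x ∈ C, ∀ v ∈ x.submodule, ∀ t, v t = c t * v t0 := by
    intro x hx v hv t
    have h1 : (MvPolynomial.X t - MvPolynomial.C (c t) * MvPolynomial.X t0 : MvPolynomial (Idx n) K) ∈ IC C := by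
      rw [← hq]
      simp only [map_sub, map_mul, MvPolynomial.aeval_X, MvPolynomial.aeval_C]
      rw [hc t, sub_self]
    have := h1 x hx v hv
    simpa [sub_eq_zero] using this
  intro x hx
  have hr := hlin x hx _ (rep_mem x)
  have hr0 : x.rep t0 ≠ 0 := by
    intro h
    apply x.rep_nonzero
    funext t
    rw [hr t, h, mul_zero]; rfl
  have hA := hlin _ hb _ (hu b)
  have hmem : ten (A b) ∈ x.submodule := by
    have : ten (A b) = (ten (A b) t0 / x.rep t0) • x.rep := by
      funext t
      rw [Pi.smul_apply, smul_eq_mul, hr t, hA t]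
      field_simp
    rw [this]
    exact Submodule.smul_mem _ _ (rep_mem x)
  have hne := ten_ne (A b) (hG.nz b)
  rw [Set.mem_singleton_iff, eq_mk_of_mem hne hmem, eq_mk_of_mem hne (hu b)]

end iso2

end part14

section part15
set_option linter.unusedSectionVars false
set_option linter.unusedVariables false
open Finset Function


section wd
variable {s : ℕ} {n : Fin s → ℕ} {K : Type uK} [Field K]

lemma sub_single_of_IC [Infinite K] {ι : Type*} [Fintype ι] (p : PP K ι) (Y : Set (PP K ι))
    (h : IC {p} ≤ IC Y) : Y ⊆ {p} := by
  intro x hx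
  have hr : ∀ i l, p.rep i * x.rep l = p.rep l * x.rep i := by
    intro i l
    have h1 : (MvPolynomial.C (p.rep i) * MvPolynomial.X l - MvPolynomial.C (p.rep l) * MvPolynomial.X i
        : MvPolynomial ι K) ∈ IC {p} := by
      intro y hy v hv
      rw [Set.mem_singleton_iff] at hy; subst hy
      obtain ⟨c, rfl⟩ := mem_submodule_smul (rep_mem y) y.rep_nonzero hv
      simp; ring
    have := h h1 x hx _ (rep_mem x)
    simpa [sub_eq_zero] using this
  obtain ⟨i, hi⟩ := Function.ne_iff.1 p.rep_nonzero
  have hi : p.rep i ≠ 0 := hi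
  have hx2 : x.rep = (x.rep i / p.rep i) • p.rep := by
    funext l
    rw [Pi.smul_apply, smul_eq_mul, div_mul_eq_mul_div, eq_div_iff hi]
    linear_combination hr i l
  have hm : x.rep ∈ p.submodule := by
    rw [hx2]; exact Submodule.smul_mem _ _ (rep_mem p)
  rw [Set.mem_singleton_iff, eq_mk_of_mem x.rep_nonzero (rep_mem x), eq_mk_of_mem x.rep_nonzero hm]

lemma zdim_finite [Infinite K] {ι : Type*} [Fintype ι] {m : ℕ} (u : Fin m → PP K ι)
    (U : Set (PP K ι)) (hU : U ⊆ Set.range u) : zdim (zclosure U) ≤ 0 := by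
  have key : ∀ Y : Set (PP K ι), IsZIrreducible Y → Y ⊆ zclosure (zclosure U) → ∃ a, Y = {u a} := by
    intro Y hY hYU
    have hP := IC_prime hY
    have h1 : IC (Set.range u) ≤ IC Y := by
      refine le_trans (IC_anti hU) ?_
      rw [← IC_zclosure U, ← IC_zclosure (zclosure U)]
      exact IC_anti hYU
    have h2 : (univ : Finset (Fin m)).inf (fun a => IC {u a}) ≤ IC Y := by
      refine le_trans ?_ h1
      intro f hf
      rw [Submodule.mem_finsetInf] at hf
      rintro x ⟨a, rfl⟩ v hv
      exact hf a (mem_univ a) _ rfl v hv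
    obtain ⟨a, -, ha⟩ := hP.inf_le'.1 h2
    exact ⟨a, (Set.Nonempty.subset_singleton_iff hY.1).1 (sub_single_of_IC _ _ ha)⟩
  unfold zdim
  rw [Order.krullDim_nonpos_iff_forall_isMax]
  rintro ⟨Y, hY⟩ ⟨Z, hZ⟩ hYZ
  obtain ⟨a, rfl⟩ := key Y hY.2.1 hY.2.2
  obtain ⟨b, rfl⟩ := key Z hZ.2.1 hZ.2.2
  have h : ({u a} : Set (PP K ι)) ⊆ {u b} := hYZ
  have : u a = u b := h rfl
  show ({u b} : Set (PP K ι)) ⊆ {u a}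
  rw [this]

lemma not_wd [IsAlgClosed K] [CharZero K] (hs : 2 ≤ s) (m : ℕ) (g : MvPolynomial (Vr n m) K)
    (hg : g ≠ 0) (hgood : ∀ x : Fin m → Par n K, ev K x g ≠ 0 → Good x) :
    ¬ WeaklyDefective (segreVariety K s n) m := by
  rintro ⟨T, ⟨S, hS, rfl⟩, ⟨u0, hu0, hu0T⟩, H⟩
  have : Infinite K := inferInstance
  have i0 : Fin s := ⟨0, by omega⟩
  simp only [multiZeroLocus, Set.mem_ofPred_eq, not_forall] at hu0T
  obtain ⟨f, hf, v, hv, hne⟩ := hu0T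
  choose w hw using fun a => segre_ten i0 (hu0 a) (hv a)
  let F : MvPolynomial (Vr n m) K :=
    MvPolynomial.aeval (fun p : Fin m × Idx n => ten (Xg K n m p.1) p.2) f
  have hF : ∀ x : Fin m → Par n K, ev K x F
      = MvPolynomial.eval (fun p : Fin m × Idx n => ten (x p.1) p.2) f := by
    intro x
    simp only [F]
    rw [← AlgHom.comp_apply, MvPolynomial.comp_aeval, ← MvPolynomial.aeval_eq_eval]
    congr 2
    funext p
    have := ten_map (ev K x : _ →+* K) (Xg K n m p.1) p.2
    rw [pmap_ev] at this
    exact this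
  have hF0 : F ≠ 0 := by
    intro h
    have := hF w
    rw [h, map_zero] at this
    apply hne
    rw [this]
    simp only [hw]
  obtain ⟨A, hA⟩ := ev_exists_ne (mul_ne_zero hF0 hg)
  rw [map_mul] at hA
  have hG := hgood A (right_ne_zero_of_mul hA)
  have hAF := left_ne_zero_of_mul hA
  have hne : ∀ a, ten (A a) ≠ 0 := fun a => ten_ne _ (hG.nz a)
  let u : Fin m → PP K (Idx n) := fun a => Projectivization.mk K (ten (A a)) (hne a)
  have hu : ∀ a, ten (A a) ∈ (u a).submodule := fun a => by
    simp only [u]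
    rw [Projectivization.submodule_mk]; exact Submodule.mem_span_singleton_self _
  have hpos := H u (fun a => mk_segre _ _) (fun hT => hAF (by
    rw [hF]; exact hT f hf (fun a => ten (A a)) hu))
  refine absurd hpos (not_lt.2 ?_)
  refine zdim_finite u _ ?_
  intro x hx
  simp only [Set.mem_iUnion] at hx
  obtain ⟨C, ⟨hC, ⟨y, hyC, ⟨b, rfl⟩⟩⟩, hx⟩ := hx
  exact ⟨b, (isolated hs A hG u hu C hC.1 hC.2.1 b hyC hx).symm⟩

end wd

end part15

section part16
set_option linter.unusedSectionVars false
set_option linter.unusedVariables false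
open Finset Function


lemma main_thm {K : Type uK} [Field K] [IsAlgClosed K] [CharZero K]
    (s : ℕ) (n : Fin s → ℕ) (hn : ∀ i, 0 < n i)
    (N r k : ℕ) (hN : N = ∑ i, n i) (hr : r + 1 = ∏ i, (n i + 1))
    (hpair : ∀ i : Fin s, ∃ j : Fin s, j ≠ i ∧ n j = n i)
    (hk : 1 ≤ k)
    (hsec : zdim (secant (k + N - 1) (segreVariety K s n)) =
      ((((k + N - 1) * (N + 1) - 1 : ℕ) : ℕ∞) : WithBot ℕ∞))
    (hlt : (k + N - 1) * (N + 1) - 1 < r) :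
    ∀ j : ℕ, 1 ≤ j → j ≤ k →
      ¬WeaklyDefective (segreVariety K s n) j ∧ Identifiable (segreVariety K s n) j := by
  intro j hj hjk
  have hinf : Infinite K := inferInstance
  have hs0 : 0 < s := by
    rcases Nat.eq_zero_or_pos s with h | h
    · subst h; simp at hr; omega
    · exact h
  have hs : 2 ≤ s := by
    obtain ⟨a, ha, -⟩ := hpair ⟨0, hs0⟩
    rcases a with ⟨a, ha'⟩
    have : a ≠ 0 := by intro h; apply ha; ext; exact h
    omega
  have i0 : Fin s := ⟨0, hs0⟩
  have hN1 : 1 ≤ N := by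
    rw [hN]
    exact le_trans (hn i0) (Finset.single_le_sum (f := n) (fun _ _ => Nat.zero_le _) (mem_univ i0))
  obtain ⟨l, hl⟩ : ∃ l, k + N - 1 = j + l := ⟨k + N - 1 - j, by omega⟩
  have hM1 : 1 ≤ (k + N - 1) * (N + 1) := Nat.mul_pos (by omega) (by omega)
  have hMk : j + l = k + ∑ i, n i - 1 := by rw [← hN, hl]
  rw [hl] at hsec hlt hM1
  have ht : TrGe K (phi (Ag K n (j + l))) ((j + l) * (∑ i, n i + 1)) := by
    apply TrGe_of_zdim i0
    rw [hsec, ← hN]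
    have : (j + l) * (N + 1) = ((j + l) * (N + 1) - 1) + 1 := by omega
    conv_lhs => rw [this]
    push_cast
    exact le_refl _
  have hcard : (j + l) * (∑ i, n i + 1) < Fintype.card (Idx n) := by
    rw [← hN]
    have : Fintype.card (Idx n) = ∏ i, (n i + 1) := by simp [Idx]
    omega
  have hG := Good_Ag (K := K) hs hn k (j + l) hk hMk ht hcard j (Fin.castAdd l)
    (Fin.castAdd_injective j l) (fun a => by rw [Fin.val_castAdd]; omega)
  have hinj : Injective (ev K (fun a : Fin j => Ag K n (j + l) (Fin.castAdd l a))) := by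
    have h1 := (algInd_Ag K n (j + l)).comp (fun q : Vr n j => (Fin.castAdd l q.1, q.2)) (by
      rintro ⟨a, q⟩ ⟨b, q'⟩ h
      simp only [Prod.mk.injEq] at h
      rw [Fin.castAdd_injective j l h.1, h.2])
    exact h1
  obtain ⟨g, hg, hgood⟩ := cert_Good.{uK} _ hinj hG
  refine ⟨not_wd hs j g hg (fun x hx => hgood K x hx), ?_⟩
  obtain ⟨h, hh, H⟩ := exists_h i0 j g hg (fun Ω _ _ x hx => hgood Ω x hx) _ (TrGe_restrict i0 _ ht)
  exact identifiable_of i0 j hj h hh H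


end part16

/-- **Theorem (ip3).**  Let `X ⊆ ℙ^r` be the Segre embedding of
`ℙ^{n 1} × ⋯ × ℙ^{n s}` (char `0`), with `N = ∑ n i` and `r = -1 + ∏ (n i + 1)`.
Assume that for each `i` there is `j ≠ i` with `n j = n i`, and that
`dim σ_{k+N-1}(X) = (k+N-1)(N+1) - 1 < r`.  Then `X` is not weakly `j`-defective
(hence it is `j`-identifiable) for every `j ≤ k`. -/
theorem statement11 {K : Type*} [Field K] [IsAlgClosed K] [CharZero K]
    (s : ℕ) (n : Fin s → ℕ) (hn : ∀ i, 0 < n i)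
    (N r k : ℕ) (hN : N = ∑ i, n i) (hr : r + 1 = ∏ i, (n i + 1))
    (hpair : ∀ i : Fin s, ∃ j : Fin s, j ≠ i ∧ n j = n i)
    (hk : 1 ≤ k)
    (hsec : zdim (secant (k + N - 1) (segreVariety K s n)) =
      ((((k + N - 1) * (N + 1) - 1 : ℕ) : ℕ∞) : WithBot ℕ∞))
    (hlt : (k + N - 1) * (N + 1) - 1 < r) :
    ∀ j : ℕ, 1 ≤ j → j ≤ k →
      ¬WeaklyDefective (segreVariety K s n) j ∧ Identifiable (segreVariety K s n) j := by
  exact main_thm s n hn N r k hN hr hpair hk hsec hlt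

end ContactLoci
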